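/- (Global well-posedness.) Let f̊ = (f̊⁺, f̊⁻) with f̊^± ∈ C¹_c(ℝ⁵; [0,∞)) be arbitrary initial data, and let A ∈ C_b([0,∞); C²_b(ℝ²; ℝ³)) be a given external magnetic vector potential with induced magnetic field B = curl_x A. Then there exists a unique global classical solution f = (f⁺, f⁻) of the two-and-one-half dimensional Vlasov–Poisson system with external field B on [0,∞) satisfying f^±(0) = f̊^± on ℝ²×ℝ³. -/

import Mathlib

open MeasureTheory Real

noncomputable section

abbrev E2 : Type := EuclideanSpace ℝ (Fin 2)
abbrev E3 : Type := EuclideanSpace ℝ (Fin 3)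

/-- Build a vector of `ℝ²` from its two coordinates. -/
def e2 (a b : ℝ) : E2 := (WithLp.equiv 2 (Fin 2 → ℝ)).symm ![a, b]

/-- Build a vector of `ℝ³` from its three coordinates. -/
def e3 (a b c : ℝ) : E3 := (WithLp.equiv 2 (Fin 3 → ℝ)).symm ![a, b, c]

/-- The cross product on `ℝ³`. -/
def cross (u v : E3) : E3 :=
  e3 (u 1 * v 2 - u 2 * v 1) (u 2 * v 0 - u 0 * v 2) (u 0 * v 1 - u 1 * v 0)

/-- Partial derivative of a scalar function on `ℝ²` in the `i`-th coordinate direction. -/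
def pd (g : E2 → ℝ) (i : Fin 2) (x : E2) : ℝ := fderiv ℝ g x (EuclideanSpace.single i 1)

/-- The curl of a vector potential `A` on `ℝ²` (regarded as independent of `x₃`):
`curl A = (∂₂A₃, -∂₁A₃, ∂₁A₂ - ∂₂A₁)`. -/
def curl2 (A : E2 → E3) (x : E2) : E3 :=
  e3 (pd (fun y => A y 2) 1 x) (-(pd (fun y => A y 2) 0 x))
     (pd (fun y => A y 1) 0 x - pd (fun y => A y 0) 1 x)

/-- The closed half-space of non-negative times in `ℝ_t × ℝ²_x × ℝ³_p`. -/
def S : Set (ℝ × E2 × E3) := {z | 0 ≤ z.1}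

/-- The charge density `ρ(t,x) = ∫ (f⁺ - f⁻)(t,x,p) dp`. -/
def chargeDensity (fp fm : ℝ × E2 × E3 → ℝ) (t : ℝ) (x : E2) : ℝ :=
  ∫ p : E3, (fp (t, x, p) - fm (t, x, p))

/-- The self-consistent electric potential `U(t,x) = -2 ∫ ρ(t,y) ln|x-y| dy`. -/
def potential (fp fm : ℝ × E2 × E3 → ℝ) (t : ℝ) (x : E2) : ℝ :=
  -2 * ∫ y : E2, chargeDensity fp fm t y * Real.log ‖x - y‖

/-- The Lorentz force `σ(-∂ₓU embedded in ℝ³ + p × B)` acting on the species of sign `sg`. -/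
def force (fp fm : ℝ × E2 × E3 → ℝ) (B : ℝ → E2 → E3) (sg t : ℝ) (x : E2) (p : E3) : E3 :=
  sg • (e3 (-(pd (potential fp fm t) 0 x)) (-(pd (potential fp fm t) 1 x)) 0
    + cross p (B t x))

/-- `(f⁺,f⁻)` is a classical solution of the two-and-one-half dimensional Vlasov–Poisson
system with external magnetic field `B` on `[0,∞)`: both functions are `C¹` on `S`,
non-negative, have bounded `(x,p)`-support at each time, and satisfy the Vlasov equations
`∂_t f^± + (p₁,p₂)·∂_x f^± ± (-∇ₓU + p×B)·∂_p f^± = 0`;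
the latter is encoded by differentiating along the direction `(1, (p₁,p₂), force)`. -/
structure IsClassicalSolution (B : ℝ → E2 → E3) (fp fm : ℝ × E2 × E3 → ℝ) : Prop where
  smooth_p : ContDiffOn ℝ 1 fp S
  smooth_m : ContDiffOn ℝ 1 fm S
  nonneg_p : ∀ z ∈ S, 0 ≤ fp z
  nonneg_m : ∀ z ∈ S, 0 ≤ fm z
  support_bounded : ∀ t : ℝ, 0 ≤ t →
    Bornology.IsBounded {zp : E2 × E3 | fp (t, zp.1, zp.2) ≠ 0 ∨ fm (t, zp.1, zp.2) ≠ 0}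
  vlasov_p : ∀ t : ℝ, 0 ≤ t → ∀ x : E2, ∀ p : E3,
    fderivWithin ℝ fp S (t, x, p) (1, e2 (p 0) (p 1), force fp fm B 1 t x p) = 0
  vlasov_m : ∀ t : ℝ, 0 ≤ t → ∀ x : E2, ∀ p : E3,
    fderivWithin ℝ fm S (t, x, p) (1, e2 (p 0) (p 1), force fp fm B (-1) t x p) = 0

/-- `A ∈ C_b([0,∞); C²_b(ℝ²;ℝ³))`: each `A(t)` is `C²`, the `x`-derivatives up to order two
are jointly continuous in `(t,x)`, and they are uniformly bounded for `t ≥ 0`. -/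
def IsAdmissiblePotential (A : ℝ → E2 → E3) : Prop :=
  (∀ t : ℝ, ContDiff ℝ 2 (A t)) ∧
  (∀ n : ℕ, n ≤ 2 → Continuous fun tx : ℝ × E2 => iteratedFDeriv ℝ n (A tx.1) tx.2) ∧
  ∃ C : ℝ, ∀ t : ℝ, 0 ≤ t → ∀ x : E2, ∀ n : ℕ, n ≤ 2 → ‖iteratedFDeriv ℝ n (A t) x‖ ≤ C

/-- `g ∈ C¹_c(ℝ⁵; [0,∞))`. -/
def IsInitialData (g : E2 × E3 → ℝ) : Prop :=
  ContDiff ℝ 1 g ∧ HasCompactSupport g ∧ ∀ z, 0 ≤ g z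

section
set_option linter.all false
namespace VP
open Set Filter Topology

section Flow
variable {F : Type*} [NormedAddCommGroup F] [NormedSpace ℝ F]

structure LipVF (V : ℝ → F → F) (K : NNReal) : Prop where
  cont : Continuous fun q : ℝ × F => V q.1 q.2
  lip : ∀ t, LipschitzWith K (V t)

lemma gronwallBound_le {δ K ε x : ℝ} (hK : 0 ≤ K) (hε : 0 ≤ ε) (hx : 0 ≤ x) (hδ : 0 ≤ δ) :
    gronwallBound δ K ε x ≤ (δ + ε * x) * exp (K * x) := by
  rcases hK.eq_or_lt with rfl | hK
  · simp [gronwallBound_K0]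
  · rw [gronwallBound_of_K_ne_0 hK.ne']
    have h1 : exp (K * x) - 1 ≤ K * x * exp (K * x) := by
      have := Real.add_one_le_exp (-(K * x))
      have h2 : exp (K*x) * exp (-(K*x)) = 1 := by rw [← Real.exp_add]; simp
      nlinarith [Real.exp_pos (K*x)]
    have h3 : ε / K * (exp (K * x) - 1) ≤ ε / K * (K * x * exp (K*x)) := by gcongr
    have h4 : ε / K * (K * x * exp (K*x)) = ε * x * exp (K * x) := by field_simp
    simp only
    linarith

lemma approx_fwd {V : ℝ → F → F} {K : NNReal} (hV : ∀ t, LipschitzWith K (V t)) {u v v' : ℝ → F} {T ε : ℝ}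
    (hT : 0 ≤ T)
    (hu : ∀ t, HasDerivAt u (V t (u t)) t) (hv : ∀ t, HasDerivAt v (v' t) t)
    (h : ∀ t ∈ Icc 0 T, ‖v' t - V t (v t)‖ ≤ ε) :
    ‖u T - v T‖ ≤ (‖u 0 - v 0‖ + ε * T) * exp (K * T) := by
  have hε : 0 ≤ ε := (norm_nonneg _).trans (h 0 ⟨le_rfl, hT⟩)
  have := dist_le_of_approx_trajectories_ODE (v := V) (f := u) (g := v) (f' := fun t => V t (u t)) (g' := v')
    (a := 0) (b := T) (εf := 0) (εg := ε) (δ := ‖u 0 - v 0‖) hV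
    (fun t _ => (hu t).continuousAt.continuousWithinAt) (fun t _ => (hu t).hasDerivWithinAt)
    (fun t _ => by simp) (fun t _ => (hv t).continuousAt.continuousWithinAt)
    (fun t _ => (hv t).hasDerivWithinAt) (fun t ht => by rw [dist_eq_norm]; exact h t ⟨ht.1, ht.2.le⟩)
    (by rw [dist_eq_norm]) T ⟨hT, le_rfl⟩
  rw [dist_eq_norm] at this
  refine this.trans ?_
  have := gronwallBound_le (δ := ‖u 0 - v 0‖) K.2 hε hT (norm_nonneg _)
  simpa using this

/-- Two-sided approximate trajectory estimate. -/
lemma approx {V : ℝ → F → F} {K : NNReal} (hV : ∀ t, LipschitzWith K (V t)) {u v v' : ℝ → F} {s T ε : ℝ}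
    (hu : ∀ t, HasDerivAt u (V t (u t)) t) (hv : ∀ t, HasDerivAt v (v' t) t)
    (h : ∀ t, |t - s| ≤ T → ‖v' t - V t (v t)‖ ≤ ε) {t : ℝ} (ht : |t - s| ≤ T) :
    ‖u t - v t‖ ≤ (‖u s - v s‖ + ε * |t - s|) * exp (K * |t - s|) := by
  rcases le_total s t with hst | hst
  · rw [abs_of_nonneg (sub_nonneg.2 hst)] at ht ⊢
    have := approx_fwd (V := fun τ => V (s + τ)) (K := K) (fun τ => hV _) (u := fun τ => u (s + τ))
      (v := fun τ => v (s + τ)) (v' := fun τ => v' (s + τ)) (T := t - s) (ε := ε) (by linarith)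
      (fun τ => by simpa using (hu (s + τ)).comp_const_add s τ) (fun τ => (hv (s + τ)).comp_const_add s τ)
      (fun τ hτ => h _ (by simp only [add_sub_cancel_left]; rw [abs_of_nonneg hτ.1]; linarith [hτ.2]))
    simpa using this
  · rw [abs_of_nonpos (sub_nonpos.2 hst)] at ht ⊢
    have := approx_fwd (V := fun τ z => - V (s - τ) z) (K := K) (fun τ => (hV _).neg) (u := fun τ => u (s - τ))
      (v := fun τ => v (s - τ)) (v' := fun τ => - v' (s - τ)) (T := -(t - s)) (ε := ε) (by linarith)
      (fun τ => (hu (s - τ)).comp_const_sub s τ) (fun τ => (hv (s - τ)).comp_const_sub s τ)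
      (fun τ hτ => by
        rw [neg_sub_neg, norm_sub_rev]
        exact h _ (by rw [show s - τ - s = -τ by ring, abs_neg, abs_of_nonneg hτ.1]; linarith [hτ.2]))
    simpa using this

lemma traj_le {V : ℝ → F → F} {K : NNReal} (hV : ∀ t, LipschitzWith K (V t)) {u v : ℝ → F}
    (hu : ∀ t, HasDerivAt u (V t (u t)) t) (hv : ∀ t, HasDerivAt v (V t (v t)) t) (s t : ℝ) :
    ‖u t - v t‖ ≤ ‖u s - v s‖ * exp (K * |t - s|) := by
  have := approx hV hu hv (s := s) (T := |t - s|) (ε := 0) (fun t _ => by simp) le_rfl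
  simpa using this

lemma traj_unique {V : ℝ → F → F} {K : NNReal} (hV : ∀ t, LipschitzWith K (V t)) {u v : ℝ → F}
    (hu : ∀ t, HasDerivAt u (V t (u t)) t) (hv : ∀ t, HasDerivAt v (V t (v t)) t) (s : ℝ) (h : u s = v s)
    (t : ℝ) : u t = v t := by
  have := traj_le hV hu hv s t
  rw [h] at this
  simpa [sub_eq_zero] using this

variable [CompleteSpace F]

lemma evt_deriv {V : ℝ → F → F} {g γ : ℝ → F} {t : ℝ} (h : g =ᶠ[𝓝 t] γ)
    (hγ : HasDerivAt γ (V t (γ t)) t) : HasDerivAt g (V t (g t)) t := by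
  rw [h.eq_of_nhds]; exact hγ.congr_of_eventuallyEq h

lemma local_sol {V : ℝ → F → F} {K : NNReal} (hV : LipVF V K) (s : ℝ) (z : F) :
    ∃ γ : ℝ → F, γ s = z ∧ ∀ t ∈ Ioo (s - 1 / (2 * K + 2)) (s + 1 / (2 * K + 2)),
      HasDerivAt γ (V t (γ t)) t := by
  set h : ℝ := 1 / (2 * K + 2) with hh
  have hpos : 0 < h := by positivity
  have hKh : K * h ≤ 1 / 2 := by
    rw [hh, mul_one_div, div_le_div_iff₀ (by positivity) (by norm_num)]; linarith
  have hc : ContinuousOn (fun t => V t z) (Icc (s - h) (s + h)) :=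
    (hV.cont.comp (by fun_prop : Continuous fun t : ℝ => (t, z))).continuousOn
  obtain ⟨c, hcb⟩ := isCompact_Icc.exists_bound_of_continuousOn hc
  have hc0 : 0 ≤ c := (norm_nonneg _).trans (hcb s ⟨by linarith, by linarith⟩)
  have hIcc : s ∈ Icc (s - h) (s + h) := ⟨by linarith, by linarith⟩
  have hPL : IsPicardLindelof V (⟨s, hIcc⟩ : Icc (s - h) (s + h)) z ⟨2 * h * c, by positivity⟩ 0
      ⟨c + K * (2 * h * c), by positivity⟩ K := by
    refine ⟨fun t _ => (hV.lip t).lipschitzOnWith, fun x _ => ?_, fun t ht x hx => ?_, ?_⟩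
    · exact (hV.cont.comp (by fun_prop : Continuous fun t : ℝ => (t, x))).continuousOn
    · have h1 := hcb t ht
      have h2 := (hV.lip t).norm_sub_le x z
      have h3 : ‖x - z‖ ≤ 2 * h * c := by rw [← dist_eq_norm]; exact hx
      have h4 : ‖V t x‖ ≤ ‖V t z‖ + ‖V t x - V t z‖ := by
        simpa using norm_add_le (V t z) (V t x - V t z)
      have h5 : K * ‖x - z‖ ≤ K * (2 * h * c) := by gcongr
      show ‖V t x‖ ≤ c + K * (2 * h * c)
      linarith
    · show (c + K * (2 * h * c)) * max (s + h - s) (s - (s - h)) ≤ 2 * h * c - 0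
      have : max (s + h - s) (s - (s - h)) = h := by rw [max_eq_left] <;> linarith
      rw [this]
      have : 0 ≤ h * c := by positivity
      nlinarith
  obtain ⟨α, h1, h2⟩ := hPL.exists_eq_forall_mem_Icc_hasDerivWithinAt₀
  exact ⟨α, h1, fun t ht => (h2 t ⟨ht.1.le, ht.2.le⟩).hasDerivAt (Icc_mem_nhds ht.1 ht.2)⟩

lemma ext_right {V : ℝ → F → F} {K : NNReal} (hV : LipVF V K) {a b : ℝ} {γ : ℝ → F}
    (hγ : ∀ t ∈ Ioo a b, HasDerivAt γ (V t (γ t)) t) {s : ℝ} (hs : s ∈ Ioo a b) (hb : b < s + 1 / (2 * K + 2)) :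
    ∃ γ' : ℝ → F, (∀ t ≤ s, γ' t = γ t) ∧
      ∀ t ∈ Ioo a (s + 1 / (2 * K + 2)), HasDerivAt γ' (V t (γ' t)) t := by
  obtain ⟨δ, hδs, hδ⟩ := local_sol hV s (γ s)
  set h : ℝ := 1 / (2 * K + 2) with hh
  have hpos : 0 < h := by positivity
  set a' := max a (s - h)
  have hu : EqOn γ δ (Ioo a' b) := by
    refine ODE_solution_unique_of_mem_Ioo (v := V) (s := fun _ => univ) (K := K) (t₀ := s)
      (fun t _ => (hV.lip t).lipschitzOnWith) ⟨max_lt hs.1 (by linarith), hs.2⟩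
      (fun t ht => ⟨hγ t ⟨(le_max_left _ _).trans_lt ht.1, ht.2⟩, trivial⟩)
      (fun t ht => ⟨hδ t ⟨(le_max_right _ _).trans_lt ht.1, by linarith [ht.2]⟩, trivial⟩) hδs.symm
  refine ⟨fun t => if t ≤ s then γ t else δ t, fun t ht => by simp [ht], fun t ht => ?_⟩
  rcases lt_or_ge t b with htb | htb
  · have : (fun t => if t ≤ s then γ t else δ t) =ᶠ[𝓝 t] γ := by
      filter_upwards [Iio_mem_nhds htb] with r hr
      by_cases hrs : r ≤ s
      · simp [hrs]
      · simp only [hrs, if_false]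
        exact (hu ⟨max_lt (hs.1.trans (not_le.1 hrs)) (by linarith [not_le.1 hrs]), hr⟩).symm
    exact evt_deriv this (hγ t ⟨ht.1, htb⟩)
  · have hts : s < t := hs.2.trans_le htb
    have : (fun t => if t ≤ s then γ t else δ t) =ᶠ[𝓝 t] δ := by
      filter_upwards [Ioi_mem_nhds hts] with r hr
      simp [not_le.2 (mem_Ioi.1 hr)]
    exact evt_deriv this (hδ t ⟨by linarith, ht.2⟩)

lemma fwd_sol {V : ℝ → F → F} {K : NNReal} (hV : LipVF V K) (s : ℝ) (z : F) (n : ℕ) :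
    ∃ γ : ℝ → F, γ s = z ∧ ∀ t ∈ Ioo (s - 1 / (2 * K + 2)) (s + (n + 2) * (1 / (2 * K + 2)) / 2),
      HasDerivAt γ (V t (γ t)) t := by
  have hpos : 0 < 1 / (2 * (K:ℝ) + 2) := by positivity
  induction n with
  | zero =>
    obtain ⟨γ, h1, h2⟩ := local_sol hV s z
    exact ⟨γ, h1, fun t ht => h2 t ⟨ht.1, by simpa using ht.2⟩⟩
  | succ n ih =>
    obtain ⟨γ, h1, h2⟩ := ih
    set h : ℝ := 1 / (2 * K + 2) with hh
    have hn : (0:ℝ) ≤ n := n.cast_nonneg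
    obtain ⟨γ', h3, h4⟩ := ext_right hV h2 (s := s + (n + 1) * h / 2)
      ⟨by nlinarith, by nlinarith⟩ (by rw [← hh]; nlinarith)
    refine ⟨γ', by rw [h3 s (by nlinarith), h1], fun t ht => h4 t ⟨ht.1, ht.2.trans_eq ?_⟩⟩
    rw [← hh]; push_cast; ring

lemma fwd_sol' {V : ℝ → F → F} {K : NNReal} (hV : LipVF V K) (s : ℝ) (z : F) (T : ℝ) :
    ∃ γ : ℝ → F, γ s = z ∧ ∃ a < s, ∀ t ∈ Ioo a (s + T), HasDerivAt γ (V t (γ t)) t := by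
  have hpos : 0 < 1 / (2 * (K:ℝ) + 2) := by positivity
  obtain ⟨n, hn⟩ := exists_nat_gt (T / (1 / (2 * (K:ℝ) + 2) / 2))
  obtain ⟨γ, h1, h2⟩ := fwd_sol hV s z n
  refine ⟨γ, h1, _, by linarith, fun t ht => h2 t ⟨ht.1, ?_⟩⟩
  rw [div_lt_iff₀ (by positivity)] at hn
  nlinarith [ht.2]

lemma LipVF.rev {V : ℝ → F → F} {K : NNReal} (hV : LipVF V K) : LipVF (fun t z => - V (-t) z) K :=
  ⟨(hV.cont.comp (by fun_prop : Continuous fun q : ℝ × F => (-q.1, q.2))).neg, fun t => (hV.lip _).neg⟩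

lemma bdd_sol {V : ℝ → F → F} {K : NNReal} (hV : LipVF V K) (s : ℝ) (z : F) (T : ℝ) (hT : 0 < T) :
    ∃ γ : ℝ → F, γ s = z ∧ ∀ t ∈ Ioo (s - T) (s + T), HasDerivAt γ (V t (γ t)) t := by
  obtain ⟨γ, h1, a, ha, h2⟩ := fwd_sol' hV s z T
  obtain ⟨δ, h3, b, hb, h4⟩ := fwd_sol' hV.rev (-s) z T
  have h5 : ∀ t ∈ Ioo (s - T) (-b), HasDerivAt (fun t => δ (-t)) (V t (δ (-t))) t := by
    intro t ht
    have := (h4 (-t) ⟨by linarith [ht.2], by linarith [ht.1]⟩)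
    have := HasDerivAt.scomp t this (hasDerivAt_neg t)
    simpa [Function.comp_def] using this
  have hu : EqOn γ (fun t => δ (-t)) (Ioo (max a (s - T)) (min (s + T) (-b))) := by
    refine ODE_solution_unique_of_mem_Ioo (v := V) (s := fun _ => univ) (K := K) (t₀ := s)
      (fun t _ => (hV.lip t).lipschitzOnWith) ⟨max_lt ha (by linarith), lt_min (by linarith) (by linarith)⟩
      (fun t ht => ⟨h2 t ⟨(le_max_left _ _).trans_lt ht.1, ht.2.trans_le (min_le_left _ _)⟩, trivial⟩)
      (fun t ht => ⟨h5 t ⟨(le_max_right _ _).trans_lt ht.1, ht.2.trans_le (min_le_right _ _)⟩, trivial⟩)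
      (by rw [h1, h3])
  refine ⟨fun t => if t ≤ s then δ (-t) else γ t, by simp [h3], fun t ht => ?_⟩
  rcases lt_or_ge s t with hts | hts
  · have : (fun t => if t ≤ s then δ (-t) else γ t) =ᶠ[𝓝 t] γ := by
      filter_upwards [Ioi_mem_nhds hts] with r hr
      simp [not_le.2 (mem_Ioi.1 hr)]
    exact evt_deriv this (h2 t ⟨by linarith, ht.2⟩)
  · have : (fun t => if t ≤ s then δ (-t) else γ t) =ᶠ[𝓝 t] fun t => δ (-t) := by
      filter_upwards [Iio_mem_nhds (show t < min (s+T) (-b) from lt_min (by linarith) (by linarith))] with r hr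
      by_cases hrs : r ≤ s
      · simp [hrs]
      · simp only [hrs, if_false]
        exact hu ⟨(max_lt ha (by linarith)).trans (not_le.1 hrs), hr⟩
    exact evt_deriv this (h5 t ⟨ht.1, by linarith⟩)

lemma exists_sol {V : ℝ → F → F} {K : NNReal} (hV : LipVF V K) (s : ℝ) (z : F) :
    ∃ γ : ℝ → F, γ s = z ∧ ∀ t, HasDerivAt γ (V t (γ t)) t := by
  choose γ h1 h2 using fun n : ℕ => bdd_sol hV s z (n + 1) (by positivity)
  have key : ∀ n m : ℕ, n ≤ m → EqOn (γ n) (γ m) (Ioo (s - (n+1)) (s + (n + 1))) := by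
    intro n m hnm
    have hc : (n:ℝ) ≤ m := by exact_mod_cast hnm
    have hn : (0:ℝ) ≤ n := n.cast_nonneg
    exact ODE_solution_unique_of_mem_Ioo (v := V) (s := fun _ => univ) (K := K) (t₀ := s)
      (fun t _ => (hV.lip t).lipschitzOnWith) ⟨by linarith, by linarith⟩
      (fun t ht => ⟨h2 n t ht, trivial⟩)
      (fun t ht => ⟨h2 m t ⟨by linarith [ht.1], by linarith [ht.2]⟩, trivial⟩) (by rw [h1, h1])
  refine ⟨fun t => γ ⌈|t - s|⌉₊ t, h1 _, fun t => ?_⟩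
  set N := ⌈|t - s|⌉₊ + 1
  have hN : |t - s| < N := by
    have := Nat.le_ceil |t - s|
    simp only [N]; push_cast; linarith
  have hev : (fun t => γ ⌈|t - s|⌉₊ t) =ᶠ[𝓝 t] γ N := by
    have : ∀ᶠ r in 𝓝 t, |r - s| < N :=
      (by fun_prop : Continuous fun r : ℝ => |r - s|).continuousAt.eventually_lt continuousAt_const hN
    filter_upwards [this] with r hr
    have h5 : ⌈|r - s|⌉₊ ≤ N := Nat.ceil_le.2 hr.le
    have h6 := Nat.le_ceil |r - s|
    exact key _ _ h5 ⟨by linarith [neg_abs_le (r - s)], by linarith [le_abs_self (r - s)]⟩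
  exact evt_deriv hev (h2 N t ⟨by linarith [neg_abs_le (t - s)], by linarith [le_abs_self (t - s)]⟩)

open Classical in
/-- Flow of `V` from time `s` to time `t`. -/
def flow (V : ℝ → F → F) (t s : ℝ) (z : F) : F :=
  if h : ∃ γ : ℝ → F, γ s = z ∧ ∀ t, HasDerivAt γ (V t (γ t)) t then h.choose t else z

variable {V : ℝ → F → F} {K : NNReal}

lemma flow_self (hV : LipVF V K) (s : ℝ) (z : F) : flow V s s z = z := by
  have h := exists_sol hV s z
  rw [flow, dif_pos h]; exact h.choose_spec.1

lemma flow_deriv (hV : LipVF V K) (s : ℝ) (z : F) (t : ℝ) :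
    HasDerivAt (fun t => flow V t s z) (V t (flow V t s z)) t := by
  have h := exists_sol hV s z
  have : (fun t => flow V t s z) = h.choose := by funext t; rw [flow, dif_pos h]
  have h2 := h.choose_spec.2 t
  rw [← this] at h2
  exact h2

lemma flow_eq (hV : LipVF V K) {γ : ℝ → F} (hγ : ∀ t, HasDerivAt γ (V t (γ t)) t) (s t : ℝ) :
    flow V t s (γ s) = γ t :=
  traj_unique hV.lip (flow_deriv hV s (γ s)) hγ s (flow_self hV _ _) t

lemma flow_comp (hV : LipVF V K) (t s r : ℝ) (z : F) : flow V t s (flow V s r z) = flow V t r z :=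
  flow_eq hV (flow_deriv hV r z) s t

lemma flow_le (hV : LipVF V K) (t s : ℝ) (z z' : F) :
    ‖flow V t s z - flow V t s z'‖ ≤ ‖z - z'‖ * exp (K * |t - s|) := by
  simpa [flow_self hV] using traj_le hV.lip (flow_deriv hV s z) (flow_deriv hV s z') s t

lemma flow_cont (hV : LipVF V K) (s : ℝ) : Continuous fun q : ℝ × F => flow V q.1 s q.2 := by
  rw [continuous_iff_continuousAt]
  rintro ⟨t, z⟩
  have hc : Continuous fun t => flow V t s z :=
    continuous_iff_continuousAt.2 fun t => (flow_deriv hV s z t).continuousAt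
  rw [ContinuousAt, tendsto_iff_norm_sub_tendsto_zero]
  have h2 : Tendsto (fun q : ℝ × F => ‖q.2 - z‖ * exp (K * |q.1 - s|) + ‖flow V q.1 s z - flow V t s z‖)
      (𝓝 (t, z)) (𝓝 (‖z - z‖ * exp (K * |t - s|) + ‖flow V t s z - flow V t s z‖)) := by
    apply Continuous.tendsto (f := fun q : ℝ × F => ‖q.2 - z‖ * exp (K * |q.1 - s|) + ‖flow V q.1 s z - flow V t s z‖)
    have := hc.comp (continuous_fst (X := ℝ) (Y := F))
    simp only [Function.comp_def] at this
    fun_prop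
  simp only [sub_self, norm_zero, zero_mul, add_zero] at h2
  refine squeeze_zero (fun _ => norm_nonneg _) (fun q => ?_) h2
  have h3 := flow_le hV q.1 s q.2 z
  have h4 := norm_add_le (flow V q.1 s q.2 - flow V q.1 s z) (flow V q.1 s z - flow V t s z)
  rw [sub_add_sub_cancel] at h4
  linarith

lemma iflow_cont (hV : LipVF V K) (s : ℝ) : Continuous fun q : ℝ × F => flow V s q.1 q.2 := by
  rw [continuous_iff_continuousAt]
  rintro ⟨t, z⟩
  have hc : Continuous fun t' => flow V t' t z :=
    continuous_iff_continuousAt.2 fun t' => (flow_deriv hV t z t').continuousAt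
  rw [ContinuousAt, tendsto_iff_norm_sub_tendsto_zero]
  have h2 : Tendsto (fun q : ℝ × F => ‖q.2 - flow V q.1 t z‖ * exp (K * |s - q.1|))
      (𝓝 (t, z)) (𝓝 (‖z - flow V t t z‖ * exp (K * |s - t|))) := by
    apply Continuous.tendsto (f := fun q : ℝ × F => ‖q.2 - flow V q.1 t z‖ * exp (K * |s - q.1|))
    have := hc.comp (continuous_fst (X := ℝ) (Y := F))
    simp only [Function.comp_def] at this
    fun_prop
  simp only [flow_self hV, sub_self, norm_zero, zero_mul] at h2
  refine squeeze_zero (fun _ => norm_nonneg _) (fun q => ?_) h2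
  have h3 := flow_le hV s q.1 q.2 (flow V q.1 t z)
  rwa [flow_comp hV] at h3

end Flow
end VP
end

section
set_option linter.all false
namespace VP
open Set Filter Topology

section Flow2
variable {F : Type*} [NormedAddCommGroup F] [NormedSpace ℝ F] [CompleteSpace F]

structure C1VF (V : ℝ → F → F) (DV : ℝ → F → F →L[ℝ] F) (K : NNReal) : Prop extends LipVF V K where
  hd : ∀ t z, HasFDerivAt (V t) (DV t z) z
  hdc : Continuous fun q : ℝ × F => DV q.1 q.2

variable {V : ℝ → F → F} {DV : ℝ → F → F →L[ℝ] F} {K : NNReal}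

def linV (V : ℝ → F → F) (DV : ℝ → F → F →L[ℝ] F) (z : F) (t : ℝ) (W : F →L[ℝ] F) : F →L[ℝ] F :=
  (DV t (flow V t 0 z)).comp W

def dflow (V : ℝ → F → F) (DV : ℝ → F → F →L[ℝ] F) (t : ℝ) (z : F) : F →L[ℝ] F :=
  flow (linV V DV z) t 0 (ContinuousLinearMap.id ℝ F)

lemma C1VF.bound (h : C1VF V DV K) (t : ℝ) (z : F) : ‖DV t z‖ ≤ K :=
  (h.hd t z).le_of_lipschitz (h.lip t)

lemma linV_lip (h : C1VF V DV K) (z : F) : LipVF (linV V DV z) K := by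
  constructor
  · have h1 : Continuous fun t => DV t (flow V t 0 z) := h.hdc.comp
      (continuous_id.prodMk ((flow_cont h.toLipVF 0).comp (by fun_prop : Continuous fun t : ℝ => (t, z))))
    exact (h1.comp continuous_fst).clm_comp continuous_snd
  · intro t
    refine LipschitzWith.of_dist_le_mul fun W W' => ?_
    rw [dist_eq_norm, dist_eq_norm, linV, linV, ← ContinuousLinearMap.comp_sub]
    exact (ContinuousLinearMap.opNorm_comp_le _ _).trans (by gcongr; exact h.bound _ _)

lemma dflow_deriv (h : C1VF V DV K) (z : F) (t : ℝ) :
    HasDerivAt (fun t => dflow V DV t z) ((DV t (flow V t 0 z)).comp (dflow V DV t z)) t :=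
  flow_deriv (linV_lip h z) 0 _ t

lemma dflow_zero (h : C1VF V DV K) (z : F) : dflow V DV 0 z = ContinuousLinearMap.id ℝ F :=
  flow_self (linV_lip h z) 0 _

lemma dflow_apply (h : C1VF V DV K) (z k : F) (s t : ℝ) :
    ‖dflow V DV t z k‖ ≤ ‖dflow V DV s z k‖ * exp (K * |t - s|) := by
  have h2 := traj_le (V := fun t y => DV t (flow V t 0 z) y) (K := K) (u := fun t => dflow V DV t z k)
    (v := fun _ => 0) (fun t => (DV t (flow V t 0 z)).lipschitz.weaken (h.bound _ _))
    (fun t => by simpa using (dflow_deriv h z t).clm_apply (hasDerivAt_const t k))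
    (fun t => by simpa using hasDerivAt_const t (0:F)) s t
  simpa using h2

lemma dflow_norm (h : C1VF V DV K) (z : F) (t : ℝ) : ‖dflow V DV t z‖ ≤ exp (K * |t|) := by
  refine ContinuousLinearMap.opNorm_le_bound _ (exp_pos _).le fun k => ?_
  have := dflow_apply h z k 0 t
  rw [dflow_zero h] at this
  simpa [mul_comm] using this

lemma dflow_cont (h : C1VF V DV K) : Continuous fun q : ℝ × F => dflow V DV q.1 q.2 := by
  rw [continuous_iff_continuousAt]
  rintro ⟨t₀, z₀⟩
  rw [ContinuousAt, Metric.tendsto_nhds]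
  intro ε hε
  set T := |t₀| + 1
  have hT : 0 < T := by positivity
  set C := exp (K * T) * T * exp (K * T) with hC
  have hC0 : 0 < C := by positivity
  have hφ := flow_cont h.toLipVF 0
  have tube : ∀ᶠ z in 𝓝 z₀, ∀ t ∈ Icc (-T) T,
      ‖DV t (flow V t 0 z) - DV t (flow V t 0 z₀)‖ < ε / (2 * C) := by
    refine isCompact_Icc.eventually_forall_of_forall_eventually fun t _ => ?_
    have hc : Continuous fun q : F × ℝ => ‖DV q.2 (flow V q.2 0 q.1) - DV q.2 (flow V q.2 0 z₀)‖ := by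
      have h1 : Continuous fun q : F × ℝ => DV q.2 (flow V q.2 0 q.1) :=
        h.hdc.comp (continuous_snd.prodMk (hφ.comp (by fun_prop : Continuous fun q : F × ℝ => (q.2, q.1))))
      have h2 : Continuous fun q : F × ℝ => DV q.2 (flow V q.2 0 z₀) :=
        h.hdc.comp (continuous_snd.prodMk (hφ.comp (by fun_prop : Continuous fun q : F × ℝ => (q.2, z₀))))
      exact (h1.sub h2).norm
    exact hc.continuousAt.eventually_lt continuousAt_const (by simp; positivity)
  have ht : ∀ᶠ t in 𝓝 t₀, |t| < T :=
    continuous_abs.continuousAt.eventually_lt continuousAt_const (by simp [T])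
  have ht2 : ∀ᶠ t in 𝓝 t₀, dist (dflow V DV t z₀) (dflow V DV t₀ z₀) < ε / 2 :=
    Metric.tendsto_nhds.1 (dflow_deriv h z₀ t₀).continuousAt _ (by positivity)
  rw [nhds_prod_eq]
  filter_upwards [(ht.and ht2).prod_mk tube] with ⟨t, z⟩ ⟨⟨h1, h2⟩, h3⟩
  simp only at h1 h2 h3 ⊢
  have h4 := approx (V := linV V DV z₀) (linV_lip h z₀).lip (u := fun t => dflow V DV t z₀)
    (v := fun t => dflow V DV t z) (s := 0) (T := T) (ε := ε / (2 * C) * exp (K * T))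
    (fun t => dflow_deriv h z₀ t) (fun t => dflow_deriv h z t) (fun r hr => by
      rw [sub_zero] at hr
      rw [linV, ← ContinuousLinearMap.sub_comp]
      refine (ContinuousLinearMap.opNorm_comp_le _ _).trans ?_
      have := h3 r (abs_le.1 hr)
      have h5 := (dflow_norm h z r)
      have h6 : exp (K * |r|) ≤ exp (K * T) := by gcongr
      gcongr
      exact h5.trans h6) (t := t) (by simpa using h1.le)
  simp only [dflow_zero h, sub_self, norm_zero, zero_add, sub_zero] at h4
  have h5 : ε / (2 * C) * exp (K * T) * |t| * exp (K * |t|) ≤ ε / (2 * C) * exp (K * T) * T * exp (K * T) := by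
    gcongr
  have h6 : ε / (2 * C) * exp (K * T) * T * exp (K * T) = ε / 2 := by
    have : ε / (2 * C) * exp (K * T) * T * exp (K * T) = ε / (2 * C) * C := by rw [hC]; ring
    rw [this]; field_simp
  have h7 := dist_triangle (dflow V DV t z) (dflow V DV t z₀) (dflow V DV t₀ z₀)
  have h8 := dist_comm (dflow V DV t z) (dflow V DV t z₀)
  rw [dist_eq_norm (dflow V DV t z₀)] at h8
  linarith

lemma flow_hasFDerivAt (h : C1VF V DV K) (t₀ : ℝ) (z : F) :
    HasFDerivAt (fun z => flow V t₀ 0 z) (dflow V DV t₀ z) z := by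
  rw [hasFDerivAt_iff_isLittleO_nhds_zero, Asymptotics.isLittleO_iff]
  intro c hc
  set T := |t₀| + 1
  have hT : 0 < T := by positivity
  set C := exp (K * T) * T * exp (K * T) with hC
  have hC0 : 0 < C := by positivity
  have hφ := flow_cont h.toLipVF 0
  have tube : ∀ᶠ k in 𝓝 (0:F), ∀ t ∈ Icc (-T) T,
      ‖DV t (flow V t 0 z + k) - DV t (flow V t 0 z)‖ < c / C := by
    refine isCompact_Icc.eventually_forall_of_forall_eventually fun t _ => ?_
    have hc : Continuous fun q : F × ℝ => ‖DV q.2 (flow V q.2 0 z + q.1) - DV q.2 (flow V q.2 0 z)‖ := by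
      have h0 : Continuous fun q : F × ℝ => flow V q.2 0 z :=
        hφ.comp (by fun_prop : Continuous fun q : F × ℝ => (q.2, z))
      have h1 : Continuous fun q : F × ℝ => DV q.2 (flow V q.2 0 z + q.1) :=
        h.hdc.comp (continuous_snd.prodMk (h0.add continuous_fst))
      have h2 : Continuous fun q : F × ℝ => DV q.2 (flow V q.2 0 z) :=
        h.hdc.comp (continuous_snd.prodMk h0)
      exact (h1.sub h2).norm
    exact hc.continuousAt.eventually_lt continuousAt_const (by simp; positivity)
  obtain ⟨r, hr, hball⟩ := Metric.eventually_nhds_iff_ball.1 tube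
  have : ∀ᶠ k in 𝓝 (0:F), exp (K * T) * ‖k‖ < r :=
    (by fun_prop : Continuous fun k : F => exp (K * T) * ‖k‖).continuousAt.eventually_lt continuousAt_const (by simpa)
  filter_upwards [this] with k hk
  have h4 := approx (V := V) h.lip (u := fun t => flow V t 0 (z + k))
    (v := fun t => flow V t 0 z + dflow V DV t z k) (s := 0) (T := T) (ε := c / C * (exp (K * T) * ‖k‖))
    (fun t => flow_deriv h.toLipVF 0 (z + k) t)
    (fun t => (flow_deriv h.toLipVF 0 z t).add ((dflow_deriv h z t).clm_apply (hasDerivAt_const t k)))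
    (fun s hs => by
      rw [sub_zero] at hs
      have hW : ‖dflow V DV s z k‖ ≤ exp (K * T) * ‖k‖ := by
        refine (ContinuousLinearMap.le_opNorm _ _).trans ?_
        gcongr
        exact (dflow_norm h z s).trans (by gcongr)
      have h5 := (convex_ball (flow V s 0 z) r).norm_image_sub_le_of_norm_hasFDerivWithin_le'
        (f := V s) (f' := DV s) (φ := DV s (flow V s 0 z)) (C := c / C) (x := flow V s 0 z)
        (y := flow V s 0 z + dflow V DV s z k)
        (fun y hy => (h.hd s y).hasFDerivWithinAt) (fun y hy => by
          have := hball (y - flow V s 0 z) (by simpa [dist_eq_norm] using hy) s (abs_le.1 hs)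
          rw [add_sub_cancel] at this
          exact this.le)
        (by simpa using hr) (by simpa using hW.trans_lt hk)
      rw [add_sub_cancel_left] at h5
      rw [norm_sub_rev] at h5 ⊢
      have h6 : V s (flow V s 0 z + dflow V DV s z k) - (V s (flow V s 0 z) +
          (((DV s (flow V s 0 z)).comp (dflow V DV s z)) k + dflow V DV s z 0)) =
          -(DV s (flow V s 0 z) (dflow V DV s z k) - (V s (flow V s 0 z + dflow V DV s z k) - V s (flow V s 0 z))) := by
        simp only [map_zero, ContinuousLinearMap.comp_apply]; abel
      rw [h6, norm_neg]
      refine h5.trans ?_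
      gcongr) (t := t₀) (by simp [T])
  simp only [flow_self h.toLipVF, dflow_zero h, ContinuousLinearMap.id_apply, sub_self, norm_zero, zero_add, sub_zero] at h4
  rw [← sub_sub] at h4
  refine h4.trans ?_
  have h8 : |t₀| ≤ T := by simp [T]
  calc c / C * (exp (K * T) * ‖k‖) * |t₀| * exp (K * |t₀|)
      ≤ c / C * (exp (K * T) * ‖k‖) * T * exp (K * T) := by gcongr
    _ = c / C * C * ‖k‖ := by rw [hC]; ring
    _ = c * ‖k‖ := by field_simp

lemma flow_hasFDerivAt2 (h : C1VF V DV K) (q : ℝ × F) :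
    HasFDerivAt (fun q : ℝ × F => flow V q.1 0 q.2)
      ((ContinuousLinearMap.toSpanSingleton ℝ (V q.1 (flow V q.1 0 q.2))).coprod (dflow V DV q.1 q.2)) q := by
  have h1 : Continuous fun q : ℝ × F => V q.1 (flow V q.1 0 q.2) :=
    h.cont.comp (continuous_fst.prodMk (flow_cont h.toLipVF 0))
  have := hasStrictFDerivAt_uncurry_coprod (𝕜 := ℝ) (u := q) (f := fun t z => flow V t 0 z)
    (f₁ := fun t z => ContinuousLinearMap.toSpanSingleton ℝ (V t (flow V t 0 z)))
    (f₂ := fun t z => dflow V DV t z)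
    (Eventually.of_forall fun v => (flow_deriv h.toLipVF 0 v.2 v.1).hasFDerivAt)
    (Eventually.of_forall fun v => flow_hasFDerivAt h v.1 v.2)
    ((ContinuousLinearMap.toSpanSingletonCLE (𝕜 := ℝ) (E := F)).continuous.comp h1).continuousAt (dflow_cont h).continuousAt
  exact this.hasFDerivAt

lemma flow_contDiff (h : C1VF V DV K) : ContDiff ℝ 1 fun q : ℝ × F => flow V q.1 0 q.2 := by
  rw [contDiff_one_iff_hasFDerivAt]
  refine ⟨_, ?_, flow_hasFDerivAt2 h⟩
  have h1 : Continuous fun q : ℝ × F => V q.1 (flow V q.1 0 q.2) :=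
    h.cont.comp (continuous_fst.prodMk (flow_cont h.toLipVF 0))
  exact (ContinuousLinearMap.coprodEquivL ℝ (E := ℝ) (F := F) (G := F)).continuous.comp
    (((ContinuousLinearMap.toSpanSingletonCLE (𝕜 := ℝ) (E := F)).continuous.comp h1).prodMk (dflow_cont h))

def flowHomeo (h : LipVF V K) : (ℝ × F) ≃ₜ (ℝ × F) where
  toFun q := (q.1, flow V q.1 0 q.2)
  invFun q := (q.1, flow V 0 q.1 q.2)
  left_inv q := by simp [flow_comp h, flow_self h]
  right_inv q := by simp [flow_comp h, flow_self h]
  continuous_toFun := continuous_fst.prodMk (flow_cont h 0)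
  continuous_invFun := continuous_fst.prodMk (iflow_cont h 0)

lemma iflow_contDiff [FiniteDimensional ℝ F] (h : C1VF V DV K) :
    ContDiff ℝ 1 fun q : ℝ × F => flow V 0 q.1 q.2 := by
  have hΨ : ContDiff ℝ 1 (flowHomeo h.toLipVF) := contDiff_fst.prodMk (flow_contDiff h)
  set D : ℝ × F → (ℝ × F →L[ℝ] ℝ × F) := fun q => (ContinuousLinearMap.fst ℝ ℝ F).prod
    ((ContinuousLinearMap.toSpanSingleton ℝ (V q.1 (flow V q.1 0 q.2))).coprod (dflow V DV q.1 q.2)) with hD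
  have hDd : ∀ q, HasFDerivAt (flowHomeo h.toLipVF) (D q) q := fun q =>
    (hasFDerivAt_fst).prodMk (flow_hasFDerivAt2 h q)
  have hinj : ∀ q, Function.Injective (D q) := by
    intro q
    rw [injective_iff_map_eq_zero]
    rintro ⟨τ, k⟩ hk
    simp only [hD, ContinuousLinearMap.prod_apply, Prod.mk_eq_zero, ContinuousLinearMap.coe_fst',
      ContinuousLinearMap.coprod_apply] at hk
    obtain ⟨rfl, h2⟩ := hk
    simp only [map_zero, zero_add] at h2
    have := dflow_apply h q.2 k q.1 0
    rw [h2, dflow_zero h] at this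
    simp at this
    simp [this]
  have := (flowHomeo h.toLipVF).contDiff_symm (n := 1) (𝕜 := ℝ)
    (f₀' := fun q => (LinearEquiv.ofInjectiveEndo (D q : ℝ × F →ₗ[ℝ] ℝ × F) (hinj q)).toContinuousLinearEquiv)
    (fun q => by
      have e : ((LinearEquiv.ofInjectiveEndo (D q : ℝ × F →ₗ[ℝ] ℝ × F) (hinj q)).toContinuousLinearEquiv : ℝ × F →L[ℝ] ℝ × F) = D q := by
        exact ContinuousLinearMap.ext fun x => rfl
      rw [e]; exact hDd q) hΨ
  exact contDiff_snd.comp this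

end Flow2
end VP
end

section
set_option linter.all false
namespace VP
open Set Filter Topology

lemma hasDerivAt_integral_cpt {X : Type*} [TopologicalSpace X] [MeasurableSpace X] [OpensMeasurableSpace X]
    [T2Space X] {μ : Measure X} [IsFiniteMeasureOnCompacts μ] {g g' : ℝ → X → ℝ}
    (hg : ∀ t z, HasDerivAt (fun t => g t z) (g' t z) t)
    (hc : Continuous fun q : ℝ × X => g q.1 q.2) (hc' : Continuous fun q : ℝ × X => g' q.1 q.2)
    (hs : ∀ T : ℝ, ∃ Kc : Set X, IsCompact Kc ∧ ∀ t, |t| < T → ∀ z ∉ Kc, g t z = 0) (t₀ : ℝ) :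
    Integrable (g' t₀) μ ∧ HasDerivAt (fun t => ∫ z, g t z ∂μ) (∫ z, g' t₀ z ∂μ) t₀ := by
  obtain ⟨Kc, hK, hz⟩ := hs (|t₀| + 1)
  have hz' : ∀ t, |t| < |t₀| + 1 → ∀ z ∉ Kc, g' t z = 0 := by
    intro t ht z hzK
    have : (fun t => g t z) =ᶠ[𝓝 t] fun _ => 0 := by
      filter_upwards [continuous_abs.continuousAt.eventually_lt continuousAt_const ht] with r hr
      exact hz r hr z hzK
    exact (hg t z).unique ((hasDerivAt_const t (0:ℝ)).congr_of_eventuallyEq this)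
  obtain ⟨C, hC⟩ := ((isCompact_Icc (a := -(|t₀| + 1)) (b := |t₀| + 1)).prod hK).exists_bound_of_continuousOn hc'.continuousOn
  have hgi : ∀ t, Continuous (g t) := fun t => hc.comp (by fun_prop : Continuous fun z : X => (t, z))
  have hgi' : ∀ t, Continuous (g' t) := fun t => hc'.comp (by fun_prop : Continuous fun z : X => (t, z))
  have h0 : |t₀| < |t₀| + 1 := by linarith
  have hev : ∀ᶠ t in 𝓝 t₀, |t| < |t₀| + 1 := continuous_abs.continuousAt.eventually_lt continuousAt_const h0
  have hsm : ∀ t, |t| < |t₀| + 1 → ∀ u : ℝ → X → ℝ, Continuous (u t) → (∀ z ∉ Kc, u t z = 0) →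
      Integrable (u t) μ := fun t ht u hu hz =>
    hu.integrable_of_hasCompactSupport (HasCompactSupport.intro hK fun z hzz => hz z hzz)
  refine hasDerivAt_integral_of_dominated_loc_of_deriv_le (bound := Kc.indicator fun _ => C) (F := g)
    (F' := g') (s := {t | |t| < |t₀| + 1}) hev ?_ ?_ ?_ ?_ ?_ ?_
  · filter_upwards [hev] with t ht using (hsm t ht g (hgi t) (hz t ht)).aestronglyMeasurable
  · exact hsm t₀ h0 g (hgi t₀) (hz t₀ h0)
  · exact (hsm t₀ h0 g' (hgi' t₀) (hz' t₀ h0)).aestronglyMeasurable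
  · refine Eventually.of_forall fun z t ht => ?_
    by_cases hzK : z ∈ Kc
    · rw [indicator_of_mem hzK]
      exact hC (t, z) ⟨abs_le.1 (le_of_lt ht), hzK⟩
    · rw [indicator_of_notMem hzK, hz' t ht z hzK, norm_zero]
  · exact (integrable_indicator_iff hK.measurableSet).2 (integrableOn_const hK.measure_lt_top.ne)
  · exact Eventually.of_forall fun z t _ => hg t z

instance : (volume : Measure (E2 × E3)).IsAddHaarMeasure :=
  Measure.prod.instIsAddHaarMeasure (volume : Measure E2) (volume : Measure E3)

section Liou
variable {F : Type*} [NormedAddCommGroup F] [NormedSpace ℝ F] [FiniteDimensional ℝ F]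
  [MeasurableSpace F] [BorelSpace F] {μ : Measure F} [μ.IsAddHaarMeasure]

lemma integral_div_free {h : F → ℝ} (hh : ContDiff ℝ 1 h) (hcs : HasCompactSupport h) {V : F → F}
    {DV : F → F →L[ℝ] F} (hV : ∀ z, HasFDerivAt V (DV z) z) (hDV : Continuous DV)
    (htr : ∀ z, LinearMap.trace ℝ F (DV z : F →ₗ[ℝ] F) = 0) :
    ∫ z, fderiv ℝ h z (V z) ∂μ = 0 := by
  classical
  set b := Module.finBasis ℝ F
  have hVc : Continuous V := continuous_iff_continuousAt.2 fun z => (hV z).continuousAt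
  have hVd : ∀ i z, HasFDerivAt (fun z => b.coord i (V z))
      ((b.coord i).toContinuousLinearMap.comp (DV z)) z := fun i z =>
    ((b.coord i).toContinuousLinearMap.hasFDerivAt (x := V z)).comp z (hV z)
  have hcc : ∀ i, Continuous fun z => b.coord i (V z) := fun i =>
    (b.coord i).toContinuousLinearMap.continuous.comp hVc
  have hDh : Continuous (fderiv ℝ h) := hh.continuous_fderiv one_ne_zero
  have hcs' : HasCompactSupport (fderiv ℝ h) := hcs.fderiv ℝ
  have int1 : ∀ i, Integrable (fun z => b.coord i (V z) * fderiv ℝ h z (b i)) μ := fun i => by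
    refine Continuous.integrable_of_hasCompactSupport ((hcc i).mul (hDh.clm_apply continuous_const)) ?_
    exact (hcs'.comp_left (g := fun L : F →L[ℝ] ℝ => L (b i)) rfl).mul_left
  have int2 : ∀ i, Integrable (fun z => b.coord i (DV z (b i)) * h z) μ := fun i => by
    refine Continuous.integrable_of_hasCompactSupport (Continuous.mul ?_ hh.continuous) hcs.mul_left
    exact (b.coord i).toContinuousLinearMap.continuous.comp (hDV.clm_apply continuous_const)
  have e1 : ∀ z, fderiv ℝ h z (V z) = ∑ i, b.coord i (V z) * fderiv ℝ h z (b i) := by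
    intro z
    have := congrArg (fderiv ℝ h z) (b.sum_repr (V z))
    rw [map_sum] at this
    rw [← this]
    exact Finset.sum_congr rfl fun i _ => by simp
  have e2 : ∀ i, ∫ z, b.coord i (V z) * fderiv ℝ h z (b i) ∂μ = - ∫ z, b.coord i (DV z (b i)) * h z ∂μ := by
    intro i
    have := integral_mul_fderiv_eq_neg_fderiv_mul_of_integrable (𝕜 := ℝ) (μ := μ) (v := b i)
      (f := fun z => b.coord i (V z)) (g := h) ?_ (int1 i) ?_ (fun z _ => (hVd i z).differentiableAt) (fun z _ => hh.differentiable one_ne_zero z)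
    · rw [this]
      simp only [(hVd i _).fderiv]; rfl
    · simp only [(hVd i _).fderiv]; exact int2 i
    · exact Continuous.integrable_of_hasCompactSupport ((hcc i).mul hh.continuous) hcs.mul_left
  simp_rw [e1]
  rw [integral_finset_sum _ fun i _ => int1 i]
  simp_rw [e2]
  rw [Finset.sum_neg_distrib, ← integral_finset_sum _ fun i _ => int2 i, neg_eq_zero]
  refine integral_eq_zero_of_ae (Eventually.of_forall fun z => ?_)
  have := htr z
  rw [LinearMap.trace_eq_matrix_trace ℝ b, Matrix.trace] at this
  simp only [← Finset.sum_mul, Pi.zero_apply]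
  have e3 : ∑ i, b.coord i (DV z (b i)) = 0 := by
    rw [← this]; refine Finset.sum_congr rfl fun i _ => ?_
    simp [Matrix.diag, LinearMap.toMatrix_apply]
  rw [e3, zero_mul]

variable {V : ℝ → F → F} {DV : ℝ → F → F →L[ℝ] F} {K : NNReal}

/-- transport equation satisfied by `h ∘ G`. -/
lemma transport (hV : C1VF V DV K) {h : F → ℝ} (hh : ContDiff ℝ 1 h) (q : ℝ × F) :
    fderiv ℝ (fun q : ℝ × F => h (flow V 0 q.1 q.2)) q (1, V q.1 q.2) = 0 := by
  obtain ⟨t, z⟩ := q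
  have hd : ContDiff ℝ 1 (fun q : ℝ × F => h (flow V 0 q.1 q.2)) := hh.comp (iflow_contDiff hV)
  have h1 : HasDerivAt (fun r => (r, flow V r t z)) ((1 : ℝ), V t (flow V t t z)) t :=
    (hasDerivAt_id t).prodMk (flow_deriv hV.toLipVF t z t)
  have h2 := ((hd.differentiable one_ne_zero (t, flow V t t z)).hasFDerivAt).comp_hasDerivAt t h1
  have h3 : ((fun q : ℝ × F => h (flow V 0 q.1 q.2)) ∘ fun r => (r, flow V r t z)) = fun _ => h (flow V 0 t z) := by
    funext r; simp [flow_comp hV.toLipVF]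
  rw [h3] at h2
  have := h2.unique (hasDerivAt_const t _)
  rwa [flow_self hV.toLipVF] at this

lemma support_flow (hV : LipVF V K) {h : F → ℝ} (hcs : HasCompactSupport h) (T : ℝ) :
    ∃ Kc : Set F, IsCompact Kc ∧ ∀ t, |t| < T → ∀ z ∉ Kc, h (flow V 0 t z) = 0 := by
  refine ⟨_, ((isCompact_Icc (a := -T) (b := T)).prod hcs).image (flow_cont hV 0), fun t ht z hz => ?_⟩
  by_contra hne
  exact hz ⟨(t, flow V 0 t z), ⟨abs_le.1 ht.le, subset_tsupport _ hne⟩, by simp [flow_comp hV, flow_self hV]⟩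

lemma liouville (hV : C1VF V DV K) (htr : ∀ t z, LinearMap.trace ℝ F (DV t z : F →ₗ[ℝ] F) = 0)
    {h : F → ℝ} (hh : ContDiff ℝ 1 h) (hcs : HasCompactSupport h) (t : ℝ) :
    ∫ z, h (flow V 0 t z) ∂μ = ∫ z, h z ∂μ := by
  set g : ℝ × F → ℝ := fun q : ℝ × F => h (flow V 0 q.1 q.2) with hg
  have hd : ContDiff ℝ 1 g := hh.comp (iflow_contDiff hV)
  have hDc : Continuous (fderiv ℝ g) := hd.continuous_fderiv one_ne_zero
  have hD : ∀ t, HasDerivAt (fun t => ∫ z, g (t, z) ∂μ) 0 t := by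
    intro t
    have h1 := (hasDerivAt_integral_cpt (μ := μ) (g := fun t z => g (t, z)) (g' := fun t z => fderiv ℝ g (t, z) (1, 0))
      (fun t z => by
        have h1 : HasDerivAt (fun r => (r, z)) ((1 : ℝ), (0:F)) t := (hasDerivAt_id t).prodMk (hasDerivAt_const t z)
        exact ((hd.differentiable one_ne_zero (t, z)).hasFDerivAt).comp_hasDerivAt t h1)
      hd.continuous (hDc.clm_apply continuous_const) (support_flow hV.toLipVF hcs) t).2
    have h2 : ∫ z, fderiv ℝ g (t, z) (1, 0) ∂μ = 0 := by
      have hgt : ContDiff ℝ 1 fun z => g (t, z) := hd.comp (by fun_prop)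
      have h3 : ∀ z v, fderiv ℝ (fun z => g (t, z)) z v = fderiv ℝ g (t, z) (0, v) := by
        intro z v
        have h1 : HasFDerivAt (fun z : F => (t, z)) (ContinuousLinearMap.inr ℝ ℝ F) z := hasFDerivAt_prodMk_right t z
        have := ((hd.differentiable one_ne_zero (t, z)).hasFDerivAt).comp z h1
        change fderiv ℝ (g ∘ fun z => (t, z)) z v = _
        rw [this.fderiv]; simp
      have h4 := integral_div_free (μ := μ) hgt (by
        obtain ⟨Kc, hK, hz⟩ := support_flow hV.toLipVF hcs (|t| + 1)
        exact HasCompactSupport.intro hK fun z hzz => hz t (by linarith) z hzz) (hV.hd t)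
        (hV.hdc.comp (by fun_prop : Continuous fun z : F => (t, z))) (htr t)
      rw [← neg_eq_zero, ← integral_neg, ← h4]
      refine integral_congr_ae (Eventually.of_forall fun z => ?_)
      have h5 : fderiv ℝ g (t, z) (1, V t z) = 0 := transport hV hh (t, z)
      have h6 : ((1:ℝ), V t z) = (1, 0) + (0, V t z) := by simp
      rw [h6, map_add] at h5
      simp only [h3]; linarith
    rwa [h2] at h1
  have := is_const_of_deriv_eq_zero (fun t => (hD t).differentiableAt) (fun t => (hD t).deriv) t 0
  simpa [hg, flow_self hV.toLipVF] using this

lemma liouville_w (hV : C1VF V DV K) (htr : ∀ t z, LinearMap.trace ℝ F (DV t z : F →ₗ[ℝ] F) = 0)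
    {h w : F → ℝ} (hh : ContDiff ℝ 1 h) (hcs : HasCompactSupport h) (hw : ContDiff ℝ 1 w) (t : ℝ) :
    ∫ z, h (flow V 0 t z) * w z ∂μ = ∫ z, h z * w (flow V t 0 z) ∂μ := by
  rw [← liouville (μ := μ) hV htr (h := fun z => h z * w (flow V t 0 z)) _ hcs.mul_right t]
  · simp [flow_comp hV.toLipVF, flow_self hV.toLipVF]
  · exact hh.mul (hw.comp ((flow_contDiff hV).comp (by fun_prop : ContDiff ℝ 1 fun z : F => (t, z))))

end Liou
end VP
end

section
set_option linter.all false
namespace VP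
open Set Filter Topology

section Radial
variable {E : Type*} [NormedAddCommGroup E] [NormedSpace ℝ E] [FiniteDimensional ℝ E] [Nontrivial E]
  [MeasurableSpace E] [BorelSpace E] (μ : Measure E) [μ.IsAddHaarMeasure]

lemma radial_eq (n : ℕ) {s y : ℝ} (hy : 0 < y) (hn : 1 ≤ n) : y ^ (n - 1) • y ^ (-s) = y ^ ((n:ℝ) - 1 - s) := by
  rw [smul_eq_mul, ← Real.rpow_natCast, ← Real.rpow_add hy, Nat.cast_sub hn]; congr 1; push_cast; ring

lemma radial_integrable {s P : ℝ} (hs : s < Module.finrank ℝ E) (hP : 0 ≤ P) :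
    IntegrableOn (fun x : E => ‖x‖ ^ (-s)) (Metric.ball 0 P) μ := by
  rw [integrableOn_fun_norm_addHaar μ (f := fun y => y ^ (-s))]
  have hn : 1 ≤ Module.finrank ℝ E := Module.finrank_pos
  rw [integrableOn_congr_fun (fun y hy => radial_eq _ hy.1 hn) measurableSet_Ioo,
    ← integrableOn_Ioc_iff_integrableOn_Ioo,
    ← intervalIntegrable_iff_integrableOn_Ioc_of_le hP]
  exact intervalIntegral.intervalIntegrable_rpow' (by linarith)

lemma radial_integral {s P : ℝ} (hs : s < Module.finrank ℝ E) (hP : 0 ≤ P) :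
    ∫ x in Metric.ball (0:E) P, ‖x‖ ^ (-s) ∂μ =
      Module.finrank ℝ E * μ.real (Metric.ball 0 1) * (P ^ ((Module.finrank ℝ E : ℝ) - s) / (Module.finrank ℝ E - s)) := by
  have hn : 1 ≤ Module.finrank ℝ E := Module.finrank_pos
  have h1 := integral_fun_norm_addHaar μ (fun y => (Iio P).indicator (fun y => y ^ (-s)) y)
  have h2 : (fun x : E => (Iio P).indicator (fun y => y ^ (-s)) ‖x‖) =
      (Metric.ball (0:E) P).indicator (fun x => ‖x‖ ^ (-s)) := by
    funext x; simp [indicator]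
  rw [h2, integral_indicator measurableSet_ball] at h1
  rw [h1, nsmul_eq_mul, smul_eq_mul, mul_assoc]
  congr 2
  have h3 : ∫ y in Ioi (0:ℝ), y ^ (Module.finrank ℝ E - 1) • (Iio P).indicator (fun y => y ^ (-s)) y =
      ∫ y in Ioo (0:ℝ) P, y ^ ((Module.finrank ℝ E : ℝ) - 1 - s) := by
    rw [← integral_indicator measurableSet_Ioi, ← integral_indicator measurableSet_Ioo]
    congr 1; funext y
    by_cases h0 : 0 < y <;> by_cases hp : y < P
    · simp only [indicator, mem_Ioi, mem_Iio, mem_Ioo, h0, hp, and_self, if_true]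
      exact radial_eq _ h0 hn
    all_goals simp [indicator, h0, hp]
  rw [h3, ← integral_Ioc_eq_integral_Ioo, ← intervalIntegral.integral_of_le hP, integral_rpow (Or.inl (by linarith)),
    show (Module.finrank ℝ E : ℝ) - 1 - s + 1 = Module.finrank ℝ E - s by ring, Real.zero_rpow (by linarith), sub_zero]

end Radial

def vb2 : ℝ := (volume : Measure E2).real (Metric.ball 0 1)

lemma vb2_nonneg : 0 ≤ vb2 := measureReal_nonneg

/-- `∫_{B_1} |y|^{-α} dy` -/
def JJ (α : ℝ) : ℝ := 2 * vb2 / (2 - α)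

lemma JJ_int {α : ℝ} (h : α < 2) : IntegrableOn (fun x : E2 => ‖x‖ ^ (-α)) (Metric.ball 0 1) :=
  radial_integrable volume (by simpa using h) zero_le_one

lemma JJ_val {α : ℝ} (h : α < 2) : ∫ x in Metric.ball (0:E2) 1, ‖x‖ ^ (-α) = JJ α := by
  rw [radial_integral volume (by simpa using h) zero_le_one]
  simp [JJ, vb2]; ring

lemma JJ_nonneg {α : ℝ} (h : α < 2) : 0 ≤ JJ α := by
  rw [JJ]; have := vb2_nonneg; have : 0 < 2 - α := by linarith
  positivity

lemma sing_bound {α : ℝ} (hα : 0 ≤ α) (z : E2) :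
    ‖z‖ ^ (-α) ≤ (Metric.ball (0:E2) 1).indicator (fun z => ‖z‖ ^ (-α)) z + 1 := by
  by_cases hz : z ∈ Metric.ball (0:E2) 1
  · simp [indicator_of_mem hz]
  · rw [indicator_of_notMem hz, zero_add]
    have : 1 ≤ ‖z‖ := by simpa using hz
    exact Real.rpow_le_one_of_one_le_of_nonpos this (by linarith)

/-- Integrals against weakly singular kernels; `u` vanishes off `S`. -/
lemma conv_bound {H : Type*} [NormedAddCommGroup H] [NormedSpace ℝ H] {α A m : ℝ}
    (hα : 0 ≤ α) (hα2 : α < 2) (hA : 0 ≤ A) {k : E2 → H} (hk : StronglyMeasurable k)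
    (hkb : ∀ z, ‖k z‖ ≤ A * ‖z‖ ^ (-α)) {u : E2 → ℝ} (hu : StronglyMeasurable u)
    {S : Set E2} (hS : MeasurableSet S) (hSf : volume S ≠ ⊤) (hub : ∀ y, |u y| ≤ m)
    (hus : ∀ y ∉ S, u y = 0) (x : E2) :
    Integrable (fun y => u y • k (x - y)) ∧ ‖∫ y, u y • k (x - y)‖ ≤ A * m * (JJ α + volume.real S) := by
  have hm : 0 ≤ m := (abs_nonneg _).trans (hub 0)
  set g : E2 → ℝ := fun y => A * m * ((Metric.ball (0:E2) 1).indicator (fun z => ‖z‖ ^ (-α)) (x - y) + S.indicator 1 y) with hg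
  have i1 : Integrable ((Metric.ball (0:E2) 1).indicator (fun z => ‖z‖ ^ (-α))) :=
    (integrable_indicator_iff measurableSet_ball).2 (JJ_int hα2)
  have i1' := i1.comp_sub_left x
  have i2 : Integrable (S.indicator (1 : E2 → ℝ)) := (integrable_indicator_iff hS).2 (integrableOn_const hSf)
  have gi : Integrable g := (i1'.add i2).const_mul _
  have hb : ∀ y, ‖u y • k (x - y)‖ ≤ g y := by
    intro y
    have hn : 0 ≤ (Metric.ball (0:E2) 1).indicator (fun z => ‖z‖ ^ (-α)) (x - y) :=
      indicator_nonneg (fun z _ => by positivity) _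
    by_cases hy : y ∈ S
    · rw [norm_smul, norm_eq_abs, hg]
      simp only [indicator_of_mem hy, Pi.one_apply]
      calc |u y| * ‖k (x - y)‖ ≤ m * (A * ‖x - y‖ ^ (-α)) := by gcongr; exact hub y; exact hkb _
        _ ≤ m * (A * ((Metric.ball (0:E2) 1).indicator (fun z => ‖z‖ ^ (-α)) (x - y) + 1)) := by
          gcongr; exact sing_bound hα _
        _ = _ := by ring
    · rw [hus y hy, zero_smul, norm_zero, hg]
      simp only [indicator_of_notMem hy]
      positivity
  have hmeas : AEStronglyMeasurable (fun y => u y • k (x - y)) :=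
    (hu.smul (hk.comp_measurable (by fun_prop))).aestronglyMeasurable
  refine ⟨gi.mono' hmeas (Eventually.of_forall hb), (norm_integral_le_of_norm_le gi (Eventually.of_forall hb)).trans_eq ?_⟩
  rw [integral_const_mul, integral_add i1' i2, integral_sub_left_eq_self (μ := volume) (fun y => (Metric.ball (0:E2) 1).indicator (fun z => ‖z‖ ^ (-α)) y) x,
    integral_indicator measurableSet_ball, JJ_val hα2, integral_indicator hS]
  simp [Measure.real]

lemma conv_swap {H : Type*} [NormedAddCommGroup H] [NormedSpace ℝ H] (k : E2 → H) (u : E2 → ℝ) (x : E2) :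
    ∫ y, u y • k (x - y) = ∫ y, u (x - y) • k (-(- y)) := by
  rw [← integral_sub_left_eq_self (μ := volume) (fun y => u y • k (x - y)) x]
  simp

/-- Lipschitz bound of a convolution with a weakly singular kernel. -/
lemma conv_lip {H : Type*} [NormedAddCommGroup H] [NormedSpace ℝ H] {α A ℓ R : ℝ}
    (hα : 0 ≤ α) (hα2 : α < 2) (hA : 0 ≤ A) {k : E2 → H} (hk : StronglyMeasurable k)
    (hkb : ∀ z, ‖k z‖ ≤ A * ‖z‖ ^ (-α)) {u : E2 → ℝ} (hℓ : 0 ≤ ℓ)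
    (hul : ∀ x y, |u x - u y| ≤ ℓ * ‖x - y‖)
    (hus : ∀ y, R < ‖y‖ → u y = 0) (x x' : E2) :
    ‖(∫ y, u y • k (x - y)) - ∫ y, u y • k (x' - y)‖ ≤
      A * ℓ * (JJ α + 2 * volume.real (Metric.closedBall (0:E2) R)) * ‖x - x'‖ := by
  have huc : Continuous u := by
    refine (LipschitzWith.of_dist_le_mul (K := ⟨ℓ, hℓ⟩) fun x y => ?_).continuous
    rw [dist_eq_norm, dist_eq_norm]; exact hul x y
  obtain ⟨m, hm⟩ : ∃ m, ∀ y, |u y| ≤ m := by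
    have : HasCompactSupport u := HasCompactSupport.intro (isCompact_closedBall (0:E2) R) fun y hy =>
      hus y (by simpa using hy)
    obtain ⟨C, hC⟩ := this.exists_bound_of_continuous huc
    exact ⟨C, hC⟩
  have ii := fun x => (conv_bound hα hα2 hA hk hkb huc.stronglyMeasurable
    (S := Metric.closedBall (0:E2) R) measurableSet_closedBall measure_closedBall_lt_top.ne hm
    (fun y hy => hus y (by simpa using hy)) x)
  have key : (∫ y, u y • k (x - y)) - ∫ y, u y • k (x' - y) =
      ∫ y, (u (x - (x - y)) - u (x' - (x - y))) • k (x - y) := by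
    have e : ∫ y, u y • k (x' - y) = ∫ y, u (x' - (x - y)) • k (x - y) := by
      rw [conv_swap, ← integral_sub_left_eq_self (μ := volume) (fun y => u (x' - y) • k (-(-y))) x]
      simp
    have i2 : Integrable fun y => u (x' - (x - y)) • k (x - y) := by
      have := ((ii x').1.comp_sub_left x').comp_sub_left x
      simpa using this
    rw [e, ← integral_sub (ii x).1 i2]
    simp [sub_smul]
  set S := Metric.closedBall (0:E2) R ∪ Metric.closedBall (x - x') R
  have hSv : volume S ≤ volume (Metric.closedBall (0:E2) R) + volume (Metric.closedBall (0:E2) R) := by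
    refine (measure_union_le _ _).trans_eq ?_
    rw [Measure.addHaar_closedBall_center _ (x - x')]
  have hSf : volume S ≠ ⊤ := ne_top_of_le_ne_top (ENNReal.add_ne_top.2 ⟨measure_closedBall_lt_top.ne, measure_closedBall_lt_top.ne⟩) hSv
  have hSr : volume.real S ≤ 2 * volume.real (Metric.closedBall (0:E2) R) := by
    have := ENNReal.toReal_mono (ENNReal.add_ne_top.2 ⟨measure_closedBall_lt_top.ne, measure_closedBall_lt_top.ne⟩) hSv
    rw [ENNReal.toReal_add measure_closedBall_lt_top.ne measure_closedBall_lt_top.ne] at this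
    simp only [Measure.real]; linarith
  rw [key]
  have hcu : Continuous fun y => u (x - (x - y)) - u (x' - (x - y)) := by fun_prop
  refine (conv_bound (m := ℓ * ‖x - x'‖) hα hα2 hA hk hkb hcu.stronglyMeasurable (S := S)
    (by measurability) hSf (fun y => ?_) (fun y hy => ?_) x).2.trans ?_
  · refine (hul _ _).trans_eq ?_
    congr 2; abel
  · simp only [S, mem_union, Metric.mem_closedBall, dist_zero_right, not_or, not_le] at hy
    rw [sub_sub_cancel, hus y hy.1, hus, sub_zero]
    have := hy.2
    rw [dist_eq_norm] at this
    rwa [show x' - (x - y) = y - (x - x') by abel]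
  · have := norm_nonneg (x - x')
    have : A * (ℓ * ‖x - x'‖) * (JJ α + volume.real S) ≤
      A * (ℓ * ‖x - x'‖) * (JJ α + 2 * volume.real (Metric.closedBall (0:E2) R)) := by gcongr
    linarith

end VP
end

section
set_option linter.all false
namespace VP
open Set Filter Topology

/-- regularised kernel `2 x / (|x|²+ε²)` -/
def kk (ε : ℝ) (x : E2) : E2 := (2 * (‖x‖ ^ 2 + ε ^ 2)⁻¹) • x

/-- convolution field -/
def EE (ε : ℝ) (u : E2 → ℝ) (x : E2) : E2 := ∫ y, u y • kk ε (x - y)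

lemma kk_meas (ε : ℝ) : StronglyMeasurable (kk ε) := by
  unfold kk
  apply Measurable.stronglyMeasurable
  fun_prop

lemma rpow_neg_one_norm (z : E2) : ‖z‖ ^ (-(1:ℝ)) = ‖z‖⁻¹ := Real.rpow_neg_one _

lemma kk_bound (ε : ℝ) (z : E2) : ‖kk ε z‖ ≤ 2 * ‖z‖ ^ (-(1:ℝ)) := by
  rw [kk, norm_smul, rpow_neg_one_norm, norm_eq_abs, abs_of_nonneg (by positivity), mul_assoc]
  by_cases hz : z = 0
  · simp [hz]
  · have h : 0 < ‖z‖ := norm_pos_iff.2 hz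
    gcongr
    rw [inv_mul_le_iff₀ (by positivity), ← div_eq_mul_inv, le_div_iff₀ h]
    nlinarith [sq_nonneg ε]

lemma kk_diff {d : ℝ} (hd : 0 ≤ d) (z : E2) : ‖kk 0 z - kk d z‖ ≤ 2 * √d * ‖z‖ ^ (-(3/2:ℝ)) := by
  by_cases hz : z = 0
  · simp [hz, kk]
  have h : 0 < ‖z‖ := norm_pos_iff.2 hz
  rw [kk, kk, ← sub_smul, norm_smul]
  set r := ‖z‖
  have hb : 0 < √r := Real.sqrt_pos.2 h
  have e1 : r ^ (-(3/2:ℝ)) = (√r ^ 3)⁻¹ := by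
    rw [Real.rpow_neg h.le, Real.sqrt_eq_rpow, ← Real.rpow_natCast (r ^ (1/2:ℝ)), ← Real.rpow_mul h.le]; norm_num
  rw [e1]
  have hr : r = √r ^ 2 := (Real.sq_sqrt h.le).symm
  have hdd : d = √d ^ 2 := (Real.sq_sqrt hd).symm
  have ha : 0 ≤ √d := Real.sqrt_nonneg d
  generalize √r = b at *
  generalize √d = a at *
  rw [hr, hdd]
  have e2 : 2 * ((b ^ 2) ^ 2 + 0 ^ 2)⁻¹ - 2 * ((b ^ 2) ^ 2 + (a ^ 2) ^ 2)⁻¹ = 2 * a ^ 4 / (b ^ 4 * (b ^ 4 + a ^ 4)) := by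
    field_simp; ring
  rw [e2, norm_eq_abs, abs_of_nonneg (by positivity)]
  rw [div_mul_eq_mul_div, div_le_iff₀ (by positivity)]
  have : 2 * a * (b ^ 3)⁻¹ * (b ^ 4 * (b ^ 4 + a ^ 4)) = 2 * a * b * (b ^ 4 + a ^ 4) := by field_simp
  rw [this]
  have h1 : a ^ 3 * b ≤ b ^ 4 + a ^ 4 := by
    nlinarith [sq_nonneg (a - b), sq_nonneg (a^2-b^2), mul_nonneg (sq_nonneg a) (sq_nonneg (a-b)), sq_nonneg (a*b), sq_nonneg (a^2), sq_nonneg (b^2)]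
  nlinarith [mul_le_mul_of_nonneg_left h1 (by positivity : 0 ≤ 2 * a * b)]

/-- derivative of the regularised kernel -/
def kk' (ε : ℝ) (x : E2) : E2 →L[ℝ] E2 :=
  (2 * (‖x‖ ^ 2 + ε ^ 2)⁻¹) • ContinuousLinearMap.id ℝ E2 +
    ((-(4 * ((‖x‖ ^ 2 + ε ^ 2)⁻¹) ^ 2)) • innerSL ℝ x).smulRight x

lemma kk_deriv {ε : ℝ} (hε : 0 < ε) (x : E2) : HasFDerivAt (kk ε) (kk' ε x) x := by
  have h0 : ‖x‖ ^ 2 + ε ^ 2 ≠ 0 := by positivity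
  have h1 : HasFDerivAt (fun x : E2 => ‖x‖ ^ 2 + ε ^ 2) (2 • innerSL ℝ x) x :=
    (hasStrictFDerivAt_norm_sq x).hasFDerivAt.add_const _
  have h2 := ((hasDerivAt_inv h0).comp_hasFDerivAt x h1).const_mul 2
  have h3 := h2.smul (hasFDerivAt_id x)
  refine h3.congr_fderiv ?_
  ext v
  simp [kk', mul_smul]
  ring

lemma kk'_cont {ε : ℝ} (hε : 0 < ε) : Continuous (kk' ε) := by
  unfold kk'
  have : ∀ x : E2, ‖x‖ ^ 2 + ε ^ 2 ≠ 0 := fun x => by positivity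
  have h1 : Continuous fun x : E2 => (‖x‖ ^ 2 + ε ^ 2)⁻¹ := Continuous.inv₀ (by fun_prop) this
  refine ((continuous_const.mul h1).smul continuous_const).add ?_
  have h2 : Continuous fun x : E2 => (-(4 * ((‖x‖ ^ 2 + ε ^ 2)⁻¹) ^ 2)) • innerSL ℝ x :=
    ((continuous_const.mul (h1.pow 2)).neg).smul (innerSL ℝ).continuous
  exact (ContinuousLinearMap.smulRightL ℝ E2 E2).continuous₂.comp (h2.prodMk continuous_id)

lemma kk'_bound {ε : ℝ} (hε : 0 < ε) (x : E2) : ‖kk' ε x‖ ≤ 6 * (‖x‖ ^ 2 + ε ^ 2)⁻¹ := by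
  refine ContinuousLinearMap.opNorm_le_bound _ (by positivity) fun v => ?_
  have h0 : 0 < ‖x‖ ^ 2 + ε ^ 2 := by positivity
  have hi : |inner ℝ x v| ≤ ‖x‖ * ‖v‖ := abs_real_inner_le_norm x v
  simp only [kk', ContinuousLinearMap.add_apply, ContinuousLinearMap.smul_apply, ContinuousLinearMap.id_apply,
    ContinuousLinearMap.smulRight_apply, innerSL_apply_apply, smul_eq_mul]
  refine (norm_add_le _ _).trans ?_
  rw [norm_smul, norm_smul, norm_eq_abs, norm_eq_abs, abs_mul (-(4 * ((‖x‖ ^ 2 + ε ^ 2)⁻¹) ^ 2)), abs_neg, abs_of_nonneg (by positivity),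
    abs_of_nonneg (a := 4 * ((‖x‖ ^ 2 + ε ^ 2)⁻¹) ^ 2) (by positivity)]
  have h1 : (‖x‖ ^ 2 + ε ^ 2)⁻¹ * ‖x‖ ^ 2 ≤ 1 := by
    rw [inv_mul_le_iff₀ h0]; nlinarith [sq_nonneg ε]
  set q := (‖x‖ ^ 2 + ε ^ 2)⁻¹
  have hq : 0 ≤ q := by positivity
  calc 2 * q * ‖v‖ + 4 * q ^ 2 * |inner ℝ x v| * ‖x‖ ≤ 2 * q * ‖v‖ + 4 * q ^ 2 * (‖x‖ * ‖v‖) * ‖x‖ := by gcongr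
    _ = 2 * q * ‖v‖ + 4 * q * ‖v‖ * (q * ‖x‖ ^ 2) := by ring
    _ ≤ 2 * q * ‖v‖ + 4 * q * ‖v‖ * 1 := by gcongr
    _ = 6 * q * ‖v‖ := by ring

lemma kk'_bound2 {ε η : ℝ} (hε : 0 < ε) (hη : 0 ≤ η) (hη1 : η ≤ 1) {x : E2} (hx : x ≠ 0) :
    ‖kk' ε x‖ ≤ 6 * ε ^ (-η) * ‖x‖ ^ (-(2 - η)) := by
  have h : 0 < ‖x‖ := norm_pos_iff.2 hx
  refine (kk'_bound hε x).trans ?_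
  rw [mul_assoc, Real.rpow_neg hε.le, Real.rpow_neg h.le, ← mul_inv]
  gcongr
  have := Real.geom_mean_le_arith_mean2_weighted (w₁ := η / 2) (w₂ := 1 - η / 2) (by linarith) (by linarith)
    (sq_nonneg ε) (sq_nonneg ‖x‖) (by ring)
  rw [← Real.rpow_natCast, ← Real.rpow_natCast, ← Real.rpow_mul hε.le, ← Real.rpow_mul h.le,
    show ((2:ℕ):ℝ) * (η / 2) = η by push_cast; ring, show ((2:ℕ):ℝ) * (1 - η / 2) = 2 - η by push_cast; ring] at this
  refine this.trans ?_
  rw [Real.rpow_natCast, Real.rpow_natCast]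
  nlinarith [sq_nonneg ε, sq_nonneg ‖x‖]

section K4
variable {H : Type*} [NormedAddCommGroup H] [NormedSpace ℝ H]

lemma conv_diff {k : E2 → H} {k' : E2 → E2 →L[ℝ] H} (hk : ∀ z, HasFDerivAt k (k' z) z) (hkc : Continuous k')
    {C : ℝ} (hC : ∀ z, ‖k' z‖ ≤ C) {u : E2 → ℝ} (hu : Continuous u) (hcs : HasCompactSupport u) (x : E2) :
    HasFDerivAt (fun x => ∫ y, u y • k (x - y)) (∫ y, u y • k' (x - y)) x := by
  have kc : Continuous k := continuous_iff_continuousAt.2 fun z => (hk z).continuousAt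
  have hui : Integrable u := hu.integrable_of_hasCompactSupport hcs
  refine hasFDerivAt_integral_of_dominated_of_fderiv_le (F' := fun x y => u y • k' (x - y))
    (bound := fun y => ‖u y‖ * C) Filter.univ_mem ?_ ?_ ?_ ?_ (hui.norm.mul_const C) ?_
  · exact Eventually.of_forall fun x => (show Continuous fun y => u y • k (x - y) by fun_prop).aestronglyMeasurable
  · exact (show Continuous fun y => u y • k (x - y) by fun_prop).integrable_of_hasCompactSupport hcs.smul_right
  · exact (show Continuous fun y => u y • k' (x - y) by fun_prop).aestronglyMeasurable
  · refine Eventually.of_forall fun y x _ => ?_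
    rw [norm_smul]; gcongr; exact hC _
  · refine Eventually.of_forall fun y x _ => ?_
    have := ((hk (x - y)).comp x ((hasFDerivAt_id x).sub_const y)).const_smul (u y)
    rw [ContinuousLinearMap.comp_id] at this
    exact this

lemma conv_cont {X : Type*} [TopologicalSpace X] [FirstCountableTopology X] [LocallyCompactSpace X]
    {k : E2 → H} (hk : Continuous k) {ρ : X → E2 → ℝ} {R : ℝ}
    (hρ : Continuous fun q : X × E2 => ρ q.1 q.2) (hs : ∀ t y, R < ‖y‖ → ρ t y = 0) :
    Continuous fun q : X × E2 => ∫ y, ρ q.1 y • k (q.2 - y) := by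
  have : (fun q : X × E2 => ∫ y, ρ q.1 y • k (q.2 - y)) =
      fun q => ∫ y in Metric.closedBall (0:E2) R, ρ q.1 y • k (q.2 - y) := by
    funext q
    rw [setIntegral_eq_integral_of_forall_compl_eq_zero]
    intro y hy
    rw [hs _ _ (by simpa using hy), zero_smul]
  rw [this]
  refine continuous_parametric_integral_of_continuous (s := Metric.closedBall (0:E2) R) ?_ (isCompact_closedBall _ _)
  simp only [Function.uncurry_def]
  have := hρ.comp (f := fun q : (X × E2) × E2 => (q.1.1, q.2)) (by fun_prop)
  exact this.smul (hk.comp (by fun_prop))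

lemma cs_of {u : E2 → ℝ} {R : ℝ} (h : ∀ y, R < ‖y‖ → u y = 0) : HasCompactSupport u :=
  HasCompactSupport.intro (isCompact_closedBall (0:E2) R) fun y hy => h y (by simpa using hy)

lemma conv_bound' {α A m R : ℝ}
    (hα : 0 ≤ α) (hα2 : α < 2) (hA : 0 ≤ A) {k : E2 → H} (hk : StronglyMeasurable k)
    (hkb : ∀ z, z ≠ 0 → ‖k z‖ ≤ A * ‖z‖ ^ (-α)) {u : E2 → ℝ} (hu : Continuous u)
    (hub : ∀ y, |u y| ≤ m) (hus : ∀ y, R < ‖y‖ → u y = 0) (x : E2) :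
    Integrable (fun y => u y • k (x - y)) ∧
    ‖∫ y, u y • k (x - y)‖ ≤ A * m * (JJ α + volume.real (Metric.closedBall (0:E2) R)) := by
  have h1 : (fun y => u y • k (x - y)) =ᵐ[volume] fun y => u y • ({0}ᶜ : Set E2).indicator k (x - y) := by
    have : ∀ᵐ y : E2, y ≠ x := by simp [ae_iff]
    filter_upwards [this] with y hy
    rw [indicator_of_mem]
    simpa [sub_eq_zero] using hy.symm
  rw [integrable_congr h1, integral_congr_ae h1]
  refine (conv_bound hα hα2 hA (hk.indicator (by measurability)) (fun z => ?_) hu.stronglyMeasurable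
    measurableSet_closedBall measure_closedBall_lt_top.ne hub (fun y hy => hus y (by simpa using hy)) x)
  by_cases hz : z = 0
  · simp [hz]; positivity
  · rw [indicator_of_mem (by simpa using hz)]; exact hkb z hz

end K4

def vR (R : ℝ) : ℝ := volume.real (Metric.closedBall (0:E2) R)
lemma vR_nonneg (R : ℝ) : 0 ≤ vR R := measureReal_nonneg

section Field
variable {u : E2 → ℝ} {m ℓ R : ℝ}

lemma EE_int (hu : Continuous u) (hub : ∀ y, |u y| ≤ m) (hus : ∀ y, R < ‖y‖ → u y = 0) (ε : ℝ) (x : E2) :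
    Integrable fun y => u y • kk ε (x - y) :=
  (conv_bound (A := 2) (α := 1) (by norm_num) (by norm_num) (by norm_num) (kk_meas ε) (kk_bound ε) hu.stronglyMeasurable
    (S := Metric.closedBall (0:E2) R) measurableSet_closedBall measure_closedBall_lt_top.ne hub (fun y hy => hus y (by simpa using hy)) x).1

lemma EE_bound (hu : Continuous u) (hub : ∀ y, |u y| ≤ m) (hus : ∀ y, R < ‖y‖ → u y = 0) (ε : ℝ) (x : E2) :
    ‖EE ε u x‖ ≤ 2 * m * (JJ 1 + vR R) :=
  (conv_bound' (by norm_num) (by norm_num) (by norm_num) (kk_meas ε) (fun z _ => kk_bound ε z) hu hub hus x).2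

lemma EE_sub {ρ : E2 → ℝ} {m' : ℝ} (hu : Continuous u) (hub : ∀ y, |u y| ≤ m) (hus : ∀ y, R < ‖y‖ → u y = 0)
   (hu' : Continuous ρ) (hub' : ∀ y, |ρ y| ≤ m') (hus' : ∀ y, R < ‖y‖ → ρ y = 0) (ε : ℝ) (x : E2) :
    EE ε u x - EE ε ρ x = EE ε (fun y => u y - ρ y) x := by
  simp only [EE, sub_smul]
  rw [integral_sub (EE_int hu hub hus ε x) (EE_int hu' hub' hus' ε x)]

lemma EE_diff_eq (hu : Continuous u) (hub : ∀ y, |u y| ≤ m) (hus : ∀ y, R < ‖y‖ → u y = 0) (ε δ : ℝ) (x : E2) :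
    EE ε u x - EE δ u x = ∫ y, u y • (kk ε (x - y) - kk δ (x - y)) := by
  simp only [EE, smul_sub]
  rw [integral_sub (EE_int hu hub hus ε x) (EE_int hu hub hus δ x)]

lemma EE_eps (hu : Continuous u) (hub : ∀ y, |u y| ≤ m) (hus : ∀ y, R < ‖y‖ → u y = 0) {ε : ℝ} (hε : 0 ≤ ε) (x : E2) :
    ‖EE 0 u x - EE ε u x‖ ≤ 2 * √ε * m * (JJ (3/2) + vR R) := by
  rw [EE_diff_eq hu hub hus]
  exact And.right <| conv_bound' (k := fun z => kk 0 z - kk ε z) (by norm_num) (by norm_num) (by positivity)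
    ((kk_meas 0).sub (kk_meas ε)) (fun z _ => kk_diff hε z) hu hub hus x

lemma kk_diff2 {ε δ : ℝ} (hε : 0 ≤ ε) (hδ : 0 ≤ δ) (z : E2) :
    ‖kk ε z - kk δ z‖ ≤ 2 * (√ε + √δ) * ‖z‖ ^ (-(3/2:ℝ)) := by
  have := kk_diff hε z
  have := kk_diff hδ z
  have : kk ε z - kk δ z = (kk 0 z - kk δ z) - (kk 0 z - kk ε z) := by abel
  rw [this]
  refine (norm_sub_le _ _).trans ?_
  linarith

lemma EE_diff_lip (hu : Continuous u) (hub : ∀ y, |u y| ≤ m) (hus : ∀ y, R < ‖y‖ → u y = 0)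
    (hℓ : 0 ≤ ℓ) (hul : ∀ x y, |u x - u y| ≤ ℓ * ‖x - y‖) {ε δ : ℝ} (hε : 0 ≤ ε) (hδ : 0 ≤ δ) (x x' : E2) :
    ‖(EE ε u x - EE δ u x) - (EE ε u x' - EE δ u x')‖ ≤ 2 * (√ε + √δ) * ℓ * (JJ (3/2) + 2 * vR R) * ‖x - x'‖ := by
  rw [EE_diff_eq hu hub hus, EE_diff_eq hu hub hus]
  exact conv_lip (k := fun z => kk ε z - kk δ z) (by norm_num) (by norm_num) (by positivity)
    ((kk_meas ε).sub (kk_meas δ)) (kk_diff2 hε hδ) hℓ hul hus x x'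

def DEe (ε : ℝ) (u : E2 → ℝ) (x : E2) : E2 →L[ℝ] E2 := ∫ y, u y • kk' ε (x - y)

lemma kk'_bound3 {ε : ℝ} (hε : 0 < ε) (z : E2) : ‖kk' ε z‖ ≤ 6 * (ε ^ 2)⁻¹ := by
  refine (kk'_bound hε z).trans ?_
  gcongr; nlinarith [sq_nonneg ‖z‖]

lemma EE_deriv (hu : Continuous u) (hus : ∀ y, R < ‖y‖ → u y = 0) {ε : ℝ} (hε : 0 < ε) (x : E2) :
    HasFDerivAt (EE ε u) (DEe ε u x) x :=
  conv_diff (kk_deriv hε) (kk'_cont hε) (kk'_bound3 hε) hu (cs_of hus) x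

def CK (R : ℝ) : ℝ := 2 * (JJ (3/2) + 2 * vR R) + 6 * rexp 1 * (4 * vb2 + vR R)

lemma CK_nonneg (R : ℝ) : 0 ≤ CK R := by
  have := vR_nonneg R; have := vb2_nonneg
  have := JJ_nonneg (α := 3/2) (by norm_num)
  unfold CK; positivity

/-- log-Lipschitz type bound -/
lemma EE_lip (hu : Continuous u) (hub : ∀ y, |u y| ≤ m) (hus : ∀ y, R < ‖y‖ → u y = 0)
    (hℓ : 0 ≤ ℓ) (hul : ∀ x y, |u x - u y| ≤ ℓ * ‖x - y‖) {J : ℝ} (hJ : 0 ≤ J) (x x' : E2) :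
    ‖EE 0 u x - EE 0 u x'‖ ≤ CK R * (ℓ * rexp (-J) + m * (1 + J)) * ‖x - x'‖ := by
  have hm : 0 ≤ m := (abs_nonneg _).trans (hub 0)
  set d := rexp (-(2 * J)) with hd
  have hd0 : 0 < d := exp_pos _
  set η := 1 / (1 + 2 * J) with hη
  have hη0 : 0 < η := by positivity
  have hη1 : η ≤ 1 := by rw [hη, div_le_one (by positivity)]; linarith
  have hsd : √d = rexp (-J) := by
    rw [hd, show -(2 * J) = -J + -J by ring, Real.exp_add, Real.sqrt_mul_self (exp_pos _).le]
  have h1 := EE_diff_lip hu hub hus hℓ hul le_rfl hd0.le x x'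
  have hde : d ^ (-η) ≤ rexp 1 := by
    rw [hd, ← Real.exp_mul]
    gcongr
    rw [hη]
    have : -(2 * J) * -(1 / (1 + 2 * J)) = 2 * J / (1 + 2 * J) := by ring
    rw [this, div_le_one (by positivity)]; linarith
  have hb : ∀ z, ‖DEe d u z‖ ≤ 6 * rexp 1 * m * (2 * vb2 * (1 + 2 * J) + vR R) := by
    intro z
    have hj : JJ (2 - η) = 2 * vb2 * (1 + 2 * J) := by rw [JJ, hη]; field_simp; ring
    refine (conv_bound' (A := 6 * d ^ (-η)) (α := 2 - η) (by linarith) (by linarith) (by positivity)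
      (kk'_cont hd0).stronglyMeasurable (fun z hz => kk'_bound2 hd0 hη0.le hη1 hz) hu hub hus z).2.trans ?_
    rw [hj]
    have := vR_nonneg R; have := vb2_nonneg
    show 6 * d ^ (-η) * m * (2 * vb2 * (1 + 2 * J) + vR R) ≤ _
    gcongr
  have h2 : ‖EE d u x - EE d u x'‖ ≤ 6 * rexp 1 * m * (2 * vb2 * (1 + 2 * J) + vR R) * ‖x - x'‖ :=
    convex_univ.norm_image_sub_le_of_norm_hasFDerivWithin_le
      (fun z _ => (EE_deriv hu hus hd0 z).hasFDerivWithinAt) (fun z _ => hb z) (mem_univ x') (mem_univ x)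
  have : EE 0 u x - EE 0 u x' = ((EE 0 u x - EE d u x) - (EE 0 u x' - EE d u x')) + (EE d u x - EE d u x') := by abel
  rw [this]
  refine (norm_add_le _ _).trans ((add_le_add h1 h2).trans ?_)
  rw [← add_mul]
  gcongr
  rw [hsd, Real.sqrt_zero, CK]
  have := vR_nonneg R; have := vb2_nonneg
  have := JJ_nonneg (α := 3/2) (by norm_num)
  have e1 : 0 ≤ ℓ * rexp (-J) := by positivity
  have e2 : 0 ≤ 6 * rexp 1 * (4 * vb2 + vR R) * (ℓ * rexp (-J)) := by positivity
  have e3 : 0 ≤ 2 * (JJ (3/2) + 2 * vR R) * (m * (1 + J)) := by positivity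
  have e4 : 6 * rexp 1 * m * (2 * vb2 * (1 + 2 * J) + vR R) ≤ 6 * rexp 1 * m * (2 * vb2 * (2 + 2 * J) + vR R * (1 + J)) := by
    gcongr
    · norm_num
    · nlinarith
  nlinarith

lemma EE_cont {X : Type*} [TopologicalSpace X] [FirstCountableTopology X] [LocallyCompactSpace X] {ρ : X → E2 → ℝ}
    (hρ : Continuous fun q : X × E2 => ρ q.1 q.2) (hb : ∀ t y, |ρ t y| ≤ m) (hs : ∀ t y, R < ‖y‖ → ρ t y = 0) :
    Continuous fun q : X × E2 => EE 0 (ρ q.1) q.2 := by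
  have hc : ∀ t, Continuous (ρ t) := fun t => hρ.comp (f := fun y : E2 => (t, y)) (by fun_prop)
  have hu : TendstoUniformly (fun (n : ℕ) (q : X × E2) => EE (1 / (n + 1 : ℝ)) (ρ q.1) q.2) (fun q => EE 0 (ρ q.1) q.2) atTop := by
    rw [Metric.tendstoUniformly_iff]
    intro e he
    have : Tendsto (fun n : ℕ => 2 * √(1 / (n + 1 : ℝ)) * m * (JJ (3/2) + vR R)) atTop (𝓝 (2 * √0 * m * (JJ (3/2) + vR R))) := by
      have := tendsto_one_div_add_atTop_nhds_zero_nat (𝕜 := ℝ)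
      exact ((((Real.continuous_sqrt.tendsto 0).comp this).const_mul 2).mul_const m).mul_const _
    rw [show 2 * √0 * m * (JJ (3/2) + vR R) = 0 by simp] at this
    filter_upwards [this.eventually (gt_mem_nhds he)] with n hn q
    rw [dist_eq_norm]
    exact (EE_eps (hc _) (hb _) (hs _) (by positivity) _).trans_lt hn
  refine hu.continuous (Frequently.of_forall fun n => ?_)
  have hn : (0:ℝ) < 1 / (n + 1) := by positivity
  exact conv_cont (continuous_iff_continuousAt.2 fun z => (kk_deriv hn z).continuousAt) hρ hs

/-- `C¹` regularity of the field -/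
lemma EE_C1 {X : Type*} [TopologicalSpace X] [FirstCountableTopology X] [LocallyCompactSpace X] {ρ : X → E2 → ℝ}
    (hρ : Continuous fun q : X × E2 => ρ q.1 q.2) (hb : ∀ t y, |ρ t y| ≤ m) (hs : ∀ t y, R < ‖y‖ → ρ t y = 0)
    (hℓ : 0 ≤ ℓ) (hl : ∀ t x y, |ρ t x - ρ t y| ≤ ℓ * ‖x - y‖) :
    ∃ D : X → E2 → E2 →L[ℝ] E2, (∀ t x, HasFDerivAt (EE 0 (ρ t)) (D t x) x) ∧
      Continuous fun q : X × E2 => D q.1 q.2 := by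
  have hc : ∀ t, Continuous (ρ t) := fun t => hρ.comp (f := fun y : E2 => (t, y)) (by fun_prop)
  set e : ℕ → ℝ := fun n => 1 / (n + 1 : ℝ) with he
  have he0 : ∀ n, 0 < e n := fun n => by simp only [he]; positivity
  have het : Tendsto (fun n => √(e n)) atTop (𝓝 0) := by
    have := tendsto_one_div_add_atTop_nhds_zero_nat (𝕜 := ℝ)
    have h2 := (Real.continuous_sqrt.tendsto 0).comp this
    rw [Real.sqrt_zero] at h2; exact h2
  set C := JJ (3/2) + 2 * vR R with hC
  have hC0 : 0 ≤ C := by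
    have := vR_nonneg R; have := JJ_nonneg (α := 3/2) (by norm_num); positivity
  have hcau : ∀ n k (q : X × E2), ‖DEe (e n) (ρ q.1) q.2 - DEe (e k) (ρ q.1) q.2‖ ≤ 2 * (√(e n) + √(e k)) * ℓ * C := by
    intro n k q
    have h := (EE_deriv (hc q.1) (hs q.1) (he0 n) q.2).sub (EE_deriv (hc q.1) (hs q.1) (he0 k) q.2)
    exact h.le_of_lip' (by positivity) (Eventually.of_forall fun x =>
      EE_diff_lip (hc q.1) (hb q.1) (hs q.1) hℓ (hl q.1) (he0 n).le (he0 k).le x q.2)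
  have hU : UniformCauchySeqOn (fun n (q : X × E2) => DEe (e n) (ρ q.1) q.2) atTop univ := by
    rw [Metric.uniformCauchySeqOn_iff]
    intro δ hδ
    have : Tendsto (fun n => 2 * √(e n) * ℓ * C) atTop (𝓝 0) := by
      simpa using ((het.const_mul 2).mul_const ℓ).mul_const C
    obtain ⟨N, hN⟩ := eventually_atTop.1 (this.eventually (gt_mem_nhds (half_pos hδ)))
    refine ⟨N, fun a ha b hb q _ => ?_⟩
    rw [dist_eq_norm]
    refine (hcau a b q).trans_lt ?_
    have := hN a ha; have := hN b hb
    nlinarith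
  have hlim : ∀ q : X × E2, ∃ L, Tendsto (fun n => DEe (e n) (ρ q.1) q.2) atTop (𝓝 L) :=
    fun q => cauchySeq_tendsto_of_complete (hU.cauchySeq (mem_univ q))
  choose D hD using hlim
  have hT : TendstoUniformlyOn (fun n (q : X × E2) => DEe (e n) (ρ q.1) q.2) D atTop univ :=
    hU.tendstoUniformlyOn_of_tendsto fun q _ => hD q
  rw [tendstoUniformlyOn_univ] at hT
  refine ⟨fun t x => D (t, x), fun t x => ?_, ?_⟩
  · refine hasFDerivAt_of_tendstoUniformly (l := atTop) (g := EE 0 (ρ t)) (g' := fun x => D (t, x)) (f := fun n => EE (e n) (ρ t)) (f' := fun n x => DEe (e n) (ρ t) x) ?_ (fun n x => EE_deriv (hc t) (hs t) (he0 n) x) (fun x => ?_) x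
    · exact hT.comp fun x => (t, x)
    · rw [tendsto_iff_norm_sub_tendsto_zero]
      refine squeeze_zero (fun _ => norm_nonneg _) (fun n => ?_) (g := fun n => 2 * √(e n) * m * (JJ (3/2) + vR R)) ?_
      · rw [norm_sub_rev]; exact EE_eps (hc t) (hb t) (hs t) (he0 n).le x
      · simpa using ((het.const_mul 2).mul_const m).mul_const (JJ (3/2) + vR R)
  · refine hT.continuous (Frequently.of_forall fun n => ?_)
    exact conv_cont (kk'_cont (he0 n)) hρ hs

end Field
end VP
end

section
set_option linter.all false
namespace VP
open Set Filter Topology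

/-- logarithmic kernel -/
def LL (ε : ℝ) (z : E2) : ℝ := Real.log (‖z‖ ^ 2 + ε ^ 2)

lemma LL_zero (z : E2) : LL 0 z = 2 * Real.log ‖z‖ := by
  rw [LL]; simp

lemma LL_meas (ε : ℝ) : StronglyMeasurable (LL ε) := by
  unfold LL; apply Measurable.stronglyMeasurable; fun_prop

lemma LL_deriv {ε : ℝ} (hε : 0 < ε) (x : E2) : HasFDerivAt (LL ε) (innerSL ℝ (kk ε x)) x := by
  have h0 : ‖x‖ ^ 2 + ε ^ 2 ≠ 0 := by positivity
  have h1 : HasFDerivAt (fun x : E2 => ‖x‖ ^ 2 + ε ^ 2) (2 • innerSL ℝ x) x :=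
    (hasStrictFDerivAt_norm_sq x).hasFDerivAt.add_const _
  refine (h1.log h0).congr_fderiv ?_
  ext v
  simp [kk, real_inner_smul_left]
  ring

lemma kk_cont {ε : ℝ} (hε : 0 < ε) : Continuous (kk ε) :=
  continuous_iff_continuousAt.2 fun z => (kk_deriv hε z).continuousAt

lemma LL_cont {ε : ℝ} (hε : 0 < ε) : Continuous (LL ε) :=
  continuous_iff_continuousAt.2 fun z => (LL_deriv hε z).continuousAt

lemma kk_bd {ε : ℝ} (hε : 0 < ε) (x : E2) : ‖kk ε x‖ ≤ ε⁻¹ := by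
  rw [kk, norm_smul, norm_eq_abs, abs_of_nonneg (by positivity), ← div_eq_mul_inv, div_mul_eq_mul_div,
    div_le_iff₀ (by positivity), inv_mul_eq_div, le_div_iff₀ hε]
  nlinarith [sq_nonneg (‖x‖ - ε)]

lemma LL_diff {ε : ℝ} (hε : 0 ≤ ε) {z : E2} (hz : z ≠ 0) : |LL 0 z - LL ε z| ≤ 2 * ε * ‖z‖ ^ (-(1:ℝ)) := by
  have h : 0 < ‖z‖ := norm_pos_iff.2 hz
  rw [rpow_neg_one_norm, abs_sub_comm, LL, LL, ← Real.log_div (by positivity) (by positivity)]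
  have e : (‖z‖ ^ 2 + ε ^ 2) / (‖z‖ ^ 2 + 0 ^ 2) = 1 + (ε * ‖z‖⁻¹) ^ 2 := by field_simp; simp
  rw [e]
  set s := ε * ‖z‖⁻¹ with hs
  have hs0 : 0 ≤ s := by positivity
  rw [abs_of_nonneg (Real.log_nonneg (by nlinarith [sq_nonneg s]))]
  calc Real.log (1 + s ^ 2) ≤ Real.log ((1 + s) ^ 2) := Real.log_le_log (by positivity) (by nlinarith)
    _ = 2 * Real.log (1 + s) := by rw [Real.log_pow]; norm_num
    _ ≤ 2 * s := by nlinarith [Real.log_le_sub_one_of_pos (show 0 < 1 + s by positivity)]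
    _ = _ := by rw [hs]; ring

section Pot
variable {u : E2 → ℝ} {m R : ℝ}

lemma LL_int_diff (hu : Continuous u) (hub : ∀ y, |u y| ≤ m) (hus : ∀ y, R < ‖y‖ → u y = 0) {ε : ℝ} (hε : 0 ≤ ε) (x : E2) :
    Integrable (fun y => u y • (LL 0 (x - y) - LL ε (x - y))) ∧
    ‖∫ y, u y • (LL 0 (x - y) - LL ε (x - y))‖ ≤ 2 * ε * m * (JJ 1 + vR R) :=
  conv_bound' (k := fun z => LL 0 z - LL ε z) (by norm_num) (by norm_num) (by positivity)
    ((LL_meas 0).sub (LL_meas ε)) (fun z hz => LL_diff hε hz) hu hub hus x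

lemma LL_int_pos (hu : Continuous u) (hus : ∀ y, R < ‖y‖ → u y = 0) {ε : ℝ} (hε : 0 < ε) (x : E2) :
    Integrable (fun y => u y • LL ε (x - y)) := by
  have := LL_cont hε
  exact (show Continuous fun y => u y • LL ε (x - y) by fun_prop).integrable_of_hasCompactSupport (cs_of hus).smul_right

lemma LL_int (hu : Continuous u) (hub : ∀ y, |u y| ≤ m) (hus : ∀ y, R < ‖y‖ → u y = 0) (x : E2) :
    Integrable (fun y => u y • LL 0 (x - y)) := by
  refine ((LL_int_diff hu hub hus zero_le_one x).1.add (LL_int_pos hu hus zero_lt_one x)).congr ?_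
  exact Eventually.of_forall fun y => by simp [mul_sub]

lemma pot_deriv (hu : Continuous u) (hub : ∀ y, |u y| ≤ m) (hus : ∀ y, R < ‖y‖ → u y = 0) (x : E2) :
    HasFDerivAt (fun x => ∫ y, u y • LL 0 (x - y)) (innerSL ℝ (EE 0 u x)) x := by
  set e : ℕ → ℝ := fun n => 1 / (n + 1 : ℝ) with he
  have he0 : ∀ n, 0 < e n := fun n => by simp only [he]; positivity
  have het : Tendsto e atTop (𝓝 0) := tendsto_one_div_add_atTop_nhds_zero_nat (𝕜 := ℝ)
  have hst : Tendsto (fun n => √(e n)) atTop (𝓝 0) := by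
    have h2 := (Real.continuous_sqrt.tendsto 0).comp het
    rw [Real.sqrt_zero] at h2; exact h2
  have hd : ∀ n x, HasFDerivAt (fun x => ∫ y, u y • LL (e n) (x - y)) (innerSL ℝ (EE (e n) u x)) x := by
    intro n x
    have h1 := conv_diff (k' := fun z => innerSL ℝ (kk (e n) z)) (LL_deriv (he0 n))
      ((innerSL ℝ).continuous.comp (kk_cont (he0 n))) (C := (e n)⁻¹)
      (fun z => by rw [innerSL_apply_norm]; exact kk_bd (he0 n) z) hu (cs_of hus) x
    refine h1.congr_fderiv ?_
    rw [EE, ← ContinuousLinearMap.integral_comp_comm _ (EE_int hu hub hus _ x)]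
    simp
  refine hasFDerivAt_of_tendstoUniformly (l := atTop) (g' := fun x => innerSL ℝ (EE 0 u x)) ?_ hd (fun x => ?_) x
  · rw [Metric.tendstoUniformly_iff]
    intro δ hδ
    have : Tendsto (fun n => 2 * √(e n) * m * (JJ (3/2) + vR R)) atTop (𝓝 0) := by
      simpa using ((hst.const_mul 2).mul_const m).mul_const (JJ (3/2) + vR R)
    filter_upwards [this.eventually (gt_mem_nhds hδ)] with n hn x
    rw [dist_eq_norm, ← map_sub, innerSL_apply_norm]
    exact (EE_eps hu hub hus (he0 n).le x).trans_lt hn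
  · rw [tendsto_iff_norm_sub_tendsto_zero]
    refine squeeze_zero (fun _ => norm_nonneg _) (fun n => ?_) (g := fun n => 2 * e n * m * (JJ 1 + vR R)) ?_
    · rw [norm_sub_rev, ← integral_sub (LL_int hu hub hus x) (LL_int_pos hu hus (he0 n) x)]
      simp only [← smul_sub]
      exact (LL_int_diff hu hub hus (he0 n).le x).2
    · simpa using ((het.const_mul 2).mul_const m).mul_const (JJ 1 + vR R)

end Pot
end VP
end

section
set_option linter.all false
namespace VP
open Set Filter Topology

abbrev Z : Type := E2 × E3

lemma e2_0 (a b : ℝ) : e2 a b 0 = a := rfl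
lemma e2_1 (a b : ℝ) : e2 a b 1 = b := rfl
lemma e3_0 (a b c : ℝ) : e3 a b c 0 = a := rfl
lemma e3_1 (a b c : ℝ) : e3 a b c 1 = b := rfl
lemma e3_2 (a b c : ℝ) : e3 a b c 2 = c := rfl

lemma ext2 {v w : E2} (h0 : v 0 = w 0) (h1 : v 1 = w 1) : v = w := by
  ext i; fin_cases i <;> assumption
lemma ext3 {v w : E3} (h0 : v 0 = w 0) (h1 : v 1 = w 1) (h2 : v 2 = w 2) : v = w := by
  ext i; fin_cases i <;> assumption

lemma nsq2 (v : E2) : ‖v‖ ^ 2 = v 0 ^ 2 + v 1 ^ 2 := by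
  rw [EuclideanSpace.real_norm_sq_eq]; simp [Fin.sum_univ_two]
lemma nsq3 (v : E3) : ‖v‖ ^ 2 = v 0 ^ 2 + v 1 ^ 2 + v 2 ^ 2 := by
  rw [EuclideanSpace.real_norm_sq_eq]; simp [Fin.sum_univ_three]
lemma inn2 (v w : E2) : inner ℝ v w = v 0 * w 0 + v 1 * w 1 := by
  simp [PiLp.inner_apply, Fin.sum_univ_two, mul_comm]
lemma inn3 (v w : E3) : inner ℝ v w = v 0 * w 0 + v 1 * w 1 + v 2 * w 2 := by
  simp [PiLp.inner_apply, Fin.sum_univ_three, mul_comm]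

/-- projection to the first two components -/
def piL : E3 →L[ℝ] E2 := LinearMap.mkContinuous
  { toFun := fun p => e2 (p 0) (p 1)
    map_add' := fun p q => ext2 (by simp [e2_0]) (by simp [e2_1])
    map_smul' := fun c p => ext2 (by simp [e2_0]) (by simp [e2_1]) } 1 (fun p => by
      rw [one_mul]
      refine abs_le_of_sq_le_sq' ?_ (norm_nonneg _) |>.2
      simp only [LinearMap.coe_mk, AddHom.coe_mk]
      rw [nsq2, nsq3, e2_0, e2_1]; nlinarith [sq_nonneg (p 2)])

lemma piL_apply (p : E3) : piL p = e2 (p 0) (p 1) := rfl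

lemma piL_le (p : E3) : ‖piL p‖ ≤ ‖p‖ := by
  refine abs_le_of_sq_le_sq' ?_ (norm_nonneg _) |>.2
  rw [nsq2, nsq3, piL_apply, e2_0, e2_1]; nlinarith [sq_nonneg (p 2)]

/-- embedding -/
def ioL : E2 →L[ℝ] E3 := LinearMap.mkContinuous
  { toFun := fun p => e3 (p 0) (p 1) 0
    map_add' := fun p q => ext3 (by simp [e3_0]) (by simp [e3_1]) (by simp [e3_2])
    map_smul' := fun c p => ext3 (by simp [e3_0]) (by simp [e3_1]) (by simp [e3_2]) } 1 (fun p => by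
      rw [one_mul]
      refine abs_le_of_sq_le_sq' ?_ (norm_nonneg _) |>.2
      simp only [LinearMap.coe_mk, AddHom.coe_mk]
      rw [nsq2, nsq3, e3_0, e3_1, e3_2]; simp)

lemma ioL_apply (p : E2) : ioL p = e3 (p 0) (p 1) 0 := rfl

lemma ioL_norm (p : E2) : ‖ioL p‖ = ‖p‖ := by
  have : ‖ioL p‖ ^ 2 = ‖p‖ ^ 2 := by rw [nsq2, nsq3, ioL_apply, e3_0, e3_1, e3_2]; ring
  exact (pow_left_inj₀ (norm_nonneg _) (norm_nonneg _) two_ne_zero).1 this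

lemma inner_ioL (v : E2) (p : E3) : inner ℝ p (ioL v) = inner ℝ (piL p) v := by
  rw [inn3, inn2, ioL_apply, piL_apply, e3_0, e3_1, e3_2, e2_0, e2_1]; ring

lemma cross_0 (u v : E3) : cross u v 0 = u 1 * v 2 - u 2 * v 1 := rfl
lemma cross_1 (u v : E3) : cross u v 1 = u 2 * v 0 - u 0 * v 2 := rfl
lemma cross_2 (u v : E3) : cross u v 2 = u 0 * v 1 - u 1 * v 0 := rfl

lemma cross_le (u v : E3) : ‖cross u v‖ ≤ ‖u‖ * ‖v‖ := by
  refine abs_le_of_sq_le_sq' ?_ (by positivity) |>.2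
  rw [mul_pow, nsq3, nsq3, nsq3, cross_0, cross_1, cross_2]
  nlinarith [sq_nonneg (u 0 * v 0 + u 1 * v 1 + u 2 * v 2)]

def crossL : E3 →L[ℝ] E3 →L[ℝ] E3 := LinearMap.mkContinuous₂
  (LinearMap.mk₂ ℝ cross
    (fun a b c => ext3 (by simp [cross_0]; ring) (by simp [cross_1]; ring) (by simp [cross_2]; ring))
    (fun a b c => ext3 (by simp [cross_0]; ring) (by simp [cross_1]; ring) (by simp [cross_2]; ring))
    (fun a b c => ext3 (by simp [cross_0]; ring) (by simp [cross_1]; ring) (by simp [cross_2]; ring))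
    (fun a b c => ext3 (by simp [cross_0]; ring) (by simp [cross_1]; ring) (by simp [cross_2]; ring))) 1
  (fun x y => by rw [one_mul]; exact cross_le x y)

lemma crossL_apply (u v : E3) : crossL u v = cross u v := rfl

lemma inner_cross_self (u v : E3) : inner ℝ u (cross u v) = 0 := by
  rw [inn3, cross_0, cross_1, cross_2]; ring

section Cut
variable {H : Type*} [NormedAddCommGroup H] [InnerProductSpace ℝ H]

/-- smooth cutoff of the identity -/
def cut (N : ℝ) (v : H) : H := Real.smoothTransition (N ^ 2 + 1 - ‖v‖ ^ 2) • v

lemma cut_eq {N : ℝ} {v : H} (h : ‖v‖ ≤ N) : cut N v = v := by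
  rw [cut, Real.smoothTransition.one_of_one_le, one_smul]
  nlinarith [norm_nonneg v]

lemma cut_zero {N : ℝ} {v : H} (h : |N| + 1 ≤ ‖v‖) : cut N v = 0 := by
  rw [cut, Real.smoothTransition.zero_of_nonpos, zero_smul]
  nlinarith [abs_nonneg N, sq_abs N]

lemma cut_bd (N : ℝ) (v : H) : ‖cut N v‖ ≤ |N| + 1 := by
  rcases le_total (|N| + 1) ‖v‖ with h | h
  · rw [cut_zero h, norm_zero]; positivity
  · rw [cut, norm_smul, norm_eq_abs, abs_of_nonneg (Real.smoothTransition.nonneg _)]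
    nlinarith [Real.smoothTransition.le_one (N ^ 2 + 1 - ‖v‖ ^ 2), norm_nonneg v]

lemma cut_contDiff (N : ℝ) : ContDiff ℝ 1 (cut N : H → H) := by
  unfold cut
  exact ((Real.smoothTransition.contDiff (n := 1)).comp (contDiff_const.sub (contDiff_norm_sq ℝ))).smul contDiff_id

lemma cut_deriv (N : ℝ) (v : H) : ∃ a b : ℝ, ∀ w, fderiv ℝ (cut N : H → H) v w = a • w + (b * inner ℝ v w) • v := by
  have h1 : HasFDerivAt (fun x : H => N ^ 2 + 1 - ‖x‖ ^ 2) (-(2 • innerSL ℝ v)) v :=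
    (hasStrictFDerivAt_norm_sq v).hasFDerivAt.const_sub _
  have h2 : HasDerivAt Real.smoothTransition (deriv Real.smoothTransition (N ^ 2 + 1 - ‖v‖ ^ 2)) (N ^ 2 + 1 - ‖v‖ ^ 2) :=
    ((Real.smoothTransition.contDiff (n := 1)).differentiable (by norm_num) _).hasDerivAt
  have hc : HasFDerivAt (fun x : H => Real.smoothTransition (N ^ 2 + 1 - ‖x‖ ^ 2))
      (deriv Real.smoothTransition (N ^ 2 + 1 - ‖v‖ ^ 2) • (-(2 • innerSL ℝ v) : H →L[ℝ] ℝ)) v := by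
    have := h2.comp_hasFDerivAt v h1
    exact this
  have h3 := hc.fun_smul (hasFDerivAt_id v : HasFDerivAt (fun x : H => x) _ v)
  rw [show (cut N : H → H) = (fun x : H => Real.smoothTransition (N ^ 2 + 1 - ‖x‖ ^ 2) • id x) from rfl, h3.fderiv]
  refine ⟨Real.smoothTransition (N ^ 2 + 1 - ‖v‖ ^ 2), -2 * deriv Real.smoothTransition (N ^ 2 + 1 - ‖v‖ ^ 2), fun w => ?_⟩
  simp
  ring_nf

variable [FiniteDimensional ℝ H]
lemma cut_lip_ex (H : Type*) [NormedAddCommGroup H] [InnerProductSpace ℝ H] [FiniteDimensional ℝ H] (N : ℝ) :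
    ∃ K, LipschitzWith K (cut N : H → H) := by
  refine ContDiff.lipschitzWith_of_hasCompactSupport ?_ (cut_contDiff N) one_ne_zero
  have : ProperSpace H := FiniteDimensional.proper ℝ H
  refine HasCompactSupport.intro (isCompact_closedBall (0:H) (|N| + 1)) fun v hv => cut_zero ?_
  simp at hv; exact hv.le

def cutK (H : Type*) [NormedAddCommGroup H] [InnerProductSpace ℝ H] [FiniteDimensional ℝ H] (N : ℝ) : NNReal :=
  (cut_lip_ex H N).choose

lemma cut_lip (N : ℝ) (v w : H) : ‖cut N v - cut N w‖ ≤ cutK H N * ‖v - w‖ := by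
  have := (cut_lip_ex H N).choose_spec.dist_le_mul v w
  rwa [dist_eq_norm, dist_eq_norm] at this
end Cut

structure GoodB (B : ℝ → E2 → E3) (DB : ℝ → E2 → E2 →L[ℝ] E3) (b : ℝ) : Prop where
  cont : Continuous fun q : ℝ × E2 => B q.1 q.2
  hd : ∀ t x, HasFDerivAt (B t) (DB t x) x
  hdc : Continuous fun q : ℝ × E2 => DB q.1 q.2
  bd : ∀ t x, ‖B t x‖ ≤ b
  dbd : ∀ t x, ‖DB t x‖ ≤ b

lemma GoodB.nonneg {B DB b} (h : GoodB B DB b) : 0 ≤ b := (norm_nonneg _).trans (h.bd 0 0)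

lemma GoodB.lip {B DB b} (h : GoodB B DB b) (t : ℝ) (x y : E2) : ‖B t x - B t y‖ ≤ b * ‖x - y‖ :=
  convex_univ.norm_image_sub_le_of_norm_hasFDerivWithin_le
      (fun z _ => (h.hd t z).hasFDerivWithinAt) (fun z _ => h.dbd t z) (mem_univ y) (mem_univ x)

structure GoodE (E : ℝ → E2 → E2) (L c : ℝ) : Prop where
  cont : Continuous fun q : ℝ × E2 => E q.1 q.2
  lip : ∀ t x y, ‖E t x - E t y‖ ≤ L * ‖x - y‖
  bd : ∀ t x, ‖E t x‖ ≤ c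

lemma GoodE.L_nonneg {E L c} (h : GoodE E L c) : 0 ≤ L := by
  have := h.lip 0 (EuclideanSpace.single 0 1) 0
  have := (norm_nonneg _).trans this
  simpa using this

/-- truncated phase-space vector field -/
def VF (N : ℝ) (B : ℝ → E2 → E3) (E : ℝ → E2 → E2) (σ : ℝ) (t : ℝ) (z : Z) : Z :=
  (piL z.2, σ • (ioL (E t z.1) + crossL (cut N z.2) (B t z.1)))

def K0 (N b : ℝ) : ℝ := 1 + cutK E3 N * b + (|N| + 1) * b

lemma K0_nonneg (N : ℝ) {b : ℝ} (hb : 0 ≤ b) : 0 ≤ K0 N b := by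
  unfold K0; positivity

section VFs
variable {N : ℝ} {B : ℝ → E2 → E3} {DB : ℝ → E2 → E2 →L[ℝ] E3} {b σ : ℝ} {E : ℝ → E2 → E2} {L c : ℝ}

lemma VF_lip (hB : GoodB B DB b) (hσ : |σ| = 1) {t ℓ : ℝ} (hℓ : ∀ x y, ‖E t x - E t y‖ ≤ ℓ * ‖x - y‖) (hℓ0 : 0 ≤ ℓ)
    (z z' : Z) : ‖VF N B E σ t z - VF N B E σ t z'‖ ≤ (K0 N b + ℓ) * ‖z - z'‖ := by
  have hb := hB.nonneg
  have h1 : ‖z.1 - z'.1‖ ≤ ‖z - z'‖ := norm_fst_le (z - z')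
  have h2 : ‖z.2 - z'.2‖ ≤ ‖z - z'‖ := norm_snd_le (z - z')
  have hn := norm_nonneg (z - z')
  simp only [VF, Prod.mk_sub_mk]
  refine norm_prod_le_iff.2 ⟨?_, ?_⟩
  · simp only
    rw [← map_sub]
    refine (piL_le _).trans (h2.trans ?_)
    have : 1 ≤ K0 N b + ℓ := by unfold K0; nlinarith [mul_nonneg (cutK E3 N).2 hb, mul_nonneg (by positivity : 0 ≤ |N| + 1) hb]
    nlinarith
  · simp only
    rw [← smul_sub, norm_smul, norm_eq_abs, hσ, one_mul]
    have e : ioL (E t z.1) + crossL (cut N z.2) (B t z.1) - (ioL (E t z'.1) + crossL (cut N z'.2) (B t z'.1)) =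
      ioL (E t z.1 - E t z'.1) + (cross (cut N z.2 - cut N z'.2) (B t z.1) + cross (cut N z'.2) (B t z.1 - B t z'.1)) := by
      simp only [← crossL_apply, map_sub, ContinuousLinearMap.sub_apply]; abel
    rw [e]
    have a1 : ‖cross (cut N z.2 - cut N z'.2) (B t z.1)‖ ≤ cutK E3 N * ‖z - z'‖ * b := by
      refine (cross_le _ _).trans ?_
      gcongr
      · exact (cut_lip N _ _).trans (by gcongr)
      · exact hB.bd _ _
    have a2 : ‖cross (cut N z'.2) (B t z.1 - B t z'.1)‖ ≤ (|N| + 1) * (b * ‖z - z'‖) := by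
      refine (cross_le _ _).trans ?_
      gcongr
      · exact cut_bd N _
      · exact (hB.lip _ _ _).trans (by gcongr)
    have a3 : ‖ioL (E t z.1 - E t z'.1)‖ ≤ ℓ * ‖z - z'‖ := by
      rw [ioL_norm]; exact (hℓ _ _).trans (by gcongr)
    refine (norm_add_le _ _).trans ((add_le_add a3 ((norm_add_le _ _).trans (add_le_add a1 a2))).trans ?_)
    unfold K0; nlinarith

lemma VF_diff (hσ : |σ| = 1) (E' : ℝ → E2 → E2) (t : ℝ) (z : Z) :
    ‖VF N B E σ t z - VF N B E' σ t z‖ ≤ ‖E t z.1 - E' t z.1‖ := by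
  simp only [VF, Prod.mk_sub_mk]
  refine norm_prod_le_iff.2 ⟨by simp, ?_⟩
  simp only
  rw [← smul_sub, norm_smul, norm_eq_abs, hσ, one_mul, add_sub_add_right_eq_sub, ← map_sub, ioL_norm]

def KV (N b L : ℝ) : NNReal := (K0 N b + L).toNNReal

lemma KV_coe (hB : GoodB B DB b) (hL : 0 ≤ L) : (KV N b L : ℝ) = K0 N b + L :=
  Real.coe_toNNReal _ (add_nonneg (K0_nonneg N hB.nonneg) hL)

lemma VF_Lip (hB : GoodB B DB b) (hE : GoodE E L c) (hσ : |σ| = 1) : LipVF (VF N B E σ) (KV N b L) := by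
  constructor
  · unfold VF
    have h1 : Continuous fun q : ℝ × Z => E q.1 q.2.1 := hE.cont.comp (f := fun q : ℝ × Z => (q.1, q.2.1)) (by fun_prop)
    have h2 : Continuous fun q : ℝ × Z => B q.1 q.2.1 := hB.cont.comp (f := fun q : ℝ × Z => (q.1, q.2.1)) (by fun_prop)
    have h3 : Continuous fun q : ℝ × Z => cut N q.2.2 := (cut_contDiff N).continuous.comp (by fun_prop)
    have h4 : Continuous fun q : ℝ × Z => crossL (cut N q.2.2) (B q.1 q.2.1) := crossL.continuous₂.comp (h3.prodMk h2)
    exact (by fun_prop : Continuous fun q : ℝ × Z => piL q.2.2).prodMk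
      (((ioL.continuous.comp h1 : Continuous fun q : ℝ × Z => ioL (E q.1 q.2.1)).add h4).const_smul σ)
  · intro t
    refine LipschitzWith.of_dist_le_mul fun z z' => ?_
    rw [dist_eq_norm, dist_eq_norm, KV_coe hB hE.L_nonneg]
    exact VF_lip hB hσ (hE.lip t) hE.L_nonneg z z'

/-- derivative of `VF` -/
def DVF (N : ℝ) (B : ℝ → E2 → E3) (DB : ℝ → E2 → E2 →L[ℝ] E3) (DE : ℝ → E2 → E2 →L[ℝ] E2) (σ : ℝ) (t : ℝ) (z : Z) :
    Z →L[ℝ] Z :=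
  (piL.comp (ContinuousLinearMap.snd ℝ E2 E3)).prod
    (σ • (ioL.comp ((DE t z.1).comp (ContinuousLinearMap.fst ℝ E2 E3)) +
      ((crossL (cut N z.2)).comp ((DB t z.1).comp (ContinuousLinearMap.fst ℝ E2 E3)) +
       (crossL.flip (B t z.1)).comp ((fderiv ℝ (cut N) z.2).comp (ContinuousLinearMap.snd ℝ E2 E3)))))

lemma VF_C1 (hB : GoodB B DB b) (hE : GoodE E L c) (hσ : |σ| = 1) {DE : ℝ → E2 → E2 →L[ℝ] E2}
    (hd : ∀ t x, HasFDerivAt (E t) (DE t x) x) (hdc : Continuous fun q : ℝ × E2 => DE q.1 q.2) :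
    C1VF (VF N B E σ) (DVF N B DB DE σ) (KV N b L) := by
  refine ⟨VF_Lip hB hE hσ, fun t z => ?_, ?_⟩
  · have f1 : HasFDerivAt (fun z : Z => E t z.1) ((DE t z.1).comp (ContinuousLinearMap.fst ℝ E2 E3)) z :=
      (hd t z.1).comp z hasFDerivAt_fst
    have f2 : HasFDerivAt (fun z : Z => B t z.1) ((DB t z.1).comp (ContinuousLinearMap.fst ℝ E2 E3)) z :=
      (hB.hd t z.1).comp z hasFDerivAt_fst
    have f3 : HasFDerivAt (fun z : Z => cut N z.2) ((fderiv ℝ (cut N) z.2).comp (ContinuousLinearMap.snd ℝ E2 E3)) z :=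
      (((cut_contDiff N).differentiable one_ne_zero z.2).hasFDerivAt).comp z hasFDerivAt_snd
    have f4 := ContinuousLinearMap.hasFDerivAt_of_bilinear crossL f3 f2
    have f5 : HasFDerivAt (fun z : Z => piL z.2) (piL.comp (ContinuousLinearMap.snd ℝ E2 E3)) z :=
      piL.hasFDerivAt.comp z hasFDerivAt_snd
    have f6 := f5.prodMk (((ioL.hasFDerivAt.comp z f1).add f4).const_smul σ)
    refine f6.congr_fderiv ?_
    ext <;> simp [DVF]
  · unfold DVF
    have h1 : Continuous fun q : ℝ × Z => DE q.1 q.2.1 := hdc.comp (f := fun q : ℝ × Z => (q.1, q.2.1)) (by fun_prop)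
    have h2 : Continuous fun q : ℝ × Z => DB q.1 q.2.1 := hB.hdc.comp (f := fun q : ℝ × Z => (q.1, q.2.1)) (by fun_prop)
    have h2' : Continuous fun q : ℝ × Z => B q.1 q.2.1 := hB.cont.comp (f := fun q : ℝ × Z => (q.1, q.2.1)) (by fun_prop)
    have h3 : Continuous fun q : ℝ × Z => crossL (cut N q.2.2) :=
      crossL.continuous.comp ((cut_contDiff N).continuous.comp (by fun_prop))
    have h3' : Continuous fun q : ℝ × Z => fderiv ℝ (cut N : E3 → E3) q.2.2 :=
      ((cut_contDiff N).continuous_fderiv one_ne_zero).comp (by fun_prop)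
    have h4 : Continuous fun q : ℝ × Z => crossL.flip (B q.1 q.2.1) := crossL.flip.continuous.comp h2'
    have h5 := (continuous_const (y := ioL)).clm_comp (h1.clm_comp (continuous_const (y := ContinuousLinearMap.fst ℝ E2 E3)))
    have h6 := h3.clm_comp (h2.clm_comp (continuous_const (y := ContinuousLinearMap.fst ℝ E2 E3)))
    have h7 := h4.clm_comp (h3'.clm_comp (continuous_const (y := ContinuousLinearMap.snd ℝ E2 E3)))
    have h8 := ((h5.add (h6.add h7)).const_smul σ)
    exact (LinearIsometryEquiv.continuous (ContinuousLinearMap.prodₗᵢ ℝ)).comp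
      ((continuous_const (y := piL.comp (ContinuousLinearMap.snd ℝ E2 E3))).prodMk h8)

lemma DVF_trace (DE : ℝ → E2 → E2 →L[ℝ] E2) (t : ℝ) (z : Z) :
    LinearMap.trace ℝ Z (DVF N B DB DE σ t z : Z →ₗ[ℝ] Z) = 0 := by
  set A22 : E3 →ₗ[ℝ] E3 := ((σ • (crossL.flip (B t z.1)).comp (fderiv ℝ (cut N) z.2) : E3 →L[ℝ] E3) : E3 →ₗ[ℝ] E3) with hA
  set A21 : E2 →ₗ[ℝ] E3 := ((σ • (ioL.comp (DE t z.1) + (crossL (cut N z.2)).comp (DB t z.1)) : E2 →L[ℝ] E3) : E2 →ₗ[ℝ] E3) with hA2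
  have e : (DVF N B DB DE σ t z : Z →ₗ[ℝ] Z) =
      (LinearMap.inl ℝ E2 E3) ∘ₗ ((piL : E3 →ₗ[ℝ] E2) ∘ₗ LinearMap.snd ℝ E2 E3) +
      (LinearMap.inr ℝ E2 E3) ∘ₗ (A21 ∘ₗ LinearMap.fst ℝ E2 E3) +
      (LinearMap.inr ℝ E2 E3) ∘ₗ (A22 ∘ₗ LinearMap.snd ℝ E2 E3) := by
    refine LinearMap.ext fun v => ?_
    refine Prod.ext ?_ ?_
    · simp [DVF]
    · simp only [DVF, hA, hA2]
      simp
      abel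
  rw [e, map_add, map_add, LinearMap.trace_comp_comm', LinearMap.trace_comp_comm' _ (LinearMap.inr ℝ E2 E3),
    LinearMap.trace_comp_comm' _ (LinearMap.inr ℝ E2 E3)]
  have z1 : ((piL : E3 →ₗ[ℝ] E2) ∘ₗ LinearMap.snd ℝ E2 E3) ∘ₗ LinearMap.inl ℝ E2 E3 = 0 := by
    refine LinearMap.ext fun v => ?_; simp
  have z2 : (A21 ∘ₗ LinearMap.fst ℝ E2 E3) ∘ₗ LinearMap.inr ℝ E2 E3 = 0 := by
    refine LinearMap.ext fun v => ?_; simp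
  have z3 : (A22 ∘ₗ LinearMap.snd ℝ E2 E3) ∘ₗ LinearMap.inr ℝ E2 E3 = A22 := by
    refine LinearMap.ext fun v => ?_; simp
  rw [z1, z2, z3, map_zero, map_zero, zero_add, zero_add, LinearMap.trace_eq_sum_inner _ (EuclideanSpace.basisFun (Fin 3) ℝ)]
  obtain ⟨a, b', h⟩ := cut_deriv N z.2
  have hv : ∀ w, A22 w = σ • cross (a • w + (b' * inner ℝ z.2 w) • z.2) (B t z.1) := by
    intro w
    rw [← h w]; rfl
  rw [Fin.sum_univ_three, hv, hv, hv]
  simp only [inn3, EuclideanSpace.basisFun_apply, PiLp.smul_apply, PiLp.add_apply, cross_0, cross_1, cross_2, smul_eq_mul]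
  simp
  ring

end VFs
end VP
end

section
set_option linter.all false
namespace VP
open Set Filter Topology

lemma gron {F : Type*} [NormedAddCommGroup F] [NormedSpace ℝ F] {u u' : ℝ → F} {a b Λ Θ : ℝ → ℝ} {T : ℝ} (hT : 0 ≤ T)
    (hu : ∀ t, HasDerivAt u (u' t) t) (hΛ : ∀ t, HasDerivAt Λ (a t) t) (hΘ : ∀ t, HasDerivAt Θ (b t) t)
    (h0 : ∀ t ∈ Icc 0 T, 0 ≤ Λ t ∧ 0 ≤ b t) (hΛ0 : Λ 0 = 0) (hΘ0 : Θ 0 = 0)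
    (h : ∀ t ∈ Icc 0 T, ‖u' t‖ ≤ a t * ‖u t‖ + b t) : ‖u T‖ ≤ exp (Λ T) * (‖u 0‖ + Θ T) := by
  have key : ∀ δ > 0, ‖u T‖ ≤ exp (Λ T) * (‖u 0‖ + δ * (1 + T) + Θ T) := by
    intro δ hδ
    refine image_norm_le_of_norm_deriv_right_lt_deriv_boundary (f := u) (f' := u') (a := 0) (b := T)
      (B := fun t => exp (Λ t) * (‖u 0‖ + δ * (1 + t) + Θ t))
      (B' := fun t => exp (Λ t) * a t * (‖u 0‖ + δ * (1 + t) + Θ t) + exp (Λ t) * (δ + b t))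
      (fun t _ => (hu t).continuousAt.continuousWithinAt) (fun t _ => (hu t).hasDerivWithinAt) ?_ ?_ ?_ ⟨hT, le_rfl⟩
    · simp [hΛ0, hΘ0]; linarith
    · intro t
      refine (hΛ t).exp.mul ?_
      have := (((hasDerivAt_id t).const_add 1).const_mul δ).const_add ‖u 0‖ |>.add (hΘ t)
      exact this.congr_deriv (by simp)
    · intro t ht he
      obtain ⟨l1, l2⟩ := h0 t ⟨ht.1, ht.2.le⟩
      have := h t ⟨ht.1, ht.2.le⟩
      rw [he] at this
      have e1 := Real.one_le_exp l1
      refine this.trans_lt ?_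
      nlinarith
  refine le_of_forall_pos_le_add fun η hη => ?_
  have hp := Real.exp_pos (Λ T)
  have := key (η / (exp (Λ T) * (1 + T))) (by positivity)
  have e : exp (Λ T) * (‖u 0‖ + η / (exp (Λ T) * (1 + T)) * (1 + T) + Θ T) = exp (Λ T) * (‖u 0‖ + Θ T) + η := by
    field_simp; ring
  rw [e] at this
  exact this

lemma growth {H : Type*} [NormedAddCommGroup H] [InnerProductSpace ℝ H] {u u' : ℝ → H} {c T : ℝ} (hT : 0 ≤ T) (hc : 0 ≤ c)
    (hu : ∀ t, HasDerivAt u (u' t) t) (h : ∀ t ∈ Icc 0 T, inner ℝ (u t) (u' t) ≤ c * ‖u t‖) :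
    ‖u T‖ ≤ ‖u 0‖ + c * T := by
  have key : ∀ δ > 0, ‖u T‖ ≤ ‖u 0‖ + δ + (c + δ) * T := by
    intro δ hδ
    have := image_le_of_deriv_right_lt_deriv_boundary (f := fun t => ‖u t‖ ^ 2) (f' := fun t => 2 * inner ℝ (u t) (u' t)) (a := 0) (b := T)
      (B := fun t => (‖u 0‖ + δ + (c + δ) * t) ^ 2) (B' := fun t => 2 * (‖u 0‖ + δ + (c + δ) * t) * (c + δ))
      (fun t _ => ((hu t).norm_sq).continuousAt.continuousWithinAt) (fun t _ => ((hu t).norm_sq).hasDerivWithinAt)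
      (by simp; gcongr; linarith) ?_ ?_ ⟨hT, le_rfl⟩
    · exact (pow_le_pow_iff_left₀ (norm_nonneg _) (by positivity) two_ne_zero).1 this
    · intro t
      have := ((((hasDerivAt_id t).const_mul (c + δ)).const_add (‖u 0‖ + δ)).pow 2)
      exact this.congr_deriv (by simp)
    · intro t ht he
      have ht0 := ht.1
      have hp : 0 < ‖u 0‖ + δ + (c + δ) * t := by positivity
      have e : ‖u t‖ = ‖u 0‖ + δ + (c + δ) * t :=
        (pow_left_inj₀ (norm_nonneg _) hp.le two_ne_zero).1 he
      have := h t ⟨ht.1, ht.2.le⟩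
      rw [e] at this
      nlinarith
  refine le_of_forall_pos_le_add fun η hη => ?_
  have := key (η / (1 + T)) (by positivity)
  have e : ‖u 0‖ + η / (1 + T) + (c + η / (1 + T)) * T = ‖u 0‖ + c * T + η := by
    field_simp; ring
  rw [e] at this
  exact this

lemma growth' {F : Type*} [NormedAddCommGroup F] [NormedSpace ℝ F] {u u' : ℝ → F} {c T : ℝ} (hT : 0 ≤ T) (hc : 0 ≤ c)
    (hu : ∀ t, HasDerivAt u (u' t) t) (h : ∀ t ∈ Icc 0 T, ‖u' t‖ ≤ c) :
    ‖u T‖ ≤ ‖u 0‖ + c * T := by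
  have := gron (a := fun _ => 0) (b := fun _ => c) (Λ := fun _ => 0) (Θ := fun t => c * t) hT hu
    (fun t => hasDerivAt_const _ _) (fun t => by simpa using (hasDerivAt_id t).const_mul c) (fun t _ => ⟨le_rfl, hc⟩) rfl (by simp)
    (fun t ht => by simpa using h t ht)
  simpa using this

def sg (s : Bool) : ℝ := if s then 1 else -1
lemma sg_abs (s : Bool) : |sg s| = 1 := by cases s <;> simp [sg]

section
variable {N : ℝ} {B : ℝ → E2 → E3} {DB : ℝ → E2 → E2 →L[ℝ] E3} {b σ : ℝ} {E : ℝ → E2 → E2} {L c : ℝ}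

lemma flow_p (hB : GoodB B DB b) (hE : GoodE E L c) (hσ : |σ| = 1) {c' t : ℝ} (ht : 0 ≤ t)
    (hc' : ∀ τ ∈ Icc 0 t, ∀ x, ‖E τ x‖ ≤ c') (z : Z) :
    ‖(flow (VF N B E σ) t 0 z).2‖ ≤ ‖z.2‖ + c' * t := by
  have hV := VF_Lip (N := N) hB hE hσ
  have hd : ∀ τ, HasDerivAt (fun τ => (flow (VF N B E σ) τ 0 z).2) (VF N B E σ τ (flow (VF N B E σ) τ 0 z)).2 τ :=
    fun τ => (flow_deriv hV 0 z τ).snd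
  have h0 : 0 ≤ c' := (norm_nonneg _).trans (hc' 0 ⟨le_rfl, ht⟩ 0)
  have := growth ht h0 hd ?_
  · simpa [flow_self hV] using this
  · intro τ hτ
    set w := flow (VF N B E σ) τ 0 z
    simp only [VF]
    rw [inner_smul_right, inner_add_right, crossL_apply, inner_ioL]
    have : inner ℝ w.2 (cross (cut N w.2) (B τ w.1)) = 0 := by
      have e : cut N w.2 = Real.smoothTransition (N ^ 2 + 1 - ‖w.2‖ ^ 2) • w.2 := rfl
      rw [e, ← crossL_apply, map_smul, ContinuousLinearMap.smul_apply, inner_smul_right, crossL_apply, inner_cross_self, mul_zero]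
    rw [this, add_zero]
    refine (le_abs_self _).trans ?_
    rw [abs_mul, hσ, one_mul]
    refine (abs_real_inner_le_norm _ _).trans ?_
    rw [mul_comm]
    exact mul_le_mul (hc' τ hτ _) (piL_le _) (norm_nonneg _) h0

lemma flow_x (hB : GoodB B DB b) (hE : GoodE E L c) (hσ : |σ| = 1) {c' t : ℝ} (ht : 0 ≤ t)
    (hc' : ∀ τ ∈ Icc 0 t, ∀ x, ‖E τ x‖ ≤ c') (z : Z) :
    ‖(flow (VF N B E σ) t 0 z).1‖ ≤ ‖z.1‖ + (‖z.2‖ + c' * t) * t := by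
  have hV := VF_Lip (N := N) hB hE hσ
  have hd : ∀ τ, HasDerivAt (fun τ => (flow (VF N B E σ) τ 0 z).1) (VF N B E σ τ (flow (VF N B E σ) τ 0 z)).1 τ :=
    fun τ => (flow_deriv hV 0 z τ).fst
  have h0 : 0 ≤ c' := (norm_nonneg _).trans (hc' 0 ⟨le_rfl, ht⟩ 0)
  have := growth' (c := ‖z.2‖ + c' * t) ht (by positivity) hd ?_
  · simpa [flow_self hV] using this
  · intro τ hτ
    simp only [VF]
    refine (piL_le _).trans ((flow_p hB hE hσ hτ.1 (fun r hr => hc' r ⟨hr.1, hr.2.trans hτ.2⟩) z).trans ?_)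
    have := hτ.2
    gcongr

/-- reversed flow derivative -/
lemma flow_rev (hB : GoodB B DB b) (hE : GoodE E L c) (hσ : |σ| = 1) (t : ℝ) (z : Z) (τ : ℝ) :
    HasDerivAt (fun τ => flow (VF N B E σ) (t - τ) t z) (- VF N B E σ (t - τ) (flow (VF N B E σ) (t - τ) t z)) τ := by
  have := (flow_deriv (VF_Lip (N := N) hB hE hσ) t z (t - τ)).scomp τ ((hasDerivAt_id τ).const_sub t)
  exact this.congr_deriv (by simp)

lemma flow_lipw (hB : GoodB B DB b) (hE : GoodE E L c) (hσ : |σ| = 1) {k lam t : ℝ} (ht : 0 ≤ t) (hk : 0 ≤ k) (hl : 0 < lam)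
    (hw : ∀ τ ∈ Icc 0 t, ∀ x y, ‖E τ x - E τ y‖ ≤ k * exp (lam * τ) * ‖x - y‖) (z z' : Z) :
    ‖flow (VF N B E σ) 0 t z - flow (VF N B E σ) 0 t z'‖ ≤ exp (K0 N b * t + k * (exp (lam * t) - 1) / lam) * ‖z - z'‖ := by
  have hV := VF_Lip (N := N) hB hE hσ
  have hk0 := K0_nonneg N hB.nonneg
  have := gron (u := fun τ => flow (VF N B E σ) (t - τ) t z - flow (VF N B E σ) (t - τ) t z') (T := t)
    (a := fun τ => K0 N b + k * exp (lam * (t - τ))) (b := fun _ => 0)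
    (Λ := fun τ => K0 N b * τ + k * (exp (lam * t) - exp (lam * (t - τ))) / lam) (Θ := fun _ => 0) ht
    (fun τ => (flow_rev hB hE hσ t z τ).sub (flow_rev hB hE hσ t z' τ)) ?_ (fun τ => hasDerivAt_const _ _) ?_ (by simp) rfl ?_
  · simpa [flow_self hV, mul_comm] using this
  · intro τ
    have h1 := (((((hasDerivAt_id τ).const_sub t).const_mul lam).exp.const_sub (exp (lam * t))).const_mul k).div_const lam
    have := ((hasDerivAt_id τ).const_mul (K0 N b)).add h1
    refine this.congr_deriv ?_
    simp; field_simp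
  · intro τ hτ
    have h1 : exp (lam * (t - τ)) ≤ exp (lam * t) := by gcongr; linarith [hτ.1]
    have h2 := hτ.1
    have h3 := sub_nonneg.2 h1
    exact ⟨by positivity, le_rfl⟩
  · intro τ hτ
    rw [add_zero, ← neg_sub_neg, neg_neg, neg_neg, norm_sub_rev]
    exact VF_lip hB hσ (hw (t - τ) ⟨by linarith [hτ.2], by linarith [hτ.1]⟩) (by positivity) _ _

lemma flow_stab (hB : GoodB B DB b) (hE : GoodE E L c) {E' : ℝ → E2 → E2} {c' : ℝ} (hE' : GoodE E' L c') (hσ : |σ| = 1)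
    {D μ t : ℝ} (ht : 0 ≤ t) (hD : 0 ≤ D) (hμ : 0 < μ)
    (hw : ∀ τ ∈ Icc 0 t, ∀ x, ‖E τ x - E' τ x‖ ≤ D * exp (μ * τ)) (z : Z) :
    ‖flow (VF N B E σ) 0 t z - flow (VF N B E' σ) 0 t z‖ ≤ exp ((K0 N b + L) * t) * (D * exp (μ * t) / μ) := by
  have hV := VF_Lip (N := N) hB hE hσ
  have hV' := VF_Lip (N := N) hB hE' hσ
  have hk0 := K0_nonneg N hB.nonneg
  have hL := hE.L_nonneg
  have := gron (u := fun τ => flow (VF N B E σ) (t - τ) t z - flow (VF N B E' σ) (t - τ) t z) (T := t)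
    (a := fun τ => K0 N b + L) (b := fun τ => D * exp (μ * (t - τ)))
    (Λ := fun τ => (K0 N b + L) * τ) (Θ := fun τ => D * (exp (μ * t) - exp (μ * (t - τ))) / μ) ht
    (fun τ => (flow_rev hB hE hσ t z τ).sub (flow_rev hB hE' hσ t z τ)) ?_ ?_ ?_ (by simp) (by simp) ?_
  · simp only [sub_zero, sub_self, flow_self hV, flow_self hV', norm_zero, zero_add] at this
    refine this.trans ?_
    gcongr
    simp [Real.exp_nonneg]
  · intro τ
    simpa using (hasDerivAt_id τ).const_mul (K0 N b + L)
  · intro τ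
    have h1 := (((((hasDerivAt_id τ).const_sub t).const_mul μ).exp.const_sub (exp (μ * t))).const_mul D).div_const μ
    refine h1.congr_deriv ?_
    simp; field_simp
  · intro τ hτ
    have h2 := hτ.1
    exact ⟨by positivity, by positivity⟩
  · intro τ hτ
    rw [← neg_sub_neg, neg_neg, neg_neg, norm_sub_rev]
    refine (norm_sub_le_norm_sub_add_norm_sub _ (VF N B E σ (t - τ) (flow (VF N B E' σ) (t - τ) t z)) _).trans ?_
    refine add_le_add (VF_lip hB hσ (hE.lip _) hL _ _) ((VF_diff hσ E' _ _).trans ?_)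
    exact hw _ ⟨by linarith [hτ.2], by linarith [hτ.1]⟩ _
end
end VP
end

section
set_option linter.all false
namespace VP
open Set Filter Topology

structure Data (f0 : Bool → Z → ℝ) (n M ℓ : ℝ) : Prop where
  c1 : ∀ s, ContDiff ℝ 1 (f0 s)
  nn : ∀ s z, 0 ≤ f0 s z
  bd : ∀ s z, f0 s z ≤ M
  sup : ∀ s z, n < ‖z‖ → f0 s z = 0
  lip : ∀ s z z', |f0 s z - f0 s z'| ≤ ℓ * ‖z - z'‖
  n0 : 0 ≤ n

lemma Data.M0 {f0 n M ℓ} (h : Data f0 n M ℓ) : 0 ≤ M := (h.nn true 0).trans (h.bd true 0)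
lemma Data.l0 {f0 n M ℓ} (h : Data f0 n M ℓ) : 0 ≤ ℓ := by
  have := (abs_nonneg _).trans (h.lip true (EuclideanSpace.single 0 1, 0) 0)
  simpa [Prod.norm_def] using this
lemma Data.cs {f0 n M ℓ} (h : Data f0 n M ℓ) (s : Bool) : HasCompactSupport (f0 s) :=
  HasCompactSupport.intro (isCompact_closedBall (0:Z) n) fun z hz => h.sup s z (by simpa using hz)

lemma Data.mk' {f0 : Bool → Z → ℝ} {n M : ℝ} (c1 : ∀ s, ContDiff ℝ 1 (f0 s)) (nn : ∀ s z, 0 ≤ f0 s z)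
    (bd : ∀ s z, f0 s z ≤ M) (sup : ∀ s z, n < ‖z‖ → f0 s z = 0) (n0 : 0 ≤ n) : ∃ ℓ, Data f0 n M ℓ := by
  have h : ∀ s, ∃ K, LipschitzWith K (f0 s) := fun s =>
    ContDiff.lipschitzWith_of_hasCompactSupport
      (HasCompactSupport.intro (isCompact_closedBall (0:Z) n) fun z hz => sup s z (by simpa using hz)) (c1 s) one_ne_zero
  choose K hK using h
  refine ⟨max (K true) (K false), c1, nn, bd, sup, fun s z z' => ?_, n0⟩
  have := (hK s).dist_le_mul z z'
  rw [Real.dist_eq, dist_eq_norm] at this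
  refine this.trans ?_
  gcongr
  cases s <;> simp

def v3 (R : ℝ) : ℝ := volume.real (Metric.closedBall (0:E3) R)
lemma v3_nonneg (R : ℝ) : 0 ≤ v3 R := measureReal_nonneg

def rho (f : Bool → Z → ℝ) (y : E2) : ℝ := ∫ p : E3, (f true (y, p) - f false (y, p))

section
variable {f g : Bool → Z → ℝ} {R δ : ℝ}

lemma rho_set (hs : ∀ s z, R < ‖z‖ → f s z = 0) (y : E2) :
    rho f y = ∫ p in Metric.closedBall (0:E3) R, (f true (y, p) - f false (y, p)) := by
  refine (setIntegral_eq_integral_of_forall_compl_eq_zero fun p hp => ?_).symm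
  have : R < ‖(y, p)‖ := lt_of_lt_of_le (by simpa using hp) (norm_snd_le (y, p))
  rw [hs _ _ this, hs _ _ this, sub_zero]

lemma rho_supp (hs : ∀ s z, R < ‖z‖ → f s z = 0) (y : E2) (hy : R < ‖y‖) : rho f y = 0 := by
  have : ∀ p s, f s (y, p) = 0 := fun p s => hs s _ (hy.trans_le (norm_fst_le (y, p)))
  simp [rho, this]

lemma rho_sub (hf : ∀ s, Continuous (f s)) (hg : ∀ s, Continuous (g s)) (hs : ∀ s z, R < ‖z‖ → f s z = 0)
    (hs' : ∀ s z, R < ‖z‖ → g s z = 0) {x y : E2} (h : ∀ s p, |f s (x, p) - g s (y, p)| ≤ δ) :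
    |rho f x - rho g y| ≤ 2 * δ * v3 R := by
  rw [rho_set hs, rho_set hs', ← integral_sub]
  · have := norm_setIntegral_le_of_norm_le_const (μ := volume) (s := Metric.closedBall (0:E3) R) (C := 2 * δ)
      (f := fun p => (f true (x, p) - f false (x, p)) - (g true (y, p) - g false (y, p))) measure_closedBall_lt_top ?_
    · exact this
    · intro p _
      have h1 := h true p
      have h2 := h false p
      rw [norm_eq_abs]
      rw [abs_le] at *
      constructor <;> linarith
  all_goals
    refine ContinuousOn.integrableOn_compact (isCompact_closedBall _ _) (Continuous.continuousOn ?_)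
  · exact ((hf true).comp (by fun_prop)).sub ((hf false).comp (by fun_prop))
  · exact ((hg true).comp (by fun_prop)).sub ((hg false).comp (by fun_prop))

lemma rho_cont {X : Type*} [TopologicalSpace X] [FirstCountableTopology X] [LocallyCompactSpace X] {f : X → Bool → Z → ℝ}
    (hf : ∀ s, Continuous fun q : X × Z => f q.1 s q.2) (hs : ∀ t s z, R < ‖z‖ → f t s z = 0) :
    Continuous fun q : X × E2 => rho (f q.1) q.2 := by
  simp only [fun q : X × E2 => rho_set (hs q.1) q.2]
  refine continuous_parametric_integral_of_continuous (f := fun (q : X × E2) (p : E3) => f q.1 true (q.2, p) - f q.1 false (q.2, p))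
    ?_ (isCompact_closedBall _ _)
  have : ∀ s, Continuous fun w : (X × E2) × E3 => f w.1.1 s (w.1.2, w.2) := fun s =>
    (hf s).comp (f := fun w : (X × E2) × E3 => (w.1.1, ((w.1.2, w.2) : Z))) (by fun_prop)
  exact (this true).sub (this false)
end

def cl (T t : ℝ) : ℝ := max 0 (min t T)
lemma cl_mem {T : ℝ} (hT : 0 ≤ T) (t : ℝ) : cl T t ∈ Icc 0 T := ⟨le_max_left _ _, max_le hT (min_le_right _ _)⟩
lemma cl_eq {T t : ℝ} (h : t ∈ Icc 0 T) : cl T t = t := by rw [cl, min_eq_left h.2, max_eq_right h.1]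
lemma cl_cont (T : ℝ) : Continuous (cl T) := by unfold cl; fun_prop

def RR (n c T : ℝ) : ℝ := n + (n + c * T) * (1 + T)
def ff (N : ℝ) (B : ℝ → E2 → E3) (f0 : Bool → Z → ℝ) (E : ℝ → E2 → E2) (t : ℝ) (s : Bool) (z : Z) : ℝ :=
  f0 s (flow (VF N B E (sg s)) 0 t z)
def rc (N : ℝ) (B : ℝ → E2 → E3) (f0 : Bool → Z → ℝ) (T : ℝ) (E : ℝ → E2 → E2) (t : ℝ) : E2 → ℝ :=
  rho (ff N B f0 E (cl T t))

section
variable {N : ℝ} {B : ℝ → E2 → E3} {DB : ℝ → E2 → E2 →L[ℝ] E3} {b : ℝ} {E E' : ℝ → E2 → E2} {L c c' T : ℝ}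
  {f0 : Bool → Z → ℝ} {n M ℓ : ℝ}

lemma ff_supp (hD : Data f0 n M ℓ) (hB : GoodB B DB b) (hE : GoodE E L c) {t : ℝ} (ht : 0 ≤ t)
    (hc' : ∀ τ ∈ Icc 0 t, ∀ x, ‖E τ x‖ ≤ c') {s : Bool} {z : Z} (hz : ff N B f0 E t s z ≠ 0) :
    ‖z.1‖ ≤ n + (n + c' * t) * t ∧ ‖z.2‖ ≤ n + c' * t := by
  have hV := VF_Lip (N := N) hB hE (sg_abs s)
  have h1 : ‖flow (VF N B E (sg s)) 0 t z‖ ≤ n := by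
    by_contra h
    exact hz (hD.sup s _ (not_le.1 h))
  have e : flow (VF N B E (sg s)) t 0 (flow (VF N B E (sg s)) 0 t z) = z := by rw [flow_comp hV, flow_self hV]
  have h2 := flow_x (N := N) hB hE (sg_abs s) ht hc' (flow (VF N B E (sg s)) 0 t z)
  have h3 := flow_p (N := N) hB hE (sg_abs s) ht hc' (flow (VF N B E (sg s)) 0 t z)
  rw [e] at h2 h3
  have i1 := (norm_fst_le _).trans h1
  have i2 := (norm_snd_le _).trans h1
  exact ⟨h2.trans (by gcongr), h3.trans (by gcongr)⟩

lemma ff_supp' (hD : Data f0 n M ℓ) (hB : GoodB B DB b) (hE : GoodE E L c) (hT : 0 ≤ T)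
    (hc' : ∀ τ ∈ Icc 0 T, ∀ x, ‖E τ x‖ ≤ c') (t : ℝ) (s : Bool) (z : Z) (hz : RR n c' T < ‖z‖) : ff N B f0 E (cl T t) s z = 0 := by
  by_contra h
  obtain ⟨h0, h1⟩ := cl_mem hT t
  have hc0 : 0 ≤ c' := (norm_nonneg _).trans (hc' 0 ⟨le_rfl, hT⟩ 0)
  have hn := hD.n0
  obtain ⟨h2, h3⟩ := ff_supp hD hB hE h0 (fun τ hτ => hc' τ ⟨hτ.1, hτ.2.trans h1⟩) h
  have i1 : n + (n + c' * cl T t) * cl T t ≤ n + (n + c' * T) * T := by gcongr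
  have i2 : n + c' * cl T t ≤ n + c' * T := by gcongr
  refine not_le.2 hz (norm_prod_le_iff.2 ⟨h2.trans (i1.trans ?_), h3.trans (i2.trans ?_)⟩) <;> unfold RR
  · gcongr; linarith
  · nlinarith [mul_nonneg (add_nonneg hn (mul_nonneg hc0 hT)) hT]

lemma ff_cont (hD : Data f0 n M ℓ) (hB : GoodB B DB b) (hE : GoodE E L c) (s : Bool) :
    Continuous fun q : ℝ × Z => ff N B f0 E q.1 s q.2 :=
  (hD.c1 s).continuous.comp (iflow_cont (VF_Lip hB hE (sg_abs s)) 0)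

lemma ff_cont' (hD : Data f0 n M ℓ) (hB : GoodB B DB b) (hE : GoodE E L c) (t : ℝ) (s : Bool) :
    Continuous (ff N B f0 E t s) := (ff_cont hD hB hE s).comp (f := fun z : Z => (t, z)) (by fun_prop)

lemma rc_cont (hD : Data f0 n M ℓ) (hB : GoodB B DB b) (hE : GoodE E L c) (hT : 0 ≤ T) :
    Continuous fun q : ℝ × E2 => rc N B f0 T E q.1 q.2 :=
  rho_cont (f := fun t => ff N B f0 E (cl T t)) (fun s => (ff_cont hD hB hE s).comp
    (f := fun q : ℝ × Z => (cl T q.1, q.2)) (((cl_cont T).comp continuous_fst).prodMk continuous_snd))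
    (ff_supp' hD hB hE hT (fun τ _ => hE.bd τ))

lemma rc_cont' (hD : Data f0 n M ℓ) (hB : GoodB B DB b) (hE : GoodE E L c) (hT : 0 ≤ T) (t : ℝ) :
    Continuous (rc N B f0 T E t) := (rc_cont hD hB hE hT).comp (f := fun z : E2 => (t, z)) (by fun_prop)

def mm (M R : ℝ) : ℝ := 2 * M * v3 R
lemma Data.m0 (hD : Data f0 n M ℓ) (R : ℝ) : 0 ≤ mm M R := by
  have := hD.M0; have := v3_nonneg R; unfold mm; positivity

lemma rc_bd (hD : Data f0 n M ℓ) (hB : GoodB B DB b) (hE : GoodE E L c) (hT : 0 ≤ T)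
    (hc' : ∀ τ ∈ Icc 0 T, ∀ x, ‖E τ x‖ ≤ c') (t : ℝ) (x : E2) : |rc N B f0 T E t x| ≤ mm M (RR n c' T) := by
  have := rho_sub (f := ff N B f0 E (cl T t)) (g := fun _ _ => 0) (R := RR n c' T) (δ := M) (x := x) (y := x)
    (ff_cont' hD hB hE _) (fun s => continuous_const)
    (ff_supp' hD hB hE hT hc' t) (fun _ _ _ => rfl) (fun s p => by
      rw [sub_zero, ff, abs_of_nonneg (hD.nn _ _)]; exact hD.bd _ _)
  simpa [rho, rc, mm] using this

lemma rc_supp (hD : Data f0 n M ℓ) (hB : GoodB B DB b) (hE : GoodE E L c) (hT : 0 ≤ T)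
    (hc' : ∀ τ ∈ Icc 0 T, ∀ x, ‖E τ x‖ ≤ c') (t : ℝ) (x : E2) (hx : RR n c' T < ‖x‖) : rc N B f0 T E t x = 0 :=
  rho_supp (ff_supp' hD hB hE hT hc' t) x hx

lemma rc_lip (hD : Data f0 n M ℓ) (hB : GoodB B DB b) (hE : GoodE E L c) (hT : 0 ≤ T) {k lam : ℝ} (hk : 0 ≤ k) (hl : 0 < lam)
    (hw : ∀ τ ∈ Icc 0 T, ∀ x y, ‖E τ x - E τ y‖ ≤ k * exp (lam * τ) * ‖x - y‖) (t : ℝ) (x y : E2) :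
    |rc N B f0 T E t x - rc N B f0 T E t y| ≤
      2 * v3 (RR n c T) * ℓ * exp (K0 N b * cl T t + k * (exp (lam * cl T t) - 1) / lam) * ‖x - y‖ := by
  obtain ⟨h0, h1⟩ := cl_mem hT t
  have := rho_sub (f := ff N B f0 E (cl T t)) (g := ff N B f0 E (cl T t)) (R := RR n c T)
    (δ := ℓ * (exp (K0 N b * cl T t + k * (exp (lam * cl T t) - 1) / lam) * ‖x - y‖)) (x := x) (y := y)
    (ff_cont' hD hB hE _) (ff_cont' hD hB hE _)
    (ff_supp' hD hB hE hT (fun τ _ => hE.bd τ) t) (ff_supp' hD hB hE hT (fun τ _ => hE.bd τ) t) (fun s p => by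
      refine (hD.lip _ _ _).trans ?_
      refine mul_le_mul_of_nonneg_left ?_ hD.l0
      have := flow_lipw (N := N) hB hE (sg_abs s) h0 hk hl (fun τ hτ => hw τ ⟨hτ.1, hτ.2.trans h1⟩) (x, p) (y, p)
      simpa [Prod.norm_def] using this)
  refine this.trans (le_of_eq ?_)
  ring

lemma field_stab (hD : Data f0 n M ℓ) (hB : GoodB B DB b) (hE : GoodE E L c) (hE' : GoodE E' L c) (hT : 0 ≤ T)
    {D μ : ℝ} (hD0 : 0 ≤ D) (hμ : 0 < μ) (hw : ∀ τ ∈ Icc 0 T, ∀ x, ‖E τ x - E' τ x‖ ≤ D * exp (μ * τ)) (t : ℝ) (x : E2) :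
    ‖EE 0 (rc N B f0 T E t) x - EE 0 (rc N B f0 T E' t) x‖ ≤
      4 * v3 (RR n c T) * ℓ * exp ((K0 N b + L) * T) * (JJ 1 + vR (RR n c T)) / μ * (D * exp (μ * cl T t)) := by
  obtain ⟨h0, h1⟩ := cl_mem hT t
  have hk0 := K0_nonneg N hB.nonneg
  have hL := hE.L_nonneg
  have hl0 := hD.l0
  have b1 := rc_bd (N := N) hD hB hE hT (fun τ _ => hE.bd τ) t
  have b2 := rc_bd (N := N) hD hB hE' hT (fun τ _ => hE'.bd τ) t
  have s1 := rc_supp (N := N) hD hB hE hT (fun τ _ => hE.bd τ) t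
  have s2 := rc_supp (N := N) hD hB hE' hT (fun τ _ => hE'.bd τ) t
  have c1 := rc_cont' (N := N) hD hB hE hT t
  have c2 := rc_cont' (N := N) hD hB hE' hT t
  rw [EE_sub c1 b1 s1 c2 b2 s2]
  have hd : ∀ y, |rc N B f0 T E t y - rc N B f0 T E' t y| ≤
      2 * (ℓ * (exp ((K0 N b + L) * T) * (D * exp (μ * cl T t) / μ))) * v3 (RR n c T) := by
    intro y
    refine rho_sub (ff_cont' hD hB hE _) (ff_cont' hD hB hE' _)
      (ff_supp' hD hB hE hT (fun τ _ => hE.bd τ) t) (ff_supp' hD hB hE' hT (fun τ _ => hE'.bd τ) t) (fun s p => ?_)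
    refine (hD.lip _ _ _).trans ?_
    refine mul_le_mul_of_nonneg_left ?_ hD.l0
    refine (flow_stab (N := N) hB hE hE' (sg_abs s) h0 hD0 hμ (fun τ hτ => hw τ ⟨hτ.1, hτ.2.trans h1⟩) (y, p)).trans ?_
    gcongr
  refine (EE_bound (c1.sub c2) hd (fun y hy => by rw [Pi.sub_apply, s1 y hy, s2 y hy, sub_zero]) 0 x).trans (le_of_eq ?_)
  field_simp; ring
end
end VP
end

section
set_option linter.all false
namespace VP
open Set Filter Topology

structure StF (F : Z → ℝ) (m P R : ℝ) : Prop where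
  cont : Continuous F
  nn : ∀ z, 0 ≤ F z
  bd : ∀ z, F z ≤ m
  sx : ∀ z, R < ‖z.1‖ → F z = 0
  sp : ∀ z, P ≤ ‖z.2‖ → F z = 0
  P0 : 0 ≤ P
  R0 : 0 ≤ R

def ra (F : Z → ℝ) (y : E2) : ℝ := ∫ p, F (y, p)

section
variable {F : Z → ℝ} {m P R : ℝ}

lemma StF.cs (h : StF F m P R) : HasCompactSupport F := by
  refine HasCompactSupport.intro ((isCompact_closedBall (0:E2) R).prod (isCompact_closedBall (0:E3) P)) fun z hz => ?_
  by_contra hne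
  apply hz
  constructor
  · simp; by_contra hh; exact hne (h.sx z (not_le.1 hh))
  · simp; by_contra hh; exact hne (h.sp z (not_le.1 hh).le)

lemma StF.m0 (h : StF F m P R) : 0 ≤ m := (h.nn 0).trans (h.bd 0)
lemma StF.int (h : StF F m P R) : Integrable F := h.cont.integrable_of_hasCompactSupport h.cs
lemma StF.kint (h : StF F m P R) : Integrable fun z : Z => ‖z.2‖ ^ 2 * F z :=
  (by have := h.cont; fun_prop : Continuous fun z : Z => ‖z.2‖ ^ 2 * F z).integrable_of_hasCompactSupport h.cs.mul_left

lemma StF.pint (h : StF F m P R) (y : E2) (g : E3 → ℝ) (hg : Continuous g) : Integrable fun p => g p * F (y, p) := by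
  refine (by have := h.cont; fun_prop : Continuous fun p => g p * F (y, p)).integrable_of_hasCompactSupport ?_
  refine HasCompactSupport.intro (isCompact_closedBall (0:E3) P) fun p hp => ?_
  rw [h.sp (y, p) (by simp at hp; exact hp.le), mul_zero]

lemma StF.pint1 (h : StF F m P R) (y : E2) : Integrable fun p => F (y, p) := by
  simpa using h.pint y (fun _ => 1) continuous_const

def C3 : ℝ := 2 * volume.real (Metric.ball (0:E3) 1)
lemma C3_nonneg : 0 ≤ C3 := by unfold C3; positivity

lemma p_int : ∀ {P : ℝ}, 0 ≤ P → ∫ p in Metric.ball (0:E3) P, ‖p‖ ^ (-(3/2:ℝ)) = C3 * P ^ (3/2:ℝ) := by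
  intro P hP
  rw [radial_integral volume (by simp) hP]
  simp [C3]; norm_num; ring

lemma key_pt {r a q : ℝ} (hr : 0 < r) (ha : 0 < a) (hq : 0 < q) :
    r⁻¹ ≤ a * q ^ 2 + r ^ (-(7/4:ℝ)) * a ^ (-(3/4:ℝ)) * q ^ (-(3/2:ℝ)) := by
  by_cases h : r⁻¹ ≤ a * q ^ 2
  · exact h.trans (le_add_of_nonneg_right (by positivity))
  · rw [not_le] at h
    have h1 : a * q ^ 2 * r < 1 := by
      rw [lt_inv_comm₀ (by positivity) hr] at h
      rwa [← one_div, lt_div_iff₀ (by positivity), mul_comm] at h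
    have h2 : 1 ≤ (a * q ^ 2 * r) ^ (-(3/4:ℝ)) := Real.one_le_rpow_of_pos_of_le_one_of_nonpos (by positivity) h1.le (by norm_num)
    have h3 : r ^ (-(7/4:ℝ)) * a ^ (-(3/4:ℝ)) * q ^ (-(3/2:ℝ)) = r⁻¹ * (a * q ^ 2 * r) ^ (-(3/4:ℝ)) := by
      rw [Real.mul_rpow (by positivity) hr.le, Real.mul_rpow ha.le (by positivity), ← Real.rpow_natCast q 2, ← Real.rpow_mul hq.le,
        ← Real.rpow_neg_one r, show (-(7/4):ℝ) = -1 + -(3/4) by norm_num, Real.rpow_add hr]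
      norm_num; ring
    rw [h3]
    have : 0 < r⁻¹ := by positivity
    nlinarith [mul_nonneg ha.le (sq_nonneg q)]

lemma field_pt (h : StF F m P R) {a : ℝ} (ha : 0 < a) (x y : E2) :
    ‖x - y‖ ^ (-(1:ℝ)) * ra F y ≤ ra F y + a * (∫ p, ‖p‖ ^ 2 * F (y, p)) +
      m * a ^ (-(3/4:ℝ)) * (C3 * P ^ (3/2:ℝ)) * (Metric.ball (0:E2) 1).indicator (fun z => ‖z‖ ^ (-(7/4:ℝ))) (x - y) := by
  have hm := h.m0
  have hr0 : 0 ≤ ra F y := integral_nonneg fun p => h.nn _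
  have hk0 : 0 ≤ ∫ p, ‖p‖ ^ 2 * F (y, p) := integral_nonneg fun p => mul_nonneg (sq_nonneg _) (h.nn _)
  have hc := C3_nonneg
  have hP := h.P0
  have hi0 : 0 ≤ (Metric.ball (0:E2) 1).indicator (fun z => ‖z‖ ^ (-(7/4:ℝ))) (x - y) :=
    indicator_nonneg (fun z _ => by positivity) _
  set r := ‖x - y‖ with hr
  have hx0 : 0 ≤ m * a ^ (-(3/4:ℝ)) * (C3 * P ^ (3/2:ℝ)) * (Metric.ball (0:E2) 1).indicator (fun z => ‖z‖ ^ (-(7/4:ℝ))) (x - y) := by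
    positivity
  rw [Real.rpow_neg_one]
  by_cases h1 : r⁻¹ ≤ 1
  · nlinarith [mul_nonneg ha.le hk0]
  · rw [not_le] at h1
    have hrp : 0 < r := by
      rcases (norm_nonneg (x - y)).eq_or_lt with e | e
      · rw [← hr] at e; rw [← e] at h1; norm_num at h1
      · exact e
    have hr1 : r < 1 := by rwa [one_lt_inv₀ hrp] at h1
    rw [indicator_of_mem (by simpa using hr1), ← hr]
    have hri := radial_integrable (E := E3) volume (s := 3/2) (P := P) (by simp) hP
    have hri2 : IntegrableOn (fun p : E3 => (m * r ^ (-(7/4:ℝ)) * a ^ (-(3/4:ℝ))) * ‖p‖ ^ (-(3/2:ℝ))) (Metric.ball 0 P) volume := hri.const_mul _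
    have : r⁻¹ * ra F y ≤ a * (∫ p, ‖p‖ ^ 2 * F (y, p)) +
        (m * r ^ (-(7/4:ℝ)) * a ^ (-(3/4:ℝ))) * ∫ p in Metric.ball (0:E3) P, ‖p‖ ^ (-(3/2:ℝ)) := by
      rw [ra, ← integral_const_mul, ← integral_const_mul, ← integral_const_mul,
        ← integral_indicator Metric.isOpen_ball.measurableSet, ← integral_add]
      · refine integral_mono_ae ((h.pint1 y).const_mul _) ?_ ?_
        · exact ((h.pint y (fun p => ‖p‖ ^ 2) (by fun_prop)).const_mul a).add
            (hri2.integrable_indicator Metric.isOpen_ball.measurableSet)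
        · filter_upwards [compl_mem_ae_iff.2 (measure_singleton (0:E3))] with p hp
          have hp0 : 0 < ‖p‖ := norm_pos_iff.2 hp
          have hF := h.nn (y, p)
          by_cases hpP : ‖p‖ < P
          · rw [indicator_of_mem (by simpa using hpP)]
            have k := key_pt hrp ha hp0
            have k1 := mul_le_mul_of_nonneg_right k hF
            have k2 : r ^ (-(7/4:ℝ)) * a ^ (-(3/4:ℝ)) * ‖p‖ ^ (-(3/2:ℝ)) * F (y, p) ≤ r ^ (-(7/4:ℝ)) * a ^ (-(3/4:ℝ)) * ‖p‖ ^ (-(3/2:ℝ)) * m :=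
              mul_le_mul_of_nonneg_left (h.bd _) (by positivity)
            nlinarith
          · have : F (y, p) = 0 := h.sp _ (not_lt.1 hpP)
            rw [this, indicator_of_notMem (by simpa using hpP)]
            simp
      · exact (h.pint y (fun p => ‖p‖ ^ 2) (by fun_prop)).const_mul a
      · exact hri2.integrable_indicator Metric.isOpen_ball.measurableSet
    rw [p_int hP] at this
    nlinarith

lemma field_A (h : StF F m P R) {a : ℝ} (ha : 0 < a) {u : E2 → ℝ} (hu : ∀ y, |u y| ≤ ra F y) (x : E2) :
    ‖EE 0 u x‖ ≤ 2 * ((∫ z, F z) + a * (∫ z : Z, ‖z.2‖ ^ 2 * F z) + m * a ^ (-(3/4:ℝ)) * (C3 * P ^ (3/2:ℝ)) * JJ (7/4)) := by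
  have i1 : Integrable (ra F) := by
    have := h.int; rw [Measure.volume_eq_prod] at this; exact this.integral_prod_left
  have i2 : Integrable (fun y => ∫ p, ‖p‖ ^ 2 * F (y, p)) := by
    have := h.kint; rw [Measure.volume_eq_prod] at this; exact this.integral_prod_left
  have i3 : Integrable (fun y => (Metric.ball (0:E2) 1).indicator (fun z => ‖z‖ ^ (-(7/4:ℝ))) (x - y)) :=
    ((JJ_int (α := 7/4) (by norm_num)).integrable_indicator Metric.isOpen_ball.measurableSet).comp_sub_left x
  have e1 : ∫ z, F z = ∫ y, ra F y := by
    have := h.int; rw [Measure.volume_eq_prod] at this ⊢; exact integral_prod _ this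
  have e2 : ∫ z : Z, ‖z.2‖ ^ 2 * F z = ∫ y, ∫ p, ‖p‖ ^ 2 * F (y, p) := by
    have := h.kint; rw [Measure.volume_eq_prod] at this ⊢; exact integral_prod _ this
  have e3 : ∫ y, (Metric.ball (0:E2) 1).indicator (fun z => ‖z‖ ^ (-(7/4:ℝ))) (x - y) = JJ (7/4) := by
    rw [integral_sub_left_eq_self (μ := volume) ((Metric.ball (0:E2) 1).indicator (fun z => ‖z‖ ^ (-(7/4:ℝ)))) x,
      integral_indicator Metric.isOpen_ball.measurableSet, JJ_val (by norm_num)]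
  have i4 : Integrable (fun y => ra F y + a * ∫ p, ‖p‖ ^ 2 * F (y, p)) := i1.add (i2.const_mul a)
  rw [e1, e2, ← e3, ← integral_const_mul, ← integral_const_mul, ← integral_add i1 (i2.const_mul a),
    ← integral_add i4 (i3.const_mul _), ← integral_const_mul]
  refine norm_integral_le_of_norm_le (((i4.add (i3.const_mul _))).const_mul 2) (Eventually.of_forall fun y => ?_)
  have := field_pt h ha x y
  have hr0 : 0 ≤ ra F y := integral_nonneg fun p => h.nn _
  rw [norm_smul, norm_eq_abs]
  refine (mul_le_mul (hu y) (kk_bound 0 (x - y)) (norm_nonneg _) hr0).trans ?_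
  nlinarith

lemma LL_bd {ε δ R : ℝ} (hε : 0 < ε) (hε1 : ε ≤ 1) (hδ : 0 < δ) (hδ1 : δ ≤ 1) {z : E2} (hz : ‖z‖ ≤ 2 * R) :
    |LL ε z| ≤ Real.log (2 + 4 * R ^ 2) - 2 * Real.log δ + 2 * (Metric.ball (0:E2) δ).indicator (fun z => ‖z‖ ^ (-(1:ℝ))) z
      ∨ z = 0 := by
  by_cases hz0 : z = 0
  · exact Or.inr hz0
  left
  have hr : 0 < ‖z‖ := norm_pos_iff.2 hz0
  have hld : Real.log δ ≤ 0 := Real.log_nonpos hδ.le hδ1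
  have hl2 : 0 ≤ Real.log (2 + 4 * R ^ 2) := Real.log_nonneg (by nlinarith [sq_nonneg R])
  have hi : 0 ≤ (Metric.ball (0:E2) δ).indicator (fun z => ‖z‖ ^ (-(1:ℝ))) z := indicator_nonneg (fun z _ => by positivity) _
  rw [abs_le]
  constructor
  · have h1 : 2 * Real.log ‖z‖ ≤ LL ε z := by
      rw [LL, show 2 * Real.log ‖z‖ = Real.log (‖z‖ ^ 2) by rw [Real.log_pow]; norm_num]
      exact Real.log_le_log (by positivity) (by nlinarith)
    by_cases hd : ‖z‖ < δ
    · rw [indicator_of_mem (by simpa using hd), Real.rpow_neg_one]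
      have := Real.one_sub_inv_le_log_of_pos hr
      linarith
    · have : Real.log δ ≤ Real.log ‖z‖ := Real.log_le_log hδ (not_lt.1 hd)
      linarith
  · have : LL ε z ≤ Real.log (2 + 4 * R ^ 2) := Real.log_le_log (by positivity) (by nlinarith [norm_nonneg z])
    linarith

lemma ra_bd (h : StF F m P R) (y : E2) : ra F y ≤ m * v3 P := by
  have e : ra F y = ∫ p in Metric.closedBall (0:E3) P, F (y, p) :=
    (setIntegral_eq_integral_of_forall_compl_eq_zero fun p hp => h.sp _ (by simp at hp; exact hp.le)).symm
  have := norm_setIntegral_le_of_norm_le_const (μ := volume) (s := Metric.closedBall (0:E3) P) (C := m)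
      (f := fun p => F (y, p)) measure_closedBall_lt_top (fun p _ => by rw [norm_eq_abs, abs_of_nonneg (h.nn _)]; exact h.bd _)
  rw [e]; exact (le_abs_self _).trans this

lemma ra_supp (h : StF F m P R) (y : E2) (hy : R < ‖y‖) : ra F y = 0 := by
  have : ∀ p, F (y, p) = 0 := fun p => h.sx _ hy
  simp [ra, this]

lemma pot_B (h : StF F m P R) {ε δ : ℝ} (hε : 0 < ε) (hε1 : ε ≤ 1) (hδ : 0 < δ) (hδ1 : δ ≤ 1) {u : E2 → ℝ}
    (hu : ∀ y, |u y| ≤ ra F y) {x : E2} (hx : ‖x‖ ≤ R) :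
    |∫ y, u y * LL ε (x - y)| ≤ (Real.log (2 + 4 * R ^ 2) - 2 * Real.log δ) * (∫ z, F z) + m * v3 P * (4 * vb2 * δ) := by
  have i1 : Integrable (ra F) := by
    have := h.int; rw [Measure.volume_eq_prod] at this; exact this.integral_prod_left
  have e1 : ∫ z, F z = ∫ y, ra F y := by
    have := h.int; rw [Measure.volume_eq_prod] at this ⊢; exact integral_prod _ this
  have hri := radial_integrable (E := E2) volume (s := 1) (P := δ) (by simp) hδ.le
  have i3 : Integrable (fun y => (Metric.ball (0:E2) δ).indicator (fun z => ‖z‖ ^ (-(1:ℝ))) (x - y)) :=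
    (hri.integrable_indicator Metric.isOpen_ball.measurableSet).comp_sub_left x
  have e3 : ∫ y, (Metric.ball (0:E2) δ).indicator (fun z => ‖z‖ ^ (-(1:ℝ))) (x - y) = 2 * vb2 * δ := by
    rw [integral_sub_left_eq_self (μ := volume) ((Metric.ball (0:E2) δ).indicator (fun z => ‖z‖ ^ (-(1:ℝ)))) x,
      integral_indicator Metric.isOpen_ball.measurableSet, radial_integral volume (by simp) hδ.le]
    simp [vb2]; norm_num
  have e4 : m * v3 P * (4 * vb2 * δ) = m * v3 P * 2 * (2 * vb2 * δ) := by ring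
  rw [e4, e1, ← e3, ← integral_const_mul, ← integral_const_mul, ← integral_add (i1.const_mul _) (i3.const_mul _), ← norm_eq_abs]
  refine norm_integral_le_of_norm_le ((i1.const_mul _).add (i3.const_mul _)) ?_
  filter_upwards [compl_mem_ae_iff.2 (measure_singleton (x:E2))] with y hy
  have hr0 : 0 ≤ ra F y := integral_nonneg fun p => h.nn _
  have hi : 0 ≤ (Metric.ball (0:E2) δ).indicator (fun z => ‖z‖ ^ (-(1:ℝ))) (x - y) := indicator_nonneg (fun z _ => by positivity) _
  have hmv : 0 ≤ m * v3 P := mul_nonneg h.m0 (v3_nonneg P)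
  rw [norm_mul, norm_eq_abs, norm_eq_abs]
  by_cases hyR : R < ‖y‖
  · have h0 := ra_supp h y hyR
    have : |u y| = 0 := le_antisymm ((hu y).trans h0.le) (abs_nonneg _)
    rw [this, h0]; simp only [zero_mul, mul_zero, zero_add]; positivity
  · rw [not_lt] at hyR
    have hz : ‖x - y‖ ≤ 2 * R := (norm_sub_le _ _).trans (by linarith)
    rcases LL_bd hε hε1 hδ hδ1 hz with hh | hh
    · refine (mul_le_mul (hu y) hh (abs_nonneg _) hr0).trans ?_
      have := mul_le_mul_of_nonneg_right (ra_bd h y) hi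
      nlinarith
    · exact absurd (sub_eq_zero.1 hh).symm hy
end
end VP
end

section
set_option linter.all false
namespace VP
open Set Filter Topology

section
variable {Y : Type*} [TopologicalSpace Y] [MeasurableSpace Y] [OpensMeasurableSpace Y] [T2Space Y] [SecondCountableTopology Y]
  {ν : Measure Y} [IsFiniteMeasureOnCompacts ν] [SFinite ν]

lemma kk_neg (ε : ℝ) (x : E2) : kk ε (-x) = - kk ε x := by simp [kk]

lemma energy_abs {X : ℝ → Y → E2} {P Q : ℝ → Y → E3} {G : ℝ → Y → ℝ} {a h : Y → ℝ} {ε : ℝ} (hε : 0 < ε)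
    (cX : Continuous fun q : ℝ × Y => X q.1 q.2) (cP : Continuous fun q : ℝ × Y => P q.1 q.2)
    (cQ : Continuous fun q : ℝ × Y => Q q.1 q.2)
    (dX : ∀ t w, HasDerivAt (fun t => X t w) (piL (P t w)) t) (dP : ∀ t w, HasDerivAt (fun t => P t w) (Q t w) t)
    (ca : Continuous a) (ch : Continuous h) (sa : HasCompactSupport a) (sh : HasCompactSupport h)
    (hG : ∀ t w, a w * inner ℝ (P t w) (Q t w) = h w * G t w) (cG : Continuous fun q : ℝ × Y => G q.1 q.2) (t : ℝ) :
    HasDerivAt (fun t => (∫ w, a w * ‖P t w‖ ^ 2 ∂ν) - ∫ w, h w * (∫ w', h w' * LL ε (X t w - X t w') ∂ν) ∂ν)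
      (2 * ∫ w, h w * (G t w - inner ℝ (piL (P t w)) (∫ w', h w' • kk ε (X t w - X t w') ∂ν)) ∂ν) t := by
  have k1 := hasDerivAt_integral_cpt (μ := ν) (g := fun t w => a w * ‖P t w‖ ^ 2) (g' := fun t w => 2 * (h w * G t w))
    (fun t w => (((dP t w).norm_sq).const_mul (a w)).congr_deriv (by rw [← hG]; ring))
    (by fun_prop) (by fun_prop) (fun T => ⟨tsupport a, sa, fun t _ z hz => by simp [image_eq_zero_of_notMem_tsupport hz]⟩) t
  have hkc := kk_cont hε
  have hLc := LL_cont hε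
  have cX1 : Continuous fun q : ℝ × Y × Y => X q.1 q.2.1 := cX.comp (f := fun q : ℝ × Y × Y => (q.1, q.2.1)) (by fun_prop)
  have cX2 : Continuous fun q : ℝ × Y × Y => X q.1 q.2.2 := cX.comp (f := fun q : ℝ × Y × Y => (q.1, q.2.2)) (by fun_prop)
  have cP1 : Continuous fun q : ℝ × Y × Y => P q.1 q.2.1 := cP.comp (f := fun q : ℝ × Y × Y => (q.1, q.2.1)) (by fun_prop)
  have cP2 : Continuous fun q : ℝ × Y × Y => P q.1 q.2.2 := cP.comp (f := fun q : ℝ × Y × Y => (q.1, q.2.2)) (by fun_prop)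
  have k2 := hasDerivAt_integral_cpt (X := Y × Y) (μ := ν.prod ν) (g := fun t w => h w.1 * h w.2 * LL ε (X t w.1 - X t w.2))
    (g' := fun t w => h w.1 * h w.2 * inner ℝ (kk ε (X t w.1 - X t w.2)) (piL (P t w.1) - piL (P t w.2)))
    (fun t w => ((((LL_deriv hε _).comp_hasDerivAt t ((dX t w.1).sub (dX t w.2)))).const_mul (h w.1 * h w.2)).congr_deriv (by
      simp))
    (by fun_prop) (by fun_prop) (fun T => ⟨_, sh.prod sh, fun t _ z hz => by
      have : h z.1 * h z.2 = 0 := by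
        by_contra hne
        exact hz ⟨subset_tsupport _ (left_ne_zero_of_mul hne), subset_tsupport _ (right_ne_zero_of_mul hne)⟩
      simp [this]⟩) t
  have scs : HasCompactSupport fun w : Y × Y => h w.1 * h w.2 := HasCompactSupport.intro (sh.prod sh) fun z hz => by
    by_contra hne
    exact hz ⟨subset_tsupport _ (left_ne_zero_of_mul hne), subset_tsupport _ (right_ne_zero_of_mul hne)⟩
  have ct : ∀ {g : Y × Y → ℝ}, Continuous g → Integrable (fun w => h w.1 * h w.2 * g w) (ν.prod ν) := fun hg =>
    (by fun_prop : Continuous _).integrable_of_hasCompactSupport scs.mul_right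
  have cXt : Continuous (X t) := cX.comp (f := fun w => (t, w)) (by fun_prop)
  have cPt : Continuous (P t) := cP.comp (f := fun w => (t, w)) (by fun_prop)
  have e1 : ∀ t, ∫ w, h w.1 * h w.2 * LL ε (X t w.1 - X t w.2) ∂(ν.prod ν) = ∫ w, h w * (∫ w', h w' * LL ε (X t w - X t w') ∂ν) ∂ν := by
    intro t
    have cXt : Continuous (X t) := cX.comp (f := fun w => (t, w)) (by fun_prop)
    rw [integral_prod _ (ct (by fun_prop))]
    simp only [mul_assoc, integral_const_mul]
  have e2 : ∫ w, h w.1 * h w.2 * inner ℝ (kk ε (X t w.1 - X t w.2)) (piL (P t w.1) - piL (P t w.2)) ∂(ν.prod ν) =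
      2 * ∫ w, h w * inner ℝ (piL (P t w)) (∫ w', h w' • kk ε (X t w - X t w') ∂ν) ∂ν := by
    have i1 : Integrable (fun w : Y × Y => h w.1 * h w.2 * inner ℝ (kk ε (X t w.1 - X t w.2)) (piL (P t w.1))) (ν.prod ν) := ct (by fun_prop)
    have s : ∫ w, h w.1 * h w.2 * inner ℝ (kk ε (X t w.1 - X t w.2)) (piL (P t w.2)) ∂(ν.prod ν) =
        - ∫ w, h w.1 * h w.2 * inner ℝ (kk ε (X t w.1 - X t w.2)) (piL (P t w.1)) ∂(ν.prod ν) := by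
      rw [← integral_prod_swap, ← integral_neg]
      refine integral_congr_ae (Eventually.of_forall fun w => ?_)
      simp only [Prod.fst_swap, Prod.snd_swap]
      rw [← neg_sub, kk_neg, inner_neg_left]; ring
    simp only [inner_sub_right, mul_sub]
    rw [integral_sub i1 (ct (by fun_prop)), s, sub_neg_eq_add, ← two_mul, integral_prod _ i1]
    congr 1
    refine integral_congr_ae (Eventually.of_forall fun w => ?_)
    simp only
    rw [← integral_inner]
    · rw [← integral_const_mul]
      refine integral_congr_ae (Eventually.of_forall fun w' => ?_)
      simp only [inner_smul_right, real_inner_comm]; ring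
    · exact (by fun_prop : Continuous fun w' => h w' • kk ε (X t w - X t w')).integrable_of_hasCompactSupport sh.smul_right
  simp only [e1] at k2
  have iG : Integrable (fun w => h w * G t w) ν := by
    have := k1.1.const_mul (1/2); refine this.congr (Eventually.of_forall fun w => ?_); simp
  refine (k1.2.sub k2.2).congr_deriv ?_
  rw [e2, integral_const_mul, ← mul_sub, ← integral_sub iG]
  · simp only [mul_sub]
  · have hi : Integrable (fun w : Y × Y => h w.1 * h w.2 * inner ℝ (kk ε (X t w.1 - X t w.2)) (piL (P t w.1))) (ν.prod ν) := ct (by fun_prop)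
    refine hi.integral_prod_left.congr (Eventually.of_forall fun w => ?_)
    simp only
    rw [← integral_inner]
    · rw [← integral_const_mul]
      refine integral_congr_ae (Eventually.of_forall fun w' => ?_)
      simp only [inner_smul_right, real_inner_comm]; ring
    · exact (by fun_prop : Continuous fun w' => h w' • kk ε (X t w - X t w')).integrable_of_hasCompactSupport sh.smul_right
end
end VP
end

section
set_option linter.all false
namespace VP
open Set Filter Topology

structure Hy (N : ℝ) (B : ℝ → E2 → E3) (DB : ℝ → E2 → E2 →L[ℝ] E3) (b : ℝ) (E : ℝ → E2 → E2) (DE : ℝ → E2 → E2 →L[ℝ] E2)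
    (L c : ℝ) (f0 : Bool → Z → ℝ) (n M ℓ : ℝ) : Prop where
  hD : Data f0 n M ℓ
  hB : GoodB B DB b
  hE : GoodE E L c
  hd : ∀ t x, HasFDerivAt (E t) (DE t x) x
  hdc : Continuous fun q : ℝ × E2 => DE q.1 q.2

section
variable {N : ℝ} {B : ℝ → E2 → E3} {DB : ℝ → E2 → E2 →L[ℝ] E3} {b : ℝ} {E : ℝ → E2 → E2} {DE : ℝ → E2 → E2 →L[ℝ] E2}
  {L c c' T : ℝ} {f0 : Bool → Z → ℝ} {n M ℓ : ℝ}

lemma Hy.vf (H : Hy N B DB b E DE L c f0 n M ℓ) (s : Bool) :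
    C1VF (VF N B E (sg s)) (DVF N B DB DE (sg s)) (KV N b L) := VF_C1 H.hB H.hE (sg_abs s) H.hd H.hdc

lemma Hy.ffc (H : Hy N B DB b E DE L c f0 n M ℓ) (t : ℝ) (s : Bool) : Continuous (ff N B f0 E t s) := ff_cont' H.hD H.hB H.hE t s

lemma Hy.ffs (H : Hy N B DB b E DE L c f0 n M ℓ) (t : ℝ) (s : Bool) : HasCompactSupport (ff N B f0 E t s) := by
  obtain ⟨K, hK, h⟩ := support_flow (H.vf s).toLipVF (H.hD.cs s) (|t| + 1)
  exact HasCompactSupport.intro hK fun z hz => h t (by linarith) z hz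

lemma Hy.lio (H : Hy N B DB b E DE L c f0 n M ℓ) {w : Z → ℝ} (hw : ContDiff ℝ 1 w) (t : ℝ) (s : Bool) :
    ∫ z, ff N B f0 E t s z * w z = ∫ z, f0 s z * w (flow (VF N B E (sg s)) t 0 z) :=
  liouville_w (H.vf s) (fun t z => DVF_trace DE t z) (H.hD.c1 s) (H.hD.cs s) hw t

abbrev YY := Bool × Z
abbrev nu : Measure YY := (Measure.count : Measure Bool).prod volume

lemma YY_cont {X : Type*} [TopologicalSpace X] {g : ℝ → YY → X} (h : ∀ s, Continuous fun q : ℝ × Z => g q.1 (s, q.2)) :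
    Continuous fun q : ℝ × YY => g q.1 q.2 := by
  have h1 : Continuous fun q : Bool × ℝ × Z => g q.2.1 (q.1, q.2.2) := continuous_prod_of_discrete_left.2 h
  exact h1.comp (f := fun q : ℝ × YY => (q.2.1, q.1, q.2.2)) (by fun_prop)

lemma YY_cs {g : YY → ℝ} (h : ∀ w : YY, n < ‖w.2‖ → g w = 0) : HasCompactSupport g :=
  HasCompactSupport.intro (isCompact_univ.prod (isCompact_closedBall (0:Z) n)) fun w hw => h w (by simpa using hw)

lemma YY_int {g : YY → ℝ} (hg : ∀ s, Continuous fun z => g (s, z)) (h : ∀ w : YY, n < ‖w.2‖ → g w = 0) :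
    ∫ w, g w ∂nu = (∫ z, g (true, z)) + ∫ z, g (false, z) := by
  have hi : Integrable g nu := (continuous_prod_of_discrete_left.2 hg : Continuous g).integrable_of_hasCompactSupport (YY_cs h)
  rw [integral_prod _ hi, integral_fintype (Integrable.of_finite)]
  simp [Measure.real]

/-- `∑` over species and transport of weights. -/
lemma Hy.tr (H : Hy N B DB b E DE L c f0 n M ℓ) {w : E2 → ℝ} (hw : ContDiff ℝ 1 w) (t : ℝ) :
    ∫ y, rho (ff N B f0 E t) y * w y = ∫ q : YY, (sg q.1 * f0 q.1 q.2) * w (flow (VF N B E (sg q.1)) t 0 q.2).1 ∂nu := by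
  have cw := hw.continuous
  have cf := H.ffc t
  have hi : ∀ s, Integrable (fun z : Z => ff N B f0 E t s z * w z.1) := fun s =>
    ((cf s).mul (cw.comp continuous_fst)).integrable_of_hasCompactSupport (H.ffs t s).mul_right
  have l := fun s => H.lio (w := fun z => w z.1) (hw.comp contDiff_fst) t s
  rw [YY_int (n := n)]
  · simp only [sg, Bool.false_eq_true, if_true, if_false, one_mul, neg_mul, integral_neg] at l ⊢
    have e := (l true).symm
    have e' := (l false).symm
    simp only [if_true, if_false, Bool.false_eq_true] at e e'
    rw [e, e', ← sub_eq_add_neg, ← integral_sub (hi _) (hi _)]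
    have hi2 : Integrable (fun z : Z => ff N B f0 E t true z * w z.1 - ff N B f0 E t false z * w z.1) := (hi true).sub (hi false)
    rw [Measure.volume_eq_prod] at hi2 ⊢
    rw [integral_prod _ hi2]
    refine integral_congr_ae (Eventually.of_forall fun y => ?_)
    simp only [rho]
    rw [← integral_mul_const]
    simp only [sub_mul]
  · intro s
    have := (H.hD.c1 s).continuous
    have h2 := (flow_cont (H.vf s).toLipVF 0).comp (f := fun z : Z => (t, z)) (by fun_prop)
    exact ((continuous_const (y := sg s)).mul this).mul (cw.comp (continuous_fst.comp h2))
  · intro w hw; simp [H.hD.sup w.1 w.2 hw]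

lemma Hy.st (H : Hy N B DB b E DE L c f0 n M ℓ) (hc' : ∀ τ ∈ Icc 0 T, ∀ x, ‖E τ x‖ ≤ c') {t : ℝ} (ht : t ∈ Icc 0 T) :
    StF (fun z => ff N B f0 E t true z + ff N B f0 E t false z) (2 * M) (1 + n + c' * T) (RR n c' T) := by
  have hc0 : 0 ≤ c' := (norm_nonneg _).trans (hc' t ht 0)
  have hn := H.hD.n0
  have ht0 := ht.1
  have htT := ht.2
  have hT := ht0.trans htT
  have key : ∀ s z, ff N B f0 E t s z ≠ 0 → ‖z.1‖ ≤ RR n c' T ∧ ‖z.2‖ < 1 + n + c' * T := fun s z hz => by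
    obtain ⟨h2, h3⟩ := ff_supp H.hD H.hB H.hE ht0 (fun τ hτ => hc' τ ⟨hτ.1, hτ.2.trans htT⟩) hz
    have i1 : n + (n + c' * t) * t ≤ n + (n + c' * T) * (1 + T) := by gcongr; linarith
    have i2 : n + c' * t ≤ n + c' * T := by gcongr
    exact ⟨h2.trans i1, by linarith⟩
  refine ⟨(H.ffc t true).add (H.ffc t false), fun z => add_nonneg (H.hD.nn _ _) (H.hD.nn _ _), fun z => ?_, fun z hz => ?_, fun z hz => ?_,
    by positivity, by unfold RR; positivity⟩
  · have := H.hD.bd true (flow (VF N B E (sg true)) 0 t z)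
    have := H.hD.bd false (flow (VF N B E (sg false)) 0 t z)
    simp only [ff]; linarith
  · have : ∀ s, ff N B f0 E t s z = 0 := fun s => by by_contra h; exact not_le.2 hz (key s z h).1
    simp [this]
  · have : ∀ s, ff N B f0 E t s z = 0 := fun s => by by_contra h; exact not_le.2 (key s z h).2 hz
    simp [this]

lemma Hy.rhole (H : Hy N B DB b E DE L c f0 n M ℓ) (hc' : ∀ τ ∈ Icc 0 T, ∀ x, ‖E τ x‖ ≤ c') {t : ℝ} (ht : t ∈ Icc 0 T) (y : E2) :
    |rho (ff N B f0 E t) y| ≤ ra (fun z => ff N B f0 E t true z + ff N B f0 E t false z) y := by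
  rw [rho, ra, ← norm_eq_abs]
  refine norm_integral_le_of_norm_le ((H.st hc' ht).pint1 y) (Eventually.of_forall fun p => ?_)
  have h1 : 0 ≤ ff N B f0 E t true (y, p) := H.hD.nn _ _
  have h2 : 0 ≤ ff N B f0 E t false (y, p) := H.hD.nn _ _
  rw [norm_eq_abs, abs_le]; constructor <;> linarith

end
end VP
end

section
set_option linter.all false
namespace VP
open Set Filter Topology

section
variable {N : ℝ} {B : ℝ → E2 → E3} {DB : ℝ → E2 → E2 →L[ℝ] E3} {b : ℝ} {E : ℝ → E2 → E2} {DE : ℝ → E2 → E2 →L[ℝ] E2}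
  {L c c' T : ℝ} {f0 : Bool → Z → ℝ} {n M ℓ : ℝ}

lemma LL_C1 {ε : ℝ} (hε : 0 < ε) (x : E2) : ContDiff ℝ 1 fun y => LL ε (x - y) := by
  unfold LL
  refine ContDiff.log ?_ fun y => by positivity
  exact ((contDiff_const.sub contDiff_id).norm_sq ℝ).add contDiff_const

lemma kk_C1 {ε : ℝ} (hε : 0 < ε) (x v : E2) : ContDiff ℝ 1 fun y => inner ℝ v (kk ε (x - y)) := by
  unfold kk
  have h : ContDiff ℝ 1 fun y : E2 => x - y := contDiff_const.sub contDiff_id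
  have h2 : ContDiff ℝ 1 fun y : E2 => 2 * (‖x - y‖ ^ 2 + ε ^ 2)⁻¹ :=
    contDiff_const.mul (((h.norm_sq ℝ).add contDiff_const).inv fun y => by positivity)
  exact contDiff_const.inner ℝ (h2.smul h)

def FF (N : ℝ) (B : ℝ → E2 → E3) (f0 : Bool → Z → ℝ) (E : ℝ → E2 → E2) (t : ℝ) (z : Z) : ℝ :=
  ff N B f0 E t true z + ff N B f0 E t false z

def aY (f0 : Bool → Z → ℝ) (q : YY) : ℝ := f0 q.1 q.2
def hY (f0 : Bool → Z → ℝ) (q : YY) : ℝ := sg q.1 * f0 q.1 q.2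
def zY (N : ℝ) (B : ℝ → E2 → E3) (E : ℝ → E2 → E2) (t : ℝ) (q : YY) : Z := flow (VF N B E (sg q.1)) t 0 q.2

lemma Hy.czY (H : Hy N B DB b E DE L c f0 n M ℓ) : Continuous fun q : ℝ × YY => zY N B E q.1 q.2 :=
  YY_cont fun s => flow_cont (H.vf s).toLipVF 0

lemma Hy.ca (H : Hy N B DB b E DE L c f0 n M ℓ) : Continuous (aY f0) :=
  continuous_prod_of_discrete_left.2 fun s => (H.hD.c1 s).continuous
lemma Hy.ch (H : Hy N B DB b E DE L c f0 n M ℓ) : Continuous (hY f0) :=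
  continuous_prod_of_discrete_left.2 fun s => (continuous_const (y := sg s)).mul (H.hD.c1 s).continuous
lemma Hy.sa (H : Hy N B DB b E DE L c f0 n M ℓ) : HasCompactSupport (aY f0) := YY_cs fun w hw => H.hD.sup _ _ hw
lemma Hy.sh (H : Hy N B DB b E DE L c f0 n M ℓ) : HasCompactSupport (hY f0) := YY_cs (n := n) fun w hw => by simp [hY, H.hD.sup _ _ hw]
lemma Hy.habs (H : Hy N B DB b E DE L c f0 n M ℓ) (q : YY) : |hY f0 q| = aY f0 q := by
  rw [hY, abs_mul, sg_abs, one_mul, abs_of_nonneg (H.hD.nn _ _)]; rfl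
lemma Hy.ai (H : Hy N B DB b E DE L c f0 n M ℓ) : Integrable (aY f0) nu := H.ca.integrable_of_hasCompactSupport H.sa

lemma Hy.wF (H : Hy N B DB b E DE L c f0 n M ℓ) {w : Z → ℝ} (hw : ContDiff ℝ 1 w) (t : ℝ) :
    ∫ z, w z * FF N B f0 E t z = ∫ q, aY f0 q * w (zY N B E t q) ∂nu := by
  have hi : ∀ s, Integrable (fun z : Z => ff N B f0 E t s z * w z) := fun s =>
    ((H.ffc t s).mul hw.continuous).integrable_of_hasCompactSupport (H.ffs t s).mul_right
  rw [YY_int (n := n)]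
  · have e := H.lio hw t true
    have e' := H.lio hw t false
    simp only [aY, zY]
    rw [← e, ← e', ← integral_add (hi _) (hi _)]
    simp only [FF, mul_comm, mul_add]
  · intro s
    have h2 := (flow_cont (H.vf s).toLipVF 0).comp (f := fun z : Z => (t, z)) (by fun_prop)
    exact (H.hD.c1 s).continuous.mul (hw.continuous.comp h2)
  · intro w hw; simp [aY, H.hD.sup w.1 w.2 hw]

lemma Hy.mass (H : Hy N B DB b E DE L c f0 n M ℓ) (t : ℝ) : ∫ z, FF N B f0 E t z = ∫ q, aY f0 q ∂nu := by
  simpa using H.wF (w := fun _ => 1) contDiff_const t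
lemma Hy.kin (H : Hy N B DB b E DE L c f0 n M ℓ) (t : ℝ) :
    ∫ z : Z, ‖z.2‖ ^ 2 * FF N B f0 E t z = ∫ q, aY f0 q * ‖(zY N B E t q).2‖ ^ 2 ∂nu :=
  H.wF (w := fun z : Z => ‖z.2‖ ^ 2) (contDiff_snd.norm_sq ℝ) t

lemma Hy.eeY (H : Hy N B DB b E DE L c f0 n M ℓ) (hT : 0 ≤ T) {t : ℝ} (ht : t ∈ Icc 0 T) {ε : ℝ} (hε : 0 < ε) (x : E2) :
    ∫ q, hY f0 q • kk ε (x - (zY N B E t q).1) ∂nu = EE ε (rho (ff N B f0 E t)) x := by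
  have e : rho (ff N B f0 E t) = rc N B f0 T E t := by rw [rc, cl_eq ht]
  refine ext_inner_left ℝ fun v => ?_
  have h1 := H.tr (kk_C1 hε x v) t
  have c1 : Continuous (zY N B E t) := H.czY.comp (f := fun q => (t, q)) (by fun_prop)
  have ck := kk_cont hε
  have chh := H.ch
  rw [← integral_inner, EE, ← integral_inner]
  · simp only [inner_smul_right]; exact h1.symm
  · rw [e]
    exact EE_int (rc_cont' H.hD H.hB H.hE hT t) (rc_bd H.hD H.hB H.hE hT (fun τ _ => H.hE.bd τ) t)
      (rc_supp H.hD H.hB H.hE hT (fun τ _ => H.hE.bd τ) t) ε x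
  · exact (by fun_prop : Continuous fun q => hY f0 q • kk ε (x - (zY N B E t q).1)).integrable_of_hasCompactSupport H.sh.smul_right

lemma Hy.aY_bd (H : Hy N B DB b E DE L c f0 n M ℓ) (hc' : ∀ τ ∈ Icc 0 T, ∀ x, ‖E τ x‖ ≤ c') {t : ℝ} (ht : t ∈ Icc 0 T) (q : YY)
    (hq : aY f0 q ≠ 0) : ‖(zY N B E t q).1‖ ≤ RR n c' T ∧ ‖(zY N B E t q).2‖ ≤ n + c' * T := by
  have hc0 : 0 ≤ c' := (norm_nonneg _).trans (hc' t ht 0)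
  have hn := H.hD.n0
  have ht0 := ht.1
  have htT := ht.2
  have hT := ht0.trans htT
  have hz : ff N B f0 E t q.1 (zY N B E t q) ≠ 0 := by
    rwa [ff, zY, flow_comp (H.vf _).toLipVF, flow_self (H.vf _).toLipVF]
  obtain ⟨h2, h3⟩ := ff_supp H.hD H.hB H.hE ht0 (fun τ hτ => hc' τ ⟨hτ.1, hτ.2.trans htT⟩) hz
  have i1 : n + (n + c' * t) * t ≤ n + (n + c' * T) * (1 + T) := by gcongr; linarith
  have i2 : n + c' * t ≤ n + c' * T := by gcongr
  exact ⟨h2.trans i1, h3.trans i2⟩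

def BB (n M Q c' T δ : ℝ) : ℝ :=
  (Real.log (2 + 4 * (RR n c' T) ^ 2) - 2 * Real.log δ) * Q + 2 * M * v3 (1 + n + c' * T) * (4 * vb2 * δ)

lemma Hy.pot (H : Hy N B DB b E DE L c f0 n M ℓ) (hc' : ∀ τ ∈ Icc 0 T, ∀ x, ‖E τ x‖ ≤ c') {t : ℝ} (ht : t ∈ Icc 0 T)
    {ε δ : ℝ} (hε : 0 < ε) (hε1 : ε ≤ 1) (hδ : 0 < δ) (hδ1 : δ ≤ 1) :
    |∫ w, hY f0 w * (∫ w', hY f0 w' * LL ε ((zY N B E t w).1 - (zY N B E t w').1) ∂nu) ∂nu| ≤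
      (∫ q, aY f0 q ∂nu) * BB n M (∫ q, aY f0 q ∂nu) c' T δ := by
  rw [← integral_mul_const, ← norm_eq_abs]
  refine norm_integral_le_of_norm_le (H.ai.mul_const _) (Eventually.of_forall fun w => ?_)
  rw [norm_mul, norm_eq_abs, H.habs]
  by_cases hq : aY f0 w = 0
  · simp [hq]
  have ha : 0 ≤ aY f0 w := H.hD.nn _ _
  refine mul_le_mul_of_nonneg_left ?_ ha
  have h1 := H.tr (LL_C1 hε (zY N B E t w).1) t
  have h2 := pot_B (H.st hc' ht) hε hε1 hδ hδ1 (H.rhole hc' ht) (H.aY_bd hc' ht w hq).1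
  rw [h1] at h2
  have h3 := H.mass t
  unfold FF at h3
  rw [h3] at h2
  exact h2

lemma Hy.ener (H : Hy N B DB b E DE L c f0 n M ℓ) (hc' : ∀ τ ∈ Icc 0 T, ∀ x, ‖E τ x‖ ≤ c')
    (hsc : ∀ t ∈ Icc 0 T, ∀ x, E t x = EE 0 (rho (ff N B f0 E t)) x) {δ : ℝ} (hδ : 0 < δ) (hδ1 : δ ≤ 1)
    {t : ℝ} (ht : t ∈ Icc 0 T) :
    ∫ z : Z, ‖z.2‖ ^ 2 * FF N B f0 E t z ≤ (∫ q, aY f0 q * ‖q.2.2‖ ^ 2 ∂nu) +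
      2 * ((∫ q, aY f0 q ∂nu) * BB n M (∫ q, aY f0 q ∂nu) c' T δ) := by
  have hT := ht.1.trans ht.2
  have hc0 : 0 ≤ c' := (norm_nonneg _).trans (hc' t ht 0)
  have hn := H.hD.n0
  set Q := ∫ q, aY f0 q ∂nu with hQ
  have hQ0 : 0 ≤ Q := integral_nonneg fun q => H.hD.nn _ _
  set C := 2 * (Q * ((n + c' * T) * (2 * mm M (RR n c T) * (JJ (3/2) + vR (RR n c T))))) with hC
  have cz := H.czY
  have cV : Continuous fun q : ℝ × YY => (VF N B E (sg q.2.1) q.1 (zY N B E q.1 q.2)).2 := by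
    refine YY_cont (g := fun t q => (VF N B E (sg q.1) t (zY N B E t q)).2) fun s => ?_
    exact continuous_snd.comp ((H.vf s).cont.comp (f := fun q : ℝ × Z => (q.1, flow (VF N B E (sg s)) q.1 0 q.2))
      (continuous_fst.prodMk (flow_cont (H.vf s).toLipVF 0)))
  have cE := H.hE.cont
  have cG : Continuous fun q : ℝ × YY => inner ℝ (piL (zY N B E q.1 q.2).2) (E q.1 (zY N B E q.1 q.2).1) := by
    have : Continuous fun q : ℝ × YY => E q.1 (zY N B E q.1 q.2).1 :=
      cE.comp (f := fun q : ℝ × YY => (q.1, (zY N B E q.1 q.2).1)) (by fun_prop)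
    fun_prop
  have step : ∀ ε, 0 < ε → ε ≤ 1 → ∫ z : Z, ‖z.2‖ ^ 2 * FF N B f0 E t z ≤ (∫ q, aY f0 q * ‖q.2.2‖ ^ 2 ∂nu) +
      2 * (Q * BB n M Q c' T δ) + C * √ε * T := by
    intro ε hε hε1
    have hder := fun t => energy_abs (ν := nu) (X := fun t q => (zY N B E t q).1) (P := fun t q => (zY N B E t q).2)
      (Q := fun t q => (VF N B E (sg q.1) t (zY N B E t q)).2) (a := aY f0) (h := hY f0)
      (G := fun t q => inner ℝ (piL (zY N B E t q).2) (E t (zY N B E t q).1)) hε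
      (by fun_prop) (by fun_prop) cV
      (fun t q => (flow_deriv (H.vf q.1).toLipVF 0 q.2 t).fst) (fun t q => (flow_deriv (H.vf q.1).toLipVF 0 q.2 t).snd)
      H.ca H.ch H.sa H.sh (fun t q => by
        simp only [VF, inner_smul_right, inner_add_right, inner_ioL]
        have e : inner ℝ (zY N B E t q).2 (crossL (cut N (zY N B E t q).2) (B t (zY N B E t q).1)) = 0 := by
          rw [cut, map_smul, ContinuousLinearMap.smul_apply, inner_smul_right, crossL_apply, inner_cross_self, mul_zero]
        rw [e, aY, hY]; ring) cG t
    have hb := norm_image_sub_le_of_norm_deriv_le_segment' (a := 0) (b := T) (C := C * √ε)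
      (fun τ _ => (hder τ).hasDerivWithinAt) (fun τ hτ => ?_) t ht
    · have p1 := H.pot hc' ht hε hε1 hδ hδ1
      have p2 := H.pot (t := 0) hc' ⟨le_rfl, hT⟩ hε hε1 hδ hδ1
      have k0 : ∫ q, aY f0 q * ‖(zY N B E 0 q).2‖ ^ 2 ∂nu = ∫ q, aY f0 q * ‖q.2.2‖ ^ 2 ∂nu := by
        simp only [zY, fun q : YY => flow_self (H.vf q.1).toLipVF 0 q.2]
      rw [H.kin t]
      rw [k0, norm_eq_abs, abs_le] at hb
      rw [abs_le] at p1 p2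
      have hCC : C * √ε * (t - 0) ≤ C * √ε * T := by
        have := JJ_nonneg (α := 3/2) (by norm_num)
        have := vR_nonneg (RR n c T)
        have := H.hD.m0 (RR n c T)
        have : 0 ≤ C := by positivity
        gcongr; linarith [ht.2]
      linarith [hb.2]
    · have hτ' : τ ∈ Icc 0 T := ⟨hτ.1, hτ.2.le⟩
      have e : rho (ff N B f0 E τ) = rc N B f0 T E τ := by rw [rc, cl_eq hτ']
      rw [norm_mul, hC, Real.norm_ofNat, mul_assoc, mul_assoc, mul_assoc, hQ, ← integral_mul_const]
      refine mul_le_mul_of_nonneg_left ?_ zero_le_two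
      refine norm_integral_le_of_norm_le (H.ai.mul_const _) (Eventually.of_forall fun w => ?_)
      rw [norm_mul, norm_eq_abs, H.habs]
      by_cases hq : aY f0 w = 0
      · simp [hq]
      refine mul_le_mul_of_nonneg_left ?_ (H.hD.nn _ _)
      rw [H.eeY hT hτ' hε, hsc τ hτ', ← inner_sub_right, e]
      refine (norm_inner_le_norm _ _).trans ?_
      have h1 := EE_eps (rc_cont' (N := N) H.hD H.hB H.hE hT τ) (rc_bd H.hD H.hB H.hE hT (fun τ _ => H.hE.bd τ) τ)
        (rc_supp H.hD H.hB H.hE hT (fun τ _ => H.hE.bd τ) τ) hε.le (zY N B E τ w).1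
      rw [mul_assoc]
      refine mul_le_mul ((piL_le _).trans (H.aY_bd hc' hτ' w hq).2) (h1.trans (le_of_eq (by ring))) (norm_nonneg _) (by positivity)
  have lim : Tendsto (fun ε => (∫ q, aY f0 q * ‖q.2.2‖ ^ 2 ∂nu) + 2 * (Q * BB n M Q c' T δ) + C * √ε * T) (𝓝[>] 0)
      (𝓝 ((∫ q, aY f0 q * ‖q.2.2‖ ^ 2 ∂nu) + 2 * (Q * BB n M Q c' T δ) + C * √0 * T)) :=
    (Continuous.tendsto (by fun_prop) 0).mono_left nhdsWithin_le_nhds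
  rw [Real.sqrt_zero, mul_zero, zero_mul, add_zero] at lim
  refine ge_of_tendsto lim ?_
  filter_upwards [Ioc_mem_nhdsGT zero_lt_one] with ε hε using step ε hε.1 hε.2
end
end VP
end

section
set_option linter.all false
namespace VP
open Set Filter Topology

section
variable {N : ℝ} {B : ℝ → E2 → E3} {DB : ℝ → E2 → E2 →L[ℝ] E3} {b : ℝ} {E : ℝ → E2 → E2} {DE : ℝ → E2 → E2 →L[ℝ] E2}
  {L c c' T T0 : ℝ} {f0 : Bool → Z → ℝ} {n M ℓ : ℝ}

def qn (n M : ℝ) : ℝ := 2 * M * volume.real (Metric.closedBall (0:Z) n)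

lemma Hy.Qle (H : Hy N B DB b E DE L c f0 n M ℓ) : ∫ q, aY f0 q ∂nu ≤ qn n M := by
  rw [YY_int (g := aY f0) (n := n) (fun s => (H.hD.c1 s).continuous) (fun w hw => H.hD.sup _ _ hw)]
  have key : ∀ s, ∫ z, f0 s z ≤ M * volume.real (Metric.closedBall (0:Z) n) := by
    intro s
    have e : ∫ z, f0 s z = ∫ z in Metric.closedBall (0:Z) n, f0 s z :=
      (setIntegral_eq_integral_of_forall_compl_eq_zero fun p hp => H.hD.sup _ _ (by simpa using hp)).symm
    have := norm_setIntegral_le_of_norm_le_const (μ := volume) (s := Metric.closedBall (0:Z) n) (C := M)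
      (f := f0 s) measure_closedBall_lt_top (fun p _ => by rw [norm_eq_abs, abs_of_nonneg (H.hD.nn _ _)]; exact H.hD.bd _ _)
    rw [e]; exact (le_abs_self _).trans this
  have h1 := key true
  have h2 := key false
  simp only [aY, qn]; linarith

lemma Hy.Kle (H : Hy N B DB b E DE L c f0 n M ℓ) : ∫ q, aY f0 q * ‖q.2.2‖ ^ 2 ∂nu ≤ qn n M * n ^ 2 := by
  have hn := H.hD.n0
  refine le_trans ?_ (mul_le_mul_of_nonneg_right H.Qle (sq_nonneg n))
  rw [← integral_mul_const]
  have ca := H.ca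
  refine integral_mono ((by fun_prop : Continuous fun q : YY => aY f0 q * ‖q.2.2‖ ^ 2).integrable_of_hasCompactSupport H.sa.mul_right)
    (H.ai.mul_const _) fun q => ?_
  by_cases hq : n < ‖q.2‖
  · have : aY f0 q = 0 := H.hD.sup _ _ hq
    simp [this]
  · have : ‖q.2.2‖ ≤ n := (norm_snd_le _).trans (not_lt.1 hq)
    have ha : 0 ≤ aY f0 q := H.hD.nn _ _
    simp only; gcongr

lemma v3_scale {P : ℝ} (hP : 0 ≤ P) : v3 P = P ^ 3 * v3 1 := by
  unfold v3
  rw [Measure.real, Measure.real, Measure.addHaar_closedBall volume _ hP, Measure.addHaar_closedBall volume _ zero_le_one]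
  simp [ENNReal.toReal_ofReal (pow_nonneg hP 3)]

def c1 (n M T : ℝ) : ℝ := (4 * (2 + T) + 112) * qn n M + 8 * M * v3 1 * vb2
def c2 (n M T : ℝ) : ℝ := qn n M * n ^ 2 + 2 * (qn n M * c1 n M T)
def c4 (n M T : ℝ) : ℝ := 2 * (qn n M + c2 n M T + 2 * M * C3 * JJ (7/4))
def AP (n M T : ℝ) : ℝ := 2 * (2 + n + c4 n M T ^ 14 * (2 * (T + 1)) ^ 13)

set_option maxHeartbeats 1000000 in
lemma Hy.step (H : Hy N B DB b E DE L c f0 n M ℓ) (hTT : T0 ≤ T) (hc' : ∀ τ ∈ Icc 0 T0, ∀ x, ‖E τ x‖ ≤ c')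
    (hsc : ∀ t ∈ Icc 0 T0, ∀ x, E t x = EE 0 (rho (ff N B f0 E t)) x) {t : ℝ} (ht : t ∈ Icc 0 T0) (x : E2) :
    ‖E t x‖ ≤ AP n M T / 2 + c' / 2 := by
  have hT0 := ht.1.trans ht.2
  have hT := hT0.trans hTT
  have hc0 : 0 ≤ c' := (norm_nonneg _).trans (hc' t ht 0)
  have hn := H.hD.n0
  have hM := H.hD.M0
  have hq0 : 0 ≤ qn n M := by unfold qn; positivity
  have hv1 := v3_nonneg 1
  have hvb := vb2_nonneg
  have hC3 := C3_nonneg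
  have hJ := JJ_nonneg (α := 7/4) (by norm_num)
  have hc1 : 0 ≤ c1 n M T := by unfold c1; positivity
  have hc2 : 0 ≤ c2 n M T := by unfold c2; positivity
  have hc4 : 0 ≤ c4 n M T := by unfold c4; positivity
  set P := 1 + n + c' * T0 with hP
  have hP1 : 0 ≤ P := by positivity
  obtain ⟨w, hw1, hw⟩ : ∃ w : ℝ, 1 ≤ w ∧ w ^ 14 = 1 + P :=
    ⟨(1 + P) ^ ((14:ℕ):ℝ)⁻¹, Real.one_le_rpow (by linarith) (by positivity), Real.rpow_inv_natCast_pow (by linarith) (by norm_num)⟩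
  have hw0 : 0 < w := by linarith
  have hlog : Real.log (1 + P) ≤ 14 * w := by
    rw [← hw, Real.log_pow]; push_cast; nlinarith [Real.log_le_sub_one_of_pos hw0]
  set Q := ∫ q, aY f0 q ∂nu with hQ
  have hQ0 : 0 ≤ Q := integral_nonneg fun q => H.hD.nn _ _
  have hQq : Q ≤ qn n M := H.Qle
  set δ := ((1 + P) ^ 3)⁻¹ with hδ
  have hδ0 : 0 < δ := by positivity
  have hδ1 : δ ≤ 1 := inv_le_one_of_one_le₀ (one_le_pow₀ (by linarith))
  have hlδ : - 2 * Real.log δ ≤ 84 * w := by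
    rw [hδ, Real.log_inv, Real.log_pow]; push_cast; linarith
  set R := RR n c' T0 with hR
  have hR0 : 0 ≤ R := by rw [hR]; unfold RR; positivity
  have hRP : 1 + R ≤ (1 + P) * (2 + T) := by
    rw [hR, hP]; unfold RR
    have : 0 ≤ c' * T0 := by positivity
    nlinarith [mul_nonneg this (sub_nonneg.2 hTT), mul_nonneg hn (sub_nonneg.2 hTT)]
  have hlR : Real.log (2 + 4 * R ^ 2) ≤ 4 * (2 + T) + 28 * w := by
    have h1 : 2 + 4 * R ^ 2 ≤ (2 * ((1 + P) * (2 + T))) ^ 2 := by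
      have : (2 * (1 + R)) ^ 2 ≤ (2 * ((1 + P) * (2 + T))) ^ 2 := by gcongr
      nlinarith
    have h2 := Real.log_le_log (by positivity) h1
    rw [Real.log_pow, show 2 * ((1 + P) * (2 + T)) = (1 + P) * (2 * (2 + T)) by ring, Real.log_mul (by positivity) (by positivity)] at h2
    push_cast at h2
    have := Real.log_le_sub_one_of_pos (show 0 < 2 * (2 + T) by positivity)
    linarith
  have hvP : v3 P * δ ≤ v3 1 := by
    rw [v3_scale hP1, hδ, ← div_eq_mul_inv, div_le_iff₀ (by positivity), mul_comm]
    gcongr; linarith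
  have hBB : BB n M Q c' T0 δ ≤ c1 n M T * w := by
    unfold BB
    rw [← hR, ← hP]
    have h1 : (Real.log (2 + 4 * R ^ 2) - 2 * Real.log δ) * Q ≤ ((4 * (2 + T) + 112) * w) * qn n M := by
      refine mul_le_mul ?_ hQq hQ0 (by positivity)
      nlinarith
    have h2 : 2 * M * v3 P * (4 * vb2 * δ) ≤ 8 * M * vb2 * v3 1 * w := by
      calc 2 * M * v3 P * (4 * vb2 * δ) = 8 * M * vb2 * (v3 P * δ) := by ring
        _ ≤ 8 * M * vb2 * v3 1 := by gcongr
        _ ≤ 8 * M * vb2 * v3 1 * w := le_mul_of_one_le_right (by positivity) hw1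
    unfold c1; linarith
  have hkin : ∫ z : Z, ‖z.2‖ ^ 2 * FF N B f0 E t z ≤ c2 n M T * w := by
    refine (H.ener hc' hsc hδ0 hδ1 ht).trans ?_
    have h1 : Q * BB n M Q c' T0 δ ≤ qn n M * (c1 n M T * w) :=
      (mul_le_mul_of_nonneg_left hBB hQ0).trans (mul_le_mul_of_nonneg_right hQq (by positivity))
    have h2 := H.Kle
    have h3 : qn n M * n ^ 2 ≤ qn n M * n ^ 2 * w := le_mul_of_one_le_right (by positivity) hw1
    unfold c2; rw [← hQ]; linarith
  have hfield := field_A (H.st hc' ht) (show 0 < w ^ 12 by positivity) (H.rhole hc' ht) x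
  rw [← hsc t ht] at hfield
  have hmass := H.mass t
  unfold FF at hmass hkin
  rw [hmass, ← hQ, ← hP] at hfield
  have e1 : (w ^ 12) ^ (-(3/4:ℝ)) * P ^ (3/2:ℝ) ≤ w ^ 13 := by
    have h1 : P ^ (3/2:ℝ) ≤ (w ^ 14) ^ (3/2:ℝ) := Real.rpow_le_rpow hP1 (by linarith) (by norm_num)
    have h2 : (w ^ 14) ^ (3/2:ℝ) = w ^ 21 := by
      rw [← Real.rpow_natCast, ← Real.rpow_natCast, ← Real.rpow_mul hw0.le]; norm_num
    have h3 : (w ^ 12) ^ (-(3/4:ℝ)) = (w ^ 9)⁻¹ := by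
      rw [← Real.rpow_natCast, ← Real.rpow_natCast, ← Real.rpow_mul hw0.le, ← Real.rpow_neg hw0.le]; norm_num
    rw [h3]; rw [h2] at h1
    calc (w ^ 9)⁻¹ * P ^ (3/2:ℝ) ≤ (w ^ 9)⁻¹ * w ^ 21 := by gcongr
      _ = w ^ 12 := by field_simp
      _ ≤ w ^ 13 := pow_le_pow_right₀ hw1 (by norm_num)
  have hE1 : ‖E t x‖ ≤ c4 n M T * w ^ 13 := by
    refine hfield.trans ?_
    have h1 : Q ≤ qn n M * w ^ 13 := hQq.trans (le_mul_of_one_le_right hq0 (one_le_pow₀ hw1))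
    have h2 : w ^ 12 * (∫ z : Z, ‖z.2‖ ^ 2 * (ff N B f0 E t true z + ff N B f0 E t false z)) ≤ c2 n M T * w ^ 13 := by
      calc _ ≤ w ^ 12 * (c2 n M T * w) := by gcongr
        _ = _ := by ring
    have h3 : 2 * M * (w ^ 12) ^ (-(3/4:ℝ)) * (C3 * P ^ (3/2:ℝ)) * JJ (7/4) ≤ 2 * M * C3 * JJ (7/4) * w ^ 13 := by
      calc _ = 2 * M * C3 * JJ (7/4) * ((w ^ 12) ^ (-(3/4:ℝ)) * P ^ (3/2:ℝ)) := by ring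
        _ ≤ _ := by gcongr
    unfold c4; linarith
  refine hE1.trans ?_
  have hy : c4 n M T * w ^ 13 ≤ w ^ 14 / (2 * (T + 1)) + c4 n M T ^ 14 * (2 * (T + 1)) ^ 13 := by
    rcases le_total (c4 n M T * (2 * (T + 1))) w with h | h
    · refine le_add_of_le_of_nonneg ?_ (by positivity)
      rw [le_div_iff₀ (by positivity)]
      calc c4 n M T * w ^ 13 * (2 * (T + 1)) = c4 n M T * (2 * (T + 1)) * w ^ 13 := by ring
        _ ≤ w * w ^ 13 := by gcongr
        _ = w ^ 14 := by ring
    · refine le_add_of_nonneg_of_le (by positivity) ?_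
      calc c4 n M T * w ^ 13 ≤ c4 n M T * (c4 n M T * (2 * (T + 1))) ^ 13 := by gcongr
        _ = _ := by ring
  have h5 : w ^ 14 / (2 * (T + 1)) ≤ 2 + n + c' / 2 := by
    rw [hw, div_le_iff₀ (by positivity), hP]
    nlinarith [mul_nonneg hc0 (sub_nonneg.2 hTT), mul_nonneg hn hT]
  unfold AP; linarith

/-- A priori bound. -/
lemma Hy.apriori (H : Hy N B DB b E DE L c f0 n M ℓ) (hTT : T0 ≤ T)
    (hsc : ∀ t ∈ Icc 0 T0, ∀ x, E t x = EE 0 (rho (ff N B f0 E t)) x) {t : ℝ} (ht : t ∈ Icc 0 T0) (x : E2) :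
    ‖E t x‖ ≤ AP n M T := by
  set S : Set ℝ := {r | ∃ τ ∈ Icc 0 T0, ∃ x, ‖E τ x‖ = r} with hS
  have hb : BddAbove S := ⟨c, by rintro r ⟨τ, _, x, rfl⟩; exact H.hE.bd τ x⟩
  have h1 : ∀ τ ∈ Icc 0 T0, ∀ x, ‖E τ x‖ ≤ sSup S := fun τ hτ x => le_csSup hb ⟨τ, hτ, x, rfl⟩
  have h2 : sSup S ≤ AP n M T / 2 + sSup S / 2 := by
    refine csSup_le ⟨_, t, ht, x, rfl⟩ ?_
    rintro r ⟨τ, hτ, x, rfl⟩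
    exact H.step hTT h1 hsc hτ x
  linarith [h1 t ht x]
end
end VP
end

section
set_option linter.all false
namespace VP
open Set Filter Topology

def PH (Q N : ℝ) (B : ℝ → E2 → E3) (f0 : Bool → Z → ℝ) (T : ℝ) (E : ℝ → E2 → E2) (t : ℝ) (x : E2) : E2 :=
  cut Q (EE 0 (rc N B f0 T E t) x)

structure GG (T k lam c : ℝ) (E : ℝ → E2 → E2) : Prop where
  g : GoodE E (k * exp (lam * T)) c
  w : ∀ t x y, ‖E t x - E t y‖ ≤ k * exp (lam * cl T t) * ‖x - y‖

def kG (Q N b c T n M ℓ : ℝ) : ℝ := 2 * (cutK E2 Q * CK (RR n c T) * (2 * v3 (RR n c T) * ℓ + mm M (RR n c T) * (1 + K0 N b * T)))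
def lG (Q c T n M : ℝ) : ℝ := 2 * (cutK E2 Q * CK (RR n c T) * mm M (RR n c T)) + 1
def uG (N b L c T n ℓ : ℝ) : ℝ := 4 * v3 (RR n c T) * ℓ * exp ((K0 N b + L) * T) * (JJ 1 + vR (RR n c T))

section
variable {Q N : ℝ} {B : ℝ → E2 → E3} {DB : ℝ → E2 → E2 →L[ℝ] E3} {b : ℝ} {E E' : ℝ → E2 → E2} {L c c' T : ℝ}
  {f0 : Bool → Z → ℝ} {n M ℓ : ℝ}

lemma kG0 (hD : Data f0 n M ℓ) (hB : GoodB B DB b) (hT : 0 ≤ T) : 0 ≤ kG Q N b c T n M ℓ := by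
  have := hD.m0 (RR n c T); have := hD.l0; have := v3_nonneg (RR n c T); have := CK_nonneg (RR n c T); have := K0_nonneg N hB.nonneg
  unfold kG; positivity

lemma lG0 (hD : Data f0 n M ℓ) : 0 < lG Q c T n M := by
  have := hD.m0 (RR n c T); have := CK_nonneg (RR n c T)
  unfold lG; positivity

lemma uG0 (hD : Data f0 n M ℓ) : 0 ≤ uG N b L c T n ℓ := by
  have := hD.l0; have := v3_nonneg (RR n c T); have := vR_nonneg (RR n c T); have := JJ_nonneg (α := 1) (by norm_num)
  unfold uG; positivity

lemma EErc_cont (hD : Data f0 n M ℓ) (hB : GoodB B DB b) (hE : GoodE E L c) (hT : 0 ≤ T) :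
    Continuous fun q : ℝ × E2 => EE 0 (rc N B f0 T E q.1) q.2 :=
  EE_cont (rc_cont hD hB hE hT) (rc_bd hD hB hE hT (fun τ _ => hE.bd τ)) (rc_supp hD hB hE hT (fun τ _ => hE.bd τ))

lemma PH_mem (hD : Data f0 n M ℓ) (hB : GoodB B DB b) (hT : 0 ≤ T) (hQ : |Q| + 1 ≤ c)
    (hE : GG T (kG Q N b c T n M ℓ) (lG Q c T n M) c E) : GG T (kG Q N b c T n M ℓ) (lG Q c T n M) c (PH Q N B f0 T E) := by
  have hk := kG0 (Q := Q) (N := N) (c := c) hD hB hT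
  have hl := lG0 (Q := Q) (c := c) (T := T) hD
  set k := kG Q N b c T n M ℓ with hkd
  set lam := lG Q c T n M with hld
  have hK := K0_nonneg N hB.nonneg
  have hC := CK_nonneg (RR n c T)
  have hm := hD.m0 (RR n c T)
  have hv := v3_nonneg (RR n c T)
  have hl0 := hD.l0
  have hw : ∀ t x y, ‖PH Q N B f0 T E t x - PH Q N B f0 T E t y‖ ≤ k * exp (lam * cl T t) * ‖x - y‖ := by
    intro t x y
    obtain ⟨h0, h1⟩ := cl_mem hT t
    set w := exp (lam * cl T t) with hwd
    have hw1 : 1 ≤ w := one_le_exp (by positivity)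
    set J := K0 N b * cl T t + k * (w - 1) / lam with hJ
    have hJ0 : 0 ≤ J := by have : 0 ≤ w - 1 := by linarith
                           positivity
    have h2 := rc_lip (N := N) hD hB hE.g hT hk hl (fun τ hτ x y => by
      have := hE.w τ x y; rwa [cl_eq hτ] at this) t
    have h3 := EE_lip (rc_cont' (N := N) hD hB hE.g hT t) (rc_bd hD hB hE.g hT (fun τ _ => hE.g.bd τ) t)
      (rc_supp hD hB hE.g hT (fun τ _ => hE.g.bd τ) t) (by positivity) h2 hJ0 x y
    refine (cut_lip Q _ _).trans ((mul_le_mul_of_nonneg_left h3 (NNReal.coe_nonneg _)).trans ?_)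
    rw [← mul_assoc]
    refine mul_le_mul_of_nonneg_right ?_ (norm_nonneg _)
    rw [← hJ, mul_assoc (2 * v3 (RR n c T) * ℓ), ← exp_add, add_neg_cancel, exp_zero, mul_one]
    have e1 : (cutK E2 Q : ℝ) * CK (RR n c T) * (2 * v3 (RR n c T) * ℓ + mm M (RR n c T) * (1 + K0 N b * cl T t)) ≤ k / 2 := by
      rw [hkd]; unfold kG; rw [mul_div_cancel_left₀ _ two_ne_zero]; gcongr
    have e2 : (cutK E2 Q : ℝ) * CK (RR n c T) * mm M (RR n c T) * (k * (w - 1) / lam) ≤ k * (w - 1) / 2 := by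
      have : (cutK E2 Q : ℝ) * CK (RR n c T) * mm M (RR n c T) = (lam - 1) / 2 := by rw [hld]; unfold lG; ring
      rw [this, ← mul_div_assoc, div_le_div_iff₀ hl two_pos]
      have : 0 ≤ k * (w - 1) := mul_nonneg hk (by linarith)
      nlinarith
    rw [hJ]
    nlinarith [mul_nonneg hk (sub_nonneg.2 hw1)]
  refine ⟨⟨(cut_contDiff Q).continuous.comp (EErc_cont hD hB hE.g hT), fun t x y => ?_, fun t x => (cut_bd _ _).trans hQ⟩, hw⟩
  refine (hw t x y).trans ?_
  have := (cl_mem hT t).2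
  gcongr

lemma PH_stab (hD : Data f0 n M ℓ) (hB : GoodB B DB b) (hE : GoodE E L c) (hE' : GoodE E' L c) (hT : 0 ≤ T)
    {D μ : ℝ} (hD0 : 0 ≤ D) (hμ : μ = 2 * (cutK E2 Q * uG N b L c T n ℓ) + 1)
    (hw : ∀ t x, ‖E t x - E' t x‖ ≤ D * exp (μ * cl T t)) (t : ℝ) (x : E2) :
    ‖PH Q N B f0 T E t x - PH Q N B f0 T E' t x‖ ≤ D / 2 * exp (μ * cl T t) := by
  have hu := uG0 (N := N) (b := b) (L := L) (c := c) (T := T) hD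
  have hμ0 : 0 < μ := by rw [hμ]; positivity
  have h := field_stab (N := N) hD hB hE hE' hT hD0 hμ0 (fun τ hτ x => by
      have := hw τ x; rwa [cl_eq hτ] at this) t x
  refine (cut_lip Q _ _).trans ((mul_le_mul_of_nonneg_left h (NNReal.coe_nonneg _)).trans ?_)
  change (cutK E2 Q : ℝ) * (uG N b L c T n ℓ / μ * (D * exp (μ * cl T t))) ≤ _
  have e : (cutK E2 Q : ℝ) * uG N b L c T n ℓ / μ ≤ 1 / 2 := by
    rw [div_le_div_iff₀ hμ0 two_pos, hμ]; linarith
  calc _ = (cutK E2 Q : ℝ) * uG N b L c T n ℓ / μ * (D * exp (μ * cl T t)) := by ring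
    _ ≤ 1 / 2 * (D * exp (μ * cl T t)) := by gcongr
    _ = _ := by ring

lemma PH_fix (hD : Data f0 n M ℓ) (hB : GoodB B DB b) (hT : 0 ≤ T) (hQ : |Q| + 1 ≤ c) :
    ∃ E, GG T (kG Q N b c T n M ℓ) (lG Q c T n M) c E ∧ ∀ t x, E t x = PH Q N B f0 T E t x := by
  have hk := kG0 (Q := Q) (N := N) (c := c) hD hB hT
  have hl := lG0 (Q := Q) (c := c) (T := T) hD
  have hc : 0 ≤ c := le_trans (by positivity) hQ
  have hs : ∀ E, GG T (kG Q N b c T n M ℓ) (lG Q c T n M) c E → GG T (kG Q N b c T n M ℓ) (lG Q c T n M) c (PH Q N B f0 T E) :=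
    fun E => PH_mem hD hB hT hQ
  set k := kG Q N b c T n M ℓ with hkd
  set lam := lG Q c T n M with hld
  set μ := 2 * (cutK E2 Q * uG N b (k * exp (lam * T)) c T n ℓ) + 1 with hμ
  have hμ0 : 0 ≤ μ := by have := uG0 (N := N) (b := b) (L := k * exp (lam * T)) (c := c) (T := T) hD; positivity
  set X : ℕ → ℝ → E2 → E2 := fun j => (PH Q N B f0 T)^[j] (fun _ _ => 0) with hX
  have hXs : ∀ j, X (j + 1) = PH Q N B f0 T (X j) := fun j => Function.iterate_succ_apply' _ _ _
  have hG : ∀ j, GG T k lam c (X j) := by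
    intro j
    induction j with
    | zero => exact ⟨⟨continuous_const, fun t x y => by simp [hX]; positivity, fun t x => by simp [hX, hc]⟩,
        fun t x y => by simp [hX]; positivity⟩
    | succ j ih => rw [hXs]; exact hs _ ih
  have hst : ∀ j t x, ‖X j t x - X (j + 1) t x‖ ≤ c / 2 ^ j * exp (μ * cl T t) := by
    intro j
    induction j with
    | zero =>
      intro t x
      have h1 := (hG 1).g.bd t x
      have : 1 ≤ exp (μ * cl T t) := one_le_exp (mul_nonneg hμ0 (cl_mem hT t).1)
      simp only [hX, pow_zero, div_one] at h1 ⊢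
      simp only [Function.iterate_zero, id, zero_sub, norm_neg]
      exact h1.trans (le_mul_of_one_le_right hc this)
    | succ j ih =>
      intro t x
      have := PH_stab hD hB (hG j).g (hG (j + 1)).g hT (by positivity) hμ ih t x
      rw [← hXs, ← hXs] at this
      refine this.trans (le_of_eq ?_)
      rw [pow_succ]; field_simp
  have hdist : ∀ t x j, dist (X j t x) (X (j + 1) t x) ≤ (2 * (c * exp (μ * cl T t))) / 2 / 2 ^ j := by
    intro t x j
    rw [dist_eq_norm]
    exact (hst j t x).trans (le_of_eq (by ring))
  choose Y hY using fun t => fun x => cauchySeq_tendsto_of_complete (cauchySeq_of_le_geometric_two (hdist t x))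
  have hr : ∀ t x j, ‖X j t x - Y t x‖ ≤ 2 * c / 2 ^ j * exp (μ * cl T t) := by
    intro t x j
    rw [← dist_eq_norm]
    refine (dist_le_of_le_geometric_two_of_tendsto (hdist t x) (hY t x) j).trans (le_of_eq (by ring))
  have hp : ∀ a : ℝ, Tendsto (fun j : ℕ => a / 2 ^ j) atTop (𝓝 0) := fun a => by
    have := (tendsto_pow_atTop_nhds_zero_of_lt_one (r := (1/2 : ℝ)) (by norm_num) (by norm_num)).const_mul a
    simpa [div_eq_mul_inv] using this
  have hYG : GG T k lam c Y := by
    refine ⟨⟨?_, fun t x y => ?_, fun t x => ?_⟩, fun t x y => ?_⟩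
    · have hu : TendstoUniformly (fun j (q : ℝ × E2) => X j q.1 q.2) (fun q => Y q.1 q.2) atTop := by
        rw [Metric.tendstoUniformly_iff]
        intro e he
        have := (hp (2 * c * exp (μ * T))).eventually (gt_mem_nhds he)
        filter_upwards [this] with j hj q
        rw [dist_comm, dist_eq_norm]
        refine ((hr q.1 q.2 j).trans ?_).trans_lt hj
        rw [div_mul_eq_mul_div]
        have := (cl_mem hT q.1).2
        gcongr
      exact hu.continuous (Frequently.of_forall fun j => (hG j).g.cont)
    · exact le_of_tendsto ((hY t x).sub (hY t y)).norm (Eventually.of_forall fun j => (hG j).g.lip t x y)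
    · exact le_of_tendsto (hY t x).norm (Eventually.of_forall fun j => (hG j).g.bd t x)
    · exact le_of_tendsto ((hY t x).sub (hY t y)).norm (Eventually.of_forall fun j => (hG j).w t x y)
  refine ⟨Y, hYG, fun t x => ?_⟩
  have h1 : Tendsto (fun j => X (j + 1) t x) atTop (𝓝 (Y t x)) := (hY t x).comp (tendsto_add_atTop_nat 1)
  refine tendsto_nhds_unique h1 ?_
  rw [tendsto_iff_norm_sub_tendsto_zero]
  have h2 := (hp (c * exp (μ * cl T t)))
  refine squeeze_zero (fun _ => norm_nonneg _) (fun j => ?_) h2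
  rw [hXs]
  refine (PH_stab hD hB (hG j).g hYG.g hT (by positivity) hμ (fun t x => hr t x j) t x).trans (le_of_eq (by ring))

/-- field of the truncated problem, with derivative -/
lemma PH_C1 (hD : Data f0 n M ℓ) (hB : GoodB B DB b) (hT : 0 ≤ T)
    (hE : GG T (kG Q N b c T n M ℓ) (lG Q c T n M) c E) :
    ∃ D : ℝ → E2 → E2 →L[ℝ] E2, (∀ t x, HasFDerivAt (PH Q N B f0 T E t) (D t x) x) ∧ Continuous fun q : ℝ × E2 => D q.1 q.2 := by
  have hk := kG0 (Q := Q) (N := N) (c := c) hD hB hT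
  have hl := lG0 (Q := Q) (c := c) (T := T) hD
  have hK := K0_nonneg N hB.nonneg
  have hv := v3_nonneg (RR n c T)
  have hl0 := hD.l0
  have h2 := rc_lip (N := N) hD hB hE.g hT hk hl (fun τ hτ x y => by
      have := hE.w τ x y; rwa [cl_eq hτ] at this)
  obtain ⟨D, hD1, hD2⟩ := EE_C1 (ℓ := 2 * v3 (RR n c T) * ℓ * exp (K0 N b * T + kG Q N b c T n M ℓ * (exp (lG Q c T n M * T) - 1) / lG Q c T n M)) (rc_cont (N := N) hD hB hE.g hT) (rc_bd hD hB hE.g hT (fun τ _ => hE.g.bd τ))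
      (rc_supp hD hB hE.g hT (fun τ _ => hE.g.bd τ)) (by positivity) (fun t x y => (h2 t x y).trans (by
        have := (cl_mem hT t).2
        gcongr))
  refine ⟨fun t x => (fderiv ℝ (cut Q : E2 → E2) (EE 0 (rc N B f0 T E t) x)).comp (D t x), fun t x => ?_, ?_⟩
  · exact (((cut_contDiff Q).differentiable (by norm_num)).differentiableAt.hasFDerivAt).comp x (hD1 t x)
  · exact ((((cut_contDiff Q).continuous_fderiv (by norm_num))).comp (EErc_cont hD hB hE.g hT)).clm_comp hD2

end
end VP
end

section
set_option linter.all false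
namespace VP
open Set Filter Topology
section
variable {Q N : ℝ} {B : ℝ → E2 → E3} {DB : ℝ → E2 → E2 →L[ℝ] E3} {b : ℝ} {E E' : ℝ → E2 → E2} {L c c' T : ℝ}
  {f0 : Bool → Z → ℝ} {n M ℓ : ℝ}

lemma EErc_unif (hD : Data f0 n M ℓ) (hB : GoodB B DB b) (hE : GoodE E L c) (hT : 0 ≤ T) (T0 : ℝ) :
    ∀ᶠ t in 𝓝 T0, ∀ x, ‖EE 0 (rc N B f0 T E t) x - EE 0 (rc N B f0 T E T0) x‖ ≤ 1 := by
  set R := RR n c T with hR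
  have hJ : 0 ≤ JJ 1 + vR R := add_nonneg (JJ_nonneg (by norm_num)) (vR_nonneg R)
  set δ : ℝ := 1 / (2 * (JJ 1 + vR R) + 1) with hδ
  have hδ0 : 0 < δ := by positivity
  have hc := rc_cont (N := N) hD hB hE hT
  have b1 := rc_bd (N := N) hD hB hE hT (fun τ _ => hE.bd τ)
  have s1 := rc_supp (N := N) hD hB hE hT (fun τ _ => hE.bd τ)
  have c1 := rc_cont' (N := N) hD hB hE hT
  have h := (isCompact_closedBall (0:E2) R).eventually_forall_of_forall_eventually (x₀ := T0)
    (P := fun t y => |rc N B f0 T E t y - rc N B f0 T E T0 y| < δ) (fun y _ => by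
      have h1 : Continuous fun q : ℝ × E2 => |rc N B f0 T E q.1 q.2 - rc N B f0 T E T0 q.2| :=
        (hc.sub ((c1 T0).comp continuous_snd)).abs
      exact h1.continuousAt.eventually_lt_const (by simpa using hδ0))
  filter_upwards [h] with t ht x
  rw [EE_sub (c1 t) (b1 t) (s1 t) (c1 T0) (b1 T0) (s1 T0)]
  refine (EE_bound (m := δ) (R := R) ((c1 t).sub (c1 T0)) (fun y => ?_) (fun y hy => by
    rw [Pi.sub_apply, s1 t y hy, s1 T0 y hy, sub_zero]) 0 x).trans ?_
  · by_cases hy : ‖y‖ ≤ R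
    · exact (ht y (by simpa using hy)).le
    · rw [Pi.sub_apply, s1 t y (not_le.1 hy), s1 T0 y (not_le.1 hy), sub_zero, abs_zero]; exact hδ0.le
  · rw [hδ, mul_one_div, div_mul_eq_mul_div, div_le_one (by positivity)]; linarith

/-- Existence on `[0,T]`. -/
lemma exist (hD : Data f0 n M ℓ) (hB : GoodB B DB b) (hT : 0 ≤ T) :
    ∃ N E DE L c, Hy N B DB b E DE L c f0 n M ℓ ∧ (∀ t ∈ Icc 0 T, ∀ x, E t x = EE 0 (rho (ff N B f0 E t)) x) ∧
      n + AP n M T * T ≤ N := by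
  have hJ : 0 ≤ JJ 1 + vR (2 * n) := add_nonneg (JJ_nonneg (by norm_num)) (vR_nonneg _)
  set C0 := 2 * mm M (2 * n) * (JJ 1 + vR (2 * n)) with hC0
  have hC00 : 0 ≤ C0 := by have := hD.m0 (2 * n); positivity
  set Q := |AP n M T| + C0 + 1 with hQ
  have hQ0 : 0 ≤ Q := by positivity
  set N := n + |AP n M T| * T with hN
  obtain ⟨E, hG, hfix⟩ := PH_fix (Q := Q) (N := N) (c := |Q| + 1) hD hB hT le_rfl
  obtain ⟨DE, hd, hdc⟩ := PH_C1 hD hB hT hG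
  have hEP : E = PH Q N B f0 T E := by ext1 t; ext1 x; exact hfix t x
  rw [← hEP] at hd
  have H : Hy N B DB b E DE _ _ f0 n M ℓ := ⟨hD, hB, hG.g, hd, hdc⟩
  set W : ℝ → E2 → E2 := fun t x => EE 0 (rc N B f0 T E t) x with hW
  have hWc : Continuous fun q : ℝ × E2 => W q.1 q.2 := EErc_cont hD hB hG.g hT
  have hWE : ∀ t x, ‖W t x‖ ≤ Q → E t x = W t x := fun t x h => by rw [hfix, PH]; exact cut_eq h
  have hrc : ∀ t ∈ Icc 0 T, ∀ x, W t x = EE 0 (rho (ff N B f0 E t)) x := fun t ht x => by rw [hW]; simp only [rc, cl_eq ht]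
  set s : Set ℝ := {T0 | ∀ τ x, ‖W (min T0 (max τ 0)) x‖ ≤ Q} with hs
  have hcl : IsClosed s := by
    simp only [hs, setOf_forall]
    refine isClosed_iInter fun τ => isClosed_iInter fun x => isClosed_le ?_ continuous_const
    exact (hWc.comp (f := fun T0 : ℝ => (min T0 (max τ 0), x)) (by fun_prop)).norm
  have key : Icc 0 T ⊆ s := by
    refine IsClosed.Icc_subset_of_forall_mem_nhdsWithin (hcl.inter isClosed_Icc) ?_ ?_
    · intro τ x
      have e : RR n (|Q| + 1) 0 = 2 * n := by unfold RR; ring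
      have h0 : cl 0 0 = 0 := by simp [cl]
      have h1 : cl T 0 = 0 := cl_eq ⟨le_rfl, hT⟩
      have h2 := EE_bound (rc_cont' (N := N) hD hB hG.g le_rfl 0) (rc_bd hD hB hG.g le_rfl (fun τ _ => hG.g.bd τ) 0)
        (rc_supp hD hB hG.g le_rfl (fun τ _ => hG.g.bd τ) 0) 0 x
      rw [min_eq_left (le_max_right _ _)]
      simp only [rc, e, h0] at h2
      simp only [hW, rc, h1]
      refine h2.trans ?_
      have := abs_nonneg (AP n M T)
      linarith
    · rintro T0 ⟨hT0, h0, hlt⟩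
      have h1 : ∀ τ ∈ Icc 0 T0, ∀ x, ‖W τ x‖ ≤ Q := fun τ hτ x => by
        have := hT0 τ x; rwa [max_eq_left hτ.1, min_eq_right hτ.2] at this
      have h2 : ∀ x, ‖W T0 x‖ ≤ Q - 1 := fun x => by
        rw [← hWE T0 x (h1 T0 ⟨h0, le_rfl⟩ x)]
        refine (H.apriori hlt.le (fun t ht x => ?_) ⟨h0, le_rfl⟩ x).trans ((le_abs_self _).trans ?_)
        · rw [hWE t x (h1 t ht x), hrc t ⟨ht.1, ht.2.trans hlt.le⟩]
        · rw [hQ]; linarith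
      obtain ⟨e, he, hb⟩ := Metric.eventually_nhds_iff.1 (EErc_unif (N := N) hD hB hG.g hT T0)
      filter_upwards [inter_mem_nhdsWithin (Ioi T0) (Metric.ball_mem_nhds T0 he)] with T1 hT1 τ x
      obtain ⟨h3, h4⟩ := hT1
      rw [Metric.mem_ball, Real.dist_eq, abs_lt] at h4
      have h3' : T0 < T1 := h3
      by_cases hm : min T1 (max τ 0) ≤ T0
      · exact h1 _ ⟨le_min (h0.trans h3'.le) (le_max_right _ _), hm⟩ x
      · push Not at hm
        have h5 := hb (y := min T1 (max τ 0)) (by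
          rw [Real.dist_eq, abs_lt]; constructor <;> linarith [min_le_left T1 (max τ 0)]) x
        have h6 := norm_sub_norm_le (W (min T1 (max τ 0)) x) (W T0 x)
        have h7 : ‖W (min T1 (max τ 0)) x - W T0 x‖ ≤ 1 := h5
        linarith [h2 x]
  have hfin : ∀ t ∈ Icc 0 T, ∀ x, E t x = W t x := fun t ht x => hWE t x (by
    have := key ht t x; rwa [max_eq_left ht.1, min_eq_right le_rfl] at this)
  exact ⟨N, E, DE, _, _, H, fun t ht x => (hfin t ht x).trans (hrc t ht x), by
    rw [hN]; gcongr; exact le_abs_self _⟩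
end
end VP
end

section
set_option linter.all false
namespace VP
open Set Filter Topology

/-- classical solutions on `[0,T]` with uniformly bounded support -/
structure Sol (B : ℝ → E2 → E3) (T k : ℝ) (g : ℝ → Bool → Z → ℝ) (Dg : ℝ → Bool → Z → (ℝ × Z →L[ℝ] ℝ)) : Prop where
  hd : ∀ s, ∀ t ∈ Icc 0 T, ∀ z, HasFDerivWithinAt (fun q : ℝ × Z => g q.1 s q.2) (Dg t s z) (Icc 0 T ×ˢ univ) (t, z)
  hdc : ∀ s, ContinuousOn (fun q : ℝ × Z => Dg q.1 s q.2) (Icc 0 T ×ˢ univ)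
  nn : ∀ t ∈ Icc 0 T, ∀ s z, 0 ≤ g t s z
  sup : ∀ t ∈ Icc 0 T, ∀ s z, k < ‖z‖ → g t s z = 0
  pde : ∀ t ∈ Icc 0 T, ∀ s z, Dg t s z (1, piL z.2, sg s • (ioL (EE 0 (rho (g t)) z.1) + crossL z.2 (B t z.1))) = 0

section
variable {N : ℝ} {B : ℝ → E2 → E3} {DB : ℝ → E2 → E2 →L[ℝ] E3} {b : ℝ} {E E' : ℝ → E2 → E2} {L c c' T k k' : ℝ}
  {f0 : Bool → Z → ℝ} {n M ℓ : ℝ} {g g' : ℝ → Bool → Z → ℝ} {Dg Dg' : ℝ → Bool → Z → (ℝ × Z →L[ℝ] ℝ)} {t : ℝ}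

lemma Sol.sd (h : Sol B T k g Dg) (ht : t ∈ Icc 0 T) (s : Bool) (z : Z) :
    HasFDerivAt (g t s) ((Dg t s z).comp (ContinuousLinearMap.inr ℝ ℝ Z)) z := by
  have h1 := h.hd s t ht z
  have h2 : HasFDerivWithinAt (fun z : Z => (t, z)) (ContinuousLinearMap.inr ℝ ℝ Z) univ z := (hasFDerivAt_prodMk_right t z).hasFDerivWithinAt
  have h3 := HasFDerivWithinAt.comp (x := z) (t := Icc 0 T ×ˢ univ) h1 h2 (fun w _ => ⟨ht, mem_univ _⟩)
  exact hasFDerivWithinAt_univ.1 h3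

lemma Sol.sd0 (h : Sol B T k g Dg) (ht : t ∈ Icc 0 T) (s : Bool) {z : Z} (hz : g t s z = 0) (w : Z) : Dg t s z (0, w) = 0 := by
  have h1 : IsLocalMin (g t s) z := Eventually.of_forall fun y => by rw [hz]; exact h.nn t ht s y
  have h2 := h1.hasFDerivAt_eq_zero (h.sd ht s z)
  simpa using congrArg (fun D => D w) h2

lemma Sol.gc (h : Sol B T k g Dg) (hT : 0 ≤ T) (s : Bool) : Continuous fun q : ℝ × Z => g (cl T q.1) s q.2 := by
  have h1 : ContinuousOn (fun q : ℝ × Z => g q.1 s q.2) (Icc 0 T ×ˢ univ) := fun q hq => (h.hd s q.1 hq.1 q.2).continuousWithinAt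
  exact h1.comp_continuous (f := fun q : ℝ × Z => (cl T q.1, q.2)) (((cl_cont T).comp continuous_fst).prodMk continuous_snd)
    fun q => ⟨cl_mem hT _, mem_univ _⟩

lemma Sol.bdd (h : Sol B T k g Dg) (hT : 0 ≤ T) : ∃ m, 0 ≤ m ∧ (∀ t s z, |g (cl T t) s z| ≤ m) ∧
    (∀ t s z z', |g (cl T t) s z - g (cl T t) s z'| ≤ m * ‖z - z'‖) := by
  have hK : IsCompact (Icc 0 T ×ˢ Metric.closedBall (0:Z) k) := isCompact_Icc.prod (isCompact_closedBall _ _)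
  have h1 : ∀ s, ∃ m, ∀ q ∈ Icc 0 T ×ˢ Metric.closedBall (0:Z) k, ‖g (cl T q.1) s q.2‖ ≤ m := fun s =>
    hK.exists_bound_of_continuousOn (h.gc hT s).continuousOn
  have h2 : ∀ s, ∃ m, ∀ q ∈ Icc 0 T ×ˢ Metric.closedBall (0:Z) k, ‖Dg q.1 s q.2‖ ≤ m := fun s =>
    hK.exists_bound_of_continuousOn ((h.hdc s).mono (prod_mono subset_rfl (subset_univ _)))
  choose m1 hm1 using h1
  choose m2 hm2 using h2
  have hle : ∀ s, |m1 s| + |m2 s| ≤ |m1 true| + |m2 true| + |m1 false| + |m2 false| := by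
    have := abs_nonneg (m1 true); have := abs_nonneg (m2 true); have := abs_nonneg (m1 false); have := abs_nonneg (m2 false)
    intro s; cases s <;> linarith
  set m := |m1 true| + |m2 true| + |m1 false| + |m2 false| with hm
  have hm0 : 0 ≤ m := by positivity
  refine ⟨m, hm0, fun t s z => ?_, fun t s z z' => ?_⟩
  · have ht := cl_mem hT t
    by_cases hz : ‖z‖ ≤ k
    · have := hm1 s (cl T t, z) ⟨ht, by simpa using hz⟩
      rw [cl_eq ht, norm_eq_abs] at this
      linarith [hle s, le_abs_self (m1 s), abs_nonneg (m2 s)]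
    · rw [h.sup _ ht s z (not_le.1 hz), abs_zero]; exact hm0
  · have ht := cl_mem hT t
    refine convex_univ.norm_image_sub_le_of_norm_hasFDerivWithin_le (C := m)
      (fun z _ => (h.sd ht s z).hasFDerivWithinAt) (fun z _ => ?_) (mem_univ z') (mem_univ z)
    by_cases hz : ‖z‖ ≤ k
    · refine ContinuousLinearMap.opNorm_le_bound _ hm0 fun w => ?_
      have h3 := hm2 s (cl T t, z) ⟨ht, by simpa using hz⟩
      have h4 := (Dg (cl T t) s z).le_opNorm (0, w)
      have h5 : ‖((0:ℝ), w)‖ = ‖w‖ := by simp [Prod.norm_def]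
      rw [h5] at h4
      refine h4.trans ?_
      gcongr
      exact h3.trans (by linarith [hle s, le_abs_self (m2 s), abs_nonneg (m1 s)])
    · have : (Dg (cl T t) s z).comp (ContinuousLinearMap.inr ℝ ℝ Z) = 0 := by
        refine ContinuousLinearMap.ext fun w => ?_
        simpa using h.sd0 ht s (h.sup _ ht s z (not_le.1 hz)) w
      rw [this, norm_zero]; exact hm0

set_option maxHeartbeats 1000000 in
lemma Sol.hy (h : Sol B T k g Dg) (hT : 0 ≤ T) (hB : GoodB B DB b) (hD : Data (g 0) n M ℓ) :
    ∃ E DE L c, (∀ N, Hy N B DB b E DE L c (g 0) n M ℓ) ∧ ∀ N, k ≤ N →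
      (∀ t ∈ Icc 0 T, g t = ff N B (g 0) E t) ∧ (∀ τ x, E τ x = EE 0 (rc N B (g 0) T E τ) x) := by
  obtain ⟨m, hm0, hm1, hm2⟩ := h.bdd hT
  have hv := v3_nonneg k
  have gc1 : ∀ t s, Continuous (g (cl T t) s) := fun t s => (h.gc hT s).comp (f := fun z : Z => (t, z)) (by fun_prop)
  have gs : ∀ t s z, k < ‖z‖ → g (cl T t) s z = 0 := fun t => h.sup _ (cl_mem hT t)
  set r : ℝ → E2 → ℝ := fun t => rho (g (cl T t)) with hr
  have rcn : Continuous fun q : ℝ × E2 => r q.1 q.2 := rho_cont (f := fun t => g (cl T t)) (h.gc hT) gs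
  have rc1 : ∀ t, Continuous (r t) := fun t => rcn.comp (f := fun z : E2 => (t, z)) (by fun_prop)
  have rs : ∀ t y, k < ‖y‖ → r t y = 0 := fun t => rho_supp (gs t)
  have rb : ∀ t y, |r t y| ≤ 2 * m * v3 k := by
    intro t y
    have := rho_sub (f := g (cl T t)) (g := fun _ _ => 0) (R := k) (δ := m) (x := y) (y := y) (gc1 t) (fun s => continuous_const)
      (gs t) (fun _ _ _ => rfl) (fun s p => by rw [sub_zero]; exact hm1 t s _)
    simpa [rho, hr] using this
  have rl : ∀ t x y, |r t x - r t y| ≤ 2 * m * v3 k * ‖x - y‖ := by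
    intro t x y
    have := rho_sub (f := g (cl T t)) (g := g (cl T t)) (R := k) (δ := m * ‖x - y‖) (x := x) (y := y) (gc1 t) (gc1 t)
      (gs t) (gs t) (fun s p => by have := hm2 t s (x, p) (y, p); simpa [Prod.norm_def] using this)
    exact this.trans (le_of_eq (by ring))
  set E : ℝ → E2 → E2 := fun t => EE 0 (r t) with hE
  obtain ⟨DE, hd, hdc⟩ := EE_C1 rcn rb rs (by positivity) rl
  have hGE : GoodE E (CK k * (2 * m * v3 k * rexp (-0) + 2 * m * v3 k * (1 + 0))) (2 * (2 * m * v3 k) * (JJ 1 + vR k)) :=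
    ⟨EE_cont rcn rb rs, fun t x y => EE_lip (rc1 t) (rb t) (rs t) (by positivity) (rl t) le_rfl x y,
      fun t x => EE_bound (rc1 t) (rb t) (rs t) 0 x⟩
  refine ⟨E, DE, _, _, fun N => ⟨hD, hB, hGE, hd, hdc⟩, fun N hN => ?_⟩
  have hff : ∀ t ∈ Icc 0 T, g t = ff N B (g 0) E t := by
    intro t ht
    ext1 s; ext1 z
    have hV := VF_Lip (N := N) hB hGE (sg_abs s)
    set V := VF N B E (sg s) with hVd
    have hc : ∀ u ∈ Icc 0 t, (fun u => g u s (flow V u t z)) u = (fun u => g u s (flow V u t z)) 0 := by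
      have hder : ∀ u ∈ Icc 0 t, HasDerivWithinAt (fun u => g u s (flow V u t z)) 0 (Icc 0 t) u := by
        intro u hu
        have hu' : u ∈ Icc 0 T := ⟨hu.1, hu.2.trans ht.2⟩
        have h1 : HasDerivWithinAt (fun r => (r, flow V r t z)) ((1 : ℝ), V u (flow V u t z)) (Icc 0 t) u :=
          ((hasDerivAt_id u).prodMk (flow_deriv hV t z u)).hasDerivWithinAt
        have hmt : MapsTo (fun r => (r, flow V r t z)) (Icc 0 t) (Icc 0 T ×ˢ univ) := fun r hr => ⟨⟨hr.1, hr.2.trans ht.2⟩, mem_univ _⟩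
        have h2 := (h.hd s u hu' (flow V u t z)).comp_hasDerivWithinAt u h1 hmt
        refine h2.congr_deriv ?_
        set w := flow V u t z with hw
        have hp := h.pde u hu' s w
        have hEu : E u w.1 = EE 0 (rho (g u)) w.1 := by simp only [hE, hr, cl_eq hu']
        by_cases hz : g u s w = 0
        · have e : ((1:ℝ), V u w) = (1, piL w.2, sg s • (ioL (EE 0 (rho (g u)) w.1) + crossL w.2 (B u w.1))) +
              (0, V u w - (piL w.2, sg s • (ioL (EE 0 (rho (g u)) w.1) + crossL w.2 (B u w.1)))) := by
            simp only [Prod.mk_add_mk, add_zero, add_sub_cancel]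
          rw [e, map_add, hp, h.sd0 hu' s hz, add_zero]
        · have hwk : ‖w.2‖ ≤ N := by
            by_contra hc
            exact hz (h.sup u hu' s w (hN.trans_lt ((not_le.1 hc).trans_le (norm_snd_le w))))
          rw [← hp, hVd, VF, cut_eq hwk, hEu]
      refine constant_of_has_deriv_right_zero (fun u hu => (hder u hu).continuousWithinAt) (fun u hu => ?_)
      have h3 := hder u ⟨hu.1, hu.2.le⟩
      exact (h3.mono (Icc_subset_Icc_left hu.1)).mono_of_mem_nhdsWithin (Icc_mem_nhdsGE hu.2)
    have := hc t ⟨ht.1, le_rfl⟩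
    simp only [flow_self hV] at this
    exact this
  refine ⟨hff, fun τ x => ?_⟩
  rw [rc, ← hff _ (cl_mem hT τ)]

lemma GoodE.mono {L' c' : ℝ} (h : GoodE E L c) (hL : L ≤ L') (hc : c ≤ c') : GoodE E L' c' :=
  ⟨h.cont, fun t x y => (h.lip t x y).trans (by gcongr), fun t x => (h.bd t x).trans hc⟩

lemma Sol.unique (h : Sol B T k g Dg) (h' : Sol B T k' g' Dg') (hT : 0 ≤ T) (hB : GoodB B DB b) (hD : Data (g 0) n M ℓ) (h0 : g' 0 = g 0)
    {t : ℝ} (ht : t ∈ Icc 0 T) : g t = g' t := by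
  obtain ⟨E, DE, L, c, H, H1⟩ := h.hy hT hB hD
  obtain ⟨E', DE', L', c', H', H1'⟩ := h'.hy hT hB (by rw [h0]; exact hD)
  rw [h0] at H' H1'
  set N := max k k' with hN
  obtain ⟨h1, h2⟩ := H1 N (le_max_left _ _)
  obtain ⟨h1', h2'⟩ := H1' N (le_max_right _ _)
  have G := (H N).hE.mono (le_max_left L L') (le_max_left c c')
  have G' := (H' N).hE.mono (le_max_right L L') (le_max_right c c')
  set L1 := max L L'
  set C := max c c'
  have hC : 0 ≤ C := (norm_nonneg _).trans (G.bd 0 0)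
  have hu := uG0 (N := N) (b := b) (L := L1) (c := C) (T := T) hD
  set μ := 2 * uG N b L1 C T n ℓ + 1 with hμ
  have hμ0 : 0 < μ := by positivity
  have key : ∀ j : ℕ, ∀ τ x, ‖E τ x - E' τ x‖ ≤ 2 * C / 2 ^ j * exp (μ * cl T τ) := by
    intro j
    induction j with
    | zero =>
      intro τ x
      have h3 := norm_sub_le (E τ x) (E' τ x)
      have h4 := G.bd τ x
      have h5 := G'.bd τ x
      have h6 : 1 ≤ exp (μ * cl T τ) := one_le_exp (mul_nonneg hμ0.le (cl_mem hT τ).1)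
      have h7 := le_mul_of_one_le_right (show 0 ≤ 2 * C by positivity) h6
      rw [pow_zero, div_one]; linarith
    | succ j ih =>
      intro τ x
      rw [h2, h2']
      refine (field_stab (D := 2 * C / 2 ^ j) hD hB G G' hT (by positivity) hμ0 (fun τ hτ x => by
        have := ih τ x; rwa [cl_eq hτ] at this) τ x).trans ?_
      change uG N b L1 C T n ℓ / μ * _ ≤ _
      have e : uG N b L1 C T n ℓ / μ ≤ 1 / 2 := by
        rw [div_le_div_iff₀ hμ0 two_pos, hμ]; linarith
      calc _ ≤ 1 / 2 * (2 * C / 2 ^ j * exp (μ * cl T τ)) := by gcongr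
        _ = _ := by rw [pow_succ]; field_simp
  have hp : ∀ a d : ℝ, Tendsto (fun j : ℕ => a / 2 ^ j * d) atTop (𝓝 0) := fun a d => by
    have := (tendsto_pow_atTop_nhds_zero_of_lt_one (r := (1/2 : ℝ)) (by norm_num) (by norm_num)).const_mul (a * d)
    rw [mul_zero] at this
    refine this.congr fun j => ?_
    simp only [one_div, inv_pow]; ring
  have hEE : E = E' := by
    ext1 τ; ext1 x
    have := ge_of_tendsto (hp (2 * C) (exp (μ * cl T τ))) (Eventually.of_forall fun j => key j τ x)
    exact sub_eq_zero.1 (norm_le_zero_iff.1 this)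
  rw [h1 t ht, h1' t ht, hEE]

lemma Sol.apriori {T1 : ℝ} (h : Sol B T k g Dg) (hT : 0 ≤ T) (hT1 : T ≤ T1) (hB : GoodB B DB b) (hD : Data (g 0) n M ℓ)
    {t : ℝ} (ht : t ∈ Icc 0 T) (s : Bool) (z : Z) (hz : RR n |AP n M T1| T1 < ‖z‖) : g t s z = 0 := by
  obtain ⟨E, DE, L, c, H, H1⟩ := h.hy hT hB hD
  obtain ⟨h1, h2⟩ := H1 k le_rfl
  have h3 : ∀ τ ∈ Icc 0 T, ∀ x, ‖E τ x‖ ≤ |AP n M T1| := fun τ hτ x =>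
    ((H k).apriori hT1 (fun t ht x => by have := h2 t x; rwa [rc, cl_eq ht] at this) hτ x).trans (le_abs_self _)
  have := ff_supp' (N := k) hD hB (H k).hE hT h3 t s z (lt_of_le_of_lt (by
    have := hD.n0
    have : 0 ≤ T1 := hT.trans hT1
    unfold RR; gcongr) hz)
  rwa [cl_eq ht, ← h1 t ht] at this

/-- The solution constructed by `exist` is a `Sol`. -/
lemma existSol (hD : Data f0 n M ℓ) (hB : GoodB B DB b) (hT : 0 ≤ T) :
    ∃ g k, Sol B T k g (fun t s z => fderiv ℝ (fun q : ℝ × Z => g q.1 s q.2) (t, z)) ∧ g 0 = f0 ∧ (∀ s, ContDiff ℝ 1 fun q : ℝ × Z => g q.1 s q.2) ∧ ∀ s t z, 0 ≤ g t s z := by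
  obtain ⟨N, E, DE, L, c, H, hsc, hN⟩ := exist hD hB hT
  have hap : ∀ τ ∈ Icc 0 T, ∀ x, ‖E τ x‖ ≤ AP n M T := fun τ hτ x => H.apriori le_rfl hsc hτ x
  have hc1 : ∀ s, ContDiff ℝ 1 fun q : ℝ × Z => ff N B f0 E q.1 s q.2 := fun s => (hD.c1 s).comp (iflow_contDiff (H.vf s))
  have hnn : ∀ s t z, 0 ≤ ff N B f0 E t s z := fun s t z => hD.nn _ _
  have hA0 : 0 ≤ AP n M T := (norm_nonneg _).trans (hap 0 ⟨le_rfl, hT⟩ 0)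
  refine ⟨ff N B f0 E, RR n (AP n M T) T, ⟨?_, ?_, ?_, ?_, ?_⟩, ?_, hc1, hnn⟩
  · exact fun s t ht z => ((hc1 s).differentiable one_ne_zero (t, z)).hasFDerivAt.hasFDerivWithinAt
  · exact fun s => ((hc1 s).continuous_fderiv one_ne_zero).continuousOn
  · exact fun t ht s z => hnn s t z
  · intro t ht s z hz
    have := ff_supp' (N := N) hD hB H.hE hT hap t s z hz
    rwa [cl_eq ht] at this
  · intro t ht s z
    by_cases hz : ff N B f0 E t s z = 0
    · have : IsLocalMin (fun q : ℝ × Z => ff N B f0 E q.1 s q.2) (t, z) := Eventually.of_forall fun y => by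
        simp only [hz]; exact hnn _ _ _
      rw [this.fderiv_eq_zero]; rfl
    · have h1 := (ff_supp hD hB H.hE ht.1 (fun τ hτ => hap τ ⟨hτ.1, hτ.2.trans ht.2⟩) hz).2
      have h2 : ‖z.2‖ ≤ N := h1.trans (le_trans (by have := ht.2; gcongr) hN)
      have h3 := transport (H.vf s) (hD.c1 s) (t, z)
      simp only [VF, cut_eq h2, hsc t ht] at h3
      exact h3
  · ext1 s; ext1 z
    rw [ff, flow_self (VF_Lip hB H.hE (sg_abs s))]
end
end VP
end

section
set_option linter.all false
namespace VP
open Set Filter Topology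

lemma baire {T : ℝ} {F : ℕ → Set ℝ} (hT : 0 ≤ T) (hc : ∀ n, IsClosed (F n)) (hm : Monotone F) (hu : Icc 0 T ⊆ ⋃ n, F n)
    (hP : ∀ n, ∃ m, ∀ s ∈ Icc 0 T, ∀ t ∈ Icc 0 T, s ∈ F n → (∃ k, uIcc s t ⊆ F k) → t ∈ F m) : ∃ k, Icc 0 T ⊆ F k := by
  set O : Set ℝ := {t | ∃ k, ∀ᶠ τ in 𝓝 t, τ ∈ Icc 0 T → τ ∈ F k} with hO
  have hOo : IsOpen O := by
    rw [isOpen_iff_mem_nhds]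
    rintro t ⟨k, hk⟩
    filter_upwards [hk.eventually_nhds] with τ hτ
    exact ⟨k, hτ⟩
  have hcpt : ∀ C : Set ℝ, IsCompact C → C ⊆ Icc 0 T → C ⊆ O → ∃ k, C ⊆ F k := by
    intro C hC hCI hCO
    refine hC.induction_on (p := fun C => ∃ k, C ∩ Icc 0 T ⊆ F k) ⟨0, by simp⟩ ?_ ?_ ?_ |>.imp fun k hk x hx => hk ⟨hx, hCI hx⟩
    · rintro s t hst ⟨k, hk⟩; exact ⟨k, (inter_subset_inter_left _ hst).trans hk⟩
    · rintro s t ⟨k, hk⟩ ⟨k', hk'⟩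
      refine ⟨max k k', ?_⟩
      rintro x ⟨hx | hx, hx'⟩
      · exact hm (le_max_left _ _) (hk ⟨hx, hx'⟩)
      · exact hm (le_max_right _ _) (hk' ⟨hx, hx'⟩)
    · intro x hx
      obtain ⟨k, hk⟩ := hCO hx
      exact ⟨_, mem_nhdsWithin_of_mem_nhds hk, k, fun y hy => hy.1 hy.2⟩
  set K := Icc 0 T \ O with hK
  have hKc : IsClosed K := isClosed_Icc.sdiff hOo
  by_cases hne : K = ∅
  · exact hcpt _ isCompact_Icc subset_rfl (diff_eq_empty.1 hne)
  exfalso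
  have : Nonempty K := (nonempty_iff_ne_empty.2 hne).to_subtype
  have : CompleteSpace K := hKc.completeSpace_coe
  obtain ⟨n, ⟨x0, hx0⟩, hx⟩ := nonempty_interior_of_iUnion_of_closed (X := K) (f := fun n => Subtype.val ⁻¹' F n)
    (fun n => (hc n).preimage continuous_subtype_val) (by
      rw [← preimage_iUnion]
      exact preimage_eq_univ_iff.2 (by rw [Subtype.range_coe]; exact diff_subset.trans hu))
  rw [mem_interior_iff_mem_nhds, mem_nhds_induced] at hx
  obtain ⟨U, hU, hUs⟩ := hx
  obtain ⟨r, hr, hrU⟩ := Metric.mem_nhds_iff.1 hU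
  have hUF : ∀ y ∈ K, y ∈ Metric.ball x0 r → y ∈ F n := fun y hy hyr => hUs (a := ⟨y, hy⟩) (hrU hyr)
  obtain ⟨m, hPm⟩ := hP n
  refine hx0.2 ⟨max m n, ?_⟩
  filter_upwards [Metric.ball_mem_nhds x0 hr] with t htb ht
  by_cases htK : t ∈ K
  · exact hm (le_max_right _ _) (hUF t htK htb)
  have hA : IsCompact (K ∩ uIcc x0 t) := isCompact_uIcc.inter_left hKc
  obtain ⟨a, ⟨haK, hau⟩, hmin⟩ := hA.exists_isMinOn ⟨x0, hx0, left_mem_uIcc⟩ (f := fun y => |y - t|) (by fun_prop)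
  have hab : a ∈ Metric.ball x0 r := by
    have := abs_sub_left_of_mem_uIcc hau
    rw [Metric.mem_ball, Real.dist_eq] at *
    exact this.trans_lt htb
  have haF := hUF a haK hab
  have haI : a ∈ Icc 0 T := haK.1
  have hsub : uIcc a t ⊆ Icc 0 T := ordConnected_Icc.uIcc_subset haI ht
  obtain ⟨j, hj⟩ := mem_iUnion.1 (hu ht)
  obtain ⟨m', hm'⟩ := hP j
  refine hm (le_max_left _ _) (hPm a haI t ht haF ⟨max m' n, fun τ hτ => ?_⟩)
  by_cases hτa : τ = a
  · rw [hτa]; exact hm (le_max_right _ _) haF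
  refine hm (le_max_left _ _) (hm' t ht τ (hsub hτ) hj (hcpt _ isCompact_uIcc ?_ ?_))
  · exact ordConnected_Icc.uIcc_subset ht (hsub hτ)
  · intro y hy
    by_contra hyO
    have hyI : y ∈ Icc 0 T := ordConnected_Icc.uIcc_subset ht (hsub hτ) hy
    have hy1 : y ∈ uIcc a t := uIcc_subset_uIcc right_mem_uIcc hτ hy
    have h1 : |a - t| ≤ |y - t| := hmin ⟨⟨hyI, hyO⟩, uIcc_subset_uIcc hau right_mem_uIcc hy1⟩
    apply hτa
    rcases le_total a t with h | h
    · rw [uIcc_of_le h] at hτ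
      rw [uIcc_of_ge hτ.2] at hy
      rw [abs_of_nonpos (by linarith), abs_of_nonpos (by linarith [hy.2])] at h1
      linarith [hτ.1, hy.1]
    · rw [uIcc_of_ge h] at hτ
      rw [uIcc_of_le hτ.1] at hy
      rw [abs_of_nonneg (by linarith), abs_of_nonneg (by linarith [hy.1])] at h1
      linarith [hτ.2, hy.2]

def lamL : (E2 →L[ℝ] E3) →L[ℝ] E3 := LinearMap.toContinuousLinearMap
  { toFun := fun D => e3 (D (EuclideanSpace.single 1 1) 2) (-(D (EuclideanSpace.single 0 1) 2))
      (D (EuclideanSpace.single 0 1) 1 - D (EuclideanSpace.single 1 1) 0)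
    map_add' := fun D D' => by
      apply ext3 <;> simp only [e3_0, e3_1, e3_2, PiLp.add_apply, ContinuousLinearMap.add_apply] <;> ring
    map_smul' := fun c D => by
      apply ext3 <;> simp only [e3_0, e3_1, e3_2, PiLp.smul_apply, ContinuousLinearMap.smul_apply, smul_eq_mul, RingHom.id_apply] <;> ring }

lemma curl_eq {A : E2 → E3} (hA : Differentiable ℝ A) (x : E2) : curl2 A x = lamL (fderiv ℝ A x) := by
  have h : ∀ i j, pd (fun y => A y i) j x = fderiv ℝ A x (EuclideanSpace.single j 1) i := by
    intro i j
    have := (EuclideanSpace.proj (𝕜 := ℝ) i : E3 →L[ℝ] ℝ).hasFDerivAt.comp x (hA x).hasFDerivAt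
    rw [pd]
    have h2 : fderiv ℝ (fun y => A y i) x = _ := this.fderiv
    rw [h2]; rfl
  rw [curl2, h, h, h, h]; rfl

lemma goodB {A : ℝ → E2 → E3} (hA : IsAdmissiblePotential A) : ∃ DB b, GoodB (fun t => curl2 (A (max t 0))) DB b := by
  obtain ⟨h1, h2, C, h3⟩ := hA
  have hd : ∀ t, Differentiable ℝ (A t) := fun t => (h1 t).differentiable two_ne_zero
  have hd2 : ∀ t, Differentiable ℝ (fderiv ℝ (A t)) := fun t => ((h1 t).fderiv_right (m := 1) (by norm_num)).differentiable one_ne_zero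
  have c1 : Continuous fun q : ℝ × E2 => fderiv ℝ (A q.1) q.2 := by
    rw [continuous_clm_apply]
    intro v
    have := (ContinuousMultilinearMap.apply ℝ (fun _ : Fin 1 => E2) E3 ![v]).continuous.comp (h2 1 (by norm_num))
    refine this.congr fun q => ?_
    simp [ContinuousMultilinearMap.apply, iteratedFDeriv_one_apply]
  have c2 : Continuous fun q : ℝ × E2 => fderiv ℝ (fderiv ℝ (A q.1)) q.2 := by
    rw [continuous_clm_apply]
    intro v
    rw [continuous_clm_apply]
    intro w
    have := (ContinuousMultilinearMap.apply ℝ (fun _ : Fin 2 => E2) E3 ![v, w]).continuous.comp (h2 2 (by norm_num))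
    refine this.congr fun q => ?_
    simp [ContinuousMultilinearMap.apply, iteratedFDeriv_two_apply]
  have hm : Continuous fun q : ℝ × E2 => (max q.1 0, q.2) := by fun_prop
  have e : (fun t => curl2 (A (max t 0))) = fun t x => lamL (fderiv ℝ (A (max t 0)) x) := by
    ext1 t; ext1 x; exact curl_eq (hd _) x
  rw [e]
  refine ⟨fun t x => lamL.comp (fderiv ℝ (fderiv ℝ (A (max t 0))) x), ‖lamL‖ * C, ⟨?_, ?_, ?_, ?_, ?_⟩⟩
  · exact lamL.continuous.comp (c1.comp hm)
  · exact fun t x => lamL.hasFDerivAt.comp x (hd2 _ x).hasFDerivAt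
  · exact continuous_const.clm_comp (c2.comp hm)
  · intro t x
    refine (lamL.le_opNorm _).trans (mul_le_mul_of_nonneg_left ?_ (norm_nonneg _))
    rw [← norm_iteratedFDeriv_one]; exact h3 _ (le_max_right _ _) x 1 (by norm_num)
  · intro t x
    refine (lamL.opNorm_comp_le _).trans (mul_le_mul_of_nonneg_left ?_ (norm_nonneg _))
    rw [← norm_iteratedFDeriv_one, norm_iteratedFDeriv_fderiv]; exact h3 _ (le_max_right _ _) x 2 (by norm_num)

lemma GoodB.win {B DB b} (h : GoodB B DB b) {η : ℝ} (hη : |η| = 1) (a : ℝ) :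
    GoodB (fun τ x => η • B (a + η * τ) x) (fun τ x => η • DB (a + η * τ) x) b := by
  have hm : Continuous fun q : ℝ × E2 => (a + η * q.1, q.2) := by fun_prop
  refine ⟨(h.cont.comp hm).const_smul η, fun t x => (h.hd _ x).const_smul η, (h.hdc.comp hm).const_smul η, fun t x => ?_, fun t x => ?_⟩
  · rw [norm_smul, norm_eq_abs, hη, one_mul]; exact h.bd _ _
  · rw [norm_smul, norm_eq_abs, hη, one_mul]; exact h.dbd _ _

def GB (fp fm : ℝ × E2 × E3 → ℝ) (s : Bool) : ℝ × E2 × E3 → ℝ := cond s fp fm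

lemma force_eq {fp fm : ℝ × E2 × E3 → ℝ} {t m R : ℝ} {r : E2 → ℝ} (hr : ∀ y, chargeDensity fp fm t y = r y) (hu : Continuous r) (hub : ∀ y, |r y| ≤ m)
    (hus : ∀ y, R < ‖y‖ → r y = 0) (B : ℝ → E2 → E3) (σ : ℝ) (x : E2) (p : E3) :
    force fp fm B σ t x p = σ • (ioL (EE 0 r x) + crossL p (B t x)) := by
  have h1 : potential fp fm t = fun x => -∫ y, r y • LL 0 (x - y) := by
    ext1 x
    simp only [potential, hr, LL_zero, smul_eq_mul]
    rw [← integral_const_mul, ← integral_neg]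
    congr 1; ext1 y; ring
  have h2 : ∀ i, -(pd (potential fp fm t) i x) = EE 0 r x i := by
    intro i
    have h3 : HasFDerivAt (fun x => -∫ y, r y • LL 0 (x - y)) (-(innerSL ℝ (EE 0 r x))) x := (pot_deriv hu hub hus x).neg
    rw [pd, h1, h3.fderiv]
    simp [EuclideanSpace.inner_single_right]
  rw [force, h2, h2]; rfl
end VP
end

section
set_option linter.all false
namespace VP
open Set Filter Topology

lemma S_ud : UniqueDiffOn ℝ S := by
  have : S = Ici (0:ℝ) ×ˢ (univ : Set (E2 × E3)) := by ext z; simp [S]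
  rw [this]; exact (uniqueDiffOn_Ici 0).prod uniqueDiffOn_univ

/-- Lift of `(τ,x,p) ↦ (η τ, x, η p)` -/
def PhL (η : ℝ) : ℝ × Z →L[ℝ] ℝ × E2 × E3 :=
  (η • ContinuousLinearMap.fst ℝ ℝ Z).prod (((ContinuousLinearMap.fst ℝ E2 E3).comp (ContinuousLinearMap.snd ℝ ℝ Z)).prod
    (η • ((ContinuousLinearMap.snd ℝ E2 E3).comp (ContinuousLinearMap.snd ℝ ℝ Z))))

lemma PhL_apply (η : ℝ) (q : ℝ × Z) : PhL η q = (η * q.1, q.2.1, η • q.2.2) := rfl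

section
variable {B B' : ℝ → E2 → E3} {gp gm : ℝ × E2 × E3 → ℝ} {η a T k : ℝ}

lemma cls_cont (hg : IsClassicalSolution B gp gm) (s : Bool) : ContinuousOn (GB gp gm s) S := by
  cases s
  · exact hg.smooth_m.continuousOn
  · exact hg.smooth_p.continuousOn
lemma cls_C1 (hg : IsClassicalSolution B gp gm) (s : Bool) : ContDiffOn ℝ 1 (GB gp gm s) S := by
  cases s
  · exact hg.smooth_m
  · exact hg.smooth_p
lemma cls_nn (hg : IsClassicalSolution B gp gm) (s : Bool) (z) (hz : z ∈ S) : 0 ≤ GB gp gm s z := by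
  cases s
  · exact hg.nonneg_m z hz
  · exact hg.nonneg_p z hz
lemma cls_pde (hg : IsClassicalSolution B gp gm) (s : Bool) (t : ℝ) (ht : 0 ≤ t) (x : E2) (p : E3) :
    fderivWithin ℝ (GB gp gm s) S (t, x, p) (1, piL p, force gp gm B (sg s) t x p) = 0 := by
  cases s
  · exact hg.vlasov_m t ht x p
  · exact hg.vlasov_p t ht x p

lemma cls_bd (hg : IsClassicalSolution B gp gm) (T k : ℝ) : ∃ M, ∀ t ∈ Icc 0 T, ∀ s, ∀ z : Z, ‖z‖ ≤ k → GB gp gm s (t, z) ≤ M := by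
  have hK : IsCompact (Icc 0 T ×ˢ Metric.closedBall (0:Z) k) := isCompact_Icc.prod (isCompact_closedBall _ _)
  have h1 : ∀ s, ∃ m, ∀ q ∈ Icc 0 T ×ˢ Metric.closedBall (0:Z) k, ‖GB gp gm s q‖ ≤ m := fun s =>
    hK.exists_bound_of_continuousOn ((cls_cont hg s).mono fun q hq => hq.1.1)
  choose m hm using h1
  refine ⟨max (m true) (m false), fun t ht s z hz => ?_⟩
  have := (le_abs_self _).trans (hm s (t, z) ⟨ht, by simpa using hz⟩)
  cases s
  · exact this.trans (le_max_right _ _)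
  · exact this.trans (le_max_left _ _)

lemma cls_force (hg : IsClassicalSolution B gp gm) {t : ℝ} (ht : 0 ≤ t) (hk : ∀ s, ∀ z : Z, k < ‖z‖ → GB gp gm s (t, z) = 0)
    (σ : ℝ) (x : E2) (p : E3) :
    force gp gm B σ t x p = σ • (ioL (EE 0 (rho fun s z => GB gp gm s (t, z)) x) + crossL p (B t x)) := by
  obtain ⟨M, hM⟩ := cls_bd hg t k
  have hc : ∀ s, Continuous fun z : Z => GB gp gm s (t, z) := fun s =>
    (cls_cont hg s).comp_continuous (f := fun z : Z => (t, z)) (by fun_prop) fun z => ht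
  have hb : ∀ s (z : Z), |GB gp gm s (t, z)| ≤ |M| := by
    intro s z
    rw [abs_of_nonneg (cls_nn hg s (t, z) ht)]
    by_cases hz : ‖z‖ ≤ k
    · exact (hM t ⟨ht, le_rfl⟩ s z hz).trans (le_abs_self _)
    · rw [hk s z (not_le.1 hz)]; exact abs_nonneg _
  refine force_eq (r := rho fun s z => GB gp gm s (t, z)) (m := 2 * |M| * v3 k) (R := k) (fun y => rfl) ?_ (fun y => ?_) (fun y => rho_supp hk y) B σ x p
  · have := rho_cont (X := Unit) (f := fun _ s (z : Z) => GB gp gm s (t, z)) (fun s => (hc s).comp continuous_snd) (fun _ => hk)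
    exact this.comp (f := fun y : E2 => ((), y)) (by fun_prop)
  · have := rho_sub (f := fun s (z : Z) => GB gp gm s (t, z)) (g := fun _ _ => 0) (R := k) (δ := |M|) (x := y) (y := y) hc
      (fun s => continuous_const) hk (fun _ _ _ => rfl) (fun s p => by rw [sub_zero]; exact hb s _)
    simpa [rho] using this

lemma nrm_refl (hη : |η| = 1) (z : Z) : ‖((z.1, η • z.2) : Z)‖ = ‖z‖ := by
  simp [Prod.norm_def, norm_smul, hη]

lemma toSol (hg : IsClassicalSolution B gp gm) (hη : η = 1 ∨ η = -1) (ha : ∀ τ ∈ Icc 0 T, 0 ≤ a + η * τ)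
    (hk : ∀ τ ∈ Icc 0 T, ∀ s, ∀ z : Z, k < ‖z‖ → GB gp gm s (a + η * τ, z) = 0)
    (hB : ∀ τ ∈ Icc 0 T, ∀ x, B' τ x = η • B (a + η * τ) x) :
    ∃ Dg, Sol B' T k (fun τ s z => GB gp gm s (a + η * τ, z.1, η • z.2)) Dg := by
  have hη1 : |η| = 1 := by rcases hη with h | h <;> simp [h]
  have hη2 : η * η = 1 := by rcases hη with h | h <;> simp [h]
  set φ : ℝ × Z → ℝ × E2 × E3 := fun q => (a, 0, 0) + PhL η q with hφ
  have hφe : ∀ q, φ q = (a + η * q.1, q.2.1, η • q.2.2) := fun q => by simp [hφ, PhL_apply]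
  have hmaps : MapsTo φ (Icc 0 T ×ˢ univ) S := fun q hq => by rw [hφe]; exact ha _ hq.1
  have hgφ : ∀ s, (fun q : ℝ × Z => GB gp gm s (a + η * q.1, q.2.1, η • q.2.2)) = GB gp gm s ∘ φ := fun s => by
    ext1 q; rw [Function.comp, hφe]
  refine ⟨fun τ s z => (fderivWithin ℝ (GB gp gm s) S (φ (τ, z))).comp (PhL η), ⟨?_, ?_, ?_, ?_, ?_⟩⟩
  · intro s t ht z
    rw [hgφ]
    have h1 : HasFDerivWithinAt φ (PhL η) (Icc 0 T ×ˢ univ) (t, z) := ((PhL η).hasFDerivAt.const_add _).hasFDerivWithinAt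
    have h2 := (((cls_C1 hg s).differentiableOn one_ne_zero) (φ (t, z)) (hmaps ⟨ht, mem_univ _⟩)).hasFDerivWithinAt
    exact h2.comp (t, z) h1 hmaps
  · intro s
    have h1 := (cls_C1 hg s).continuousOn_fderivWithin S_ud le_rfl
    have h2 : ContinuousOn φ (Icc 0 T ×ˢ univ) := (continuous_const.add (PhL η).continuous).continuousOn
    exact (h1.comp h2 hmaps).clm_comp continuousOn_const
  · exact fun t ht s z => cls_nn hg s _ (ha t ht)
  · exact fun t ht s z hz => hk t ht s (z.1, η • z.2) (by rwa [nrm_refl hη1])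
  · intro t ht s z
    have hr : rho (fun s z => GB gp gm s (a + η * t, z.1, η • z.2)) = rho (fun s z => GB gp gm s (a + η * t, z)) := by
      ext1 y
      rcases hη with h | h
      · simp only [rho, h, one_smul]
      · simp only [rho, h, neg_smul, one_smul]
        exact integral_neg_eq_self (fun p => GB gp gm true (a + -1 * t, y, p) - GB gp gm false (a + -1 * t, y, p)) volume
    have h1 := cls_pde hg s (a + η * t) (ha t ht) z.1 (η • z.2)
    rw [cls_force hg (ha t ht) (hk t ht)] at h1
    simp only [hr]
    rw [ContinuousLinearMap.comp_apply, hφe, PhL_apply, hB t ht]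
    have e : ((η * 1, piL z.2, η • sg s • (ioL (EE 0 (rho (fun s z => GB gp gm s (a + η * t, z))) z.1) + crossL z.2 (η • B (a + η * t) z.1))) : ℝ × E2 × E3)
        = η • (1, piL (η • z.2), sg s • (ioL (EE 0 (rho (fun s z => GB gp gm s (a + η * t, z))) z.1) + crossL (η • z.2) (B (a + η * t) z.1))) := by
      simp only [Prod.smul_mk, smul_eq_mul, map_smul, smul_smul, hη2, one_smul, ContinuousLinearMap.smul_apply]
    simp only
    rw [e, map_smul, h1, smul_zero]

end
end VP
end

section
set_option linter.all false
namespace VP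
open Set Filter Topology
section
variable {B B' : ℝ → E2 → E3} {DB : ℝ → E2 → E2 →L[ℝ] E3} {b : ℝ} {gp gm : ℝ × E2 × E3 → ℝ} {T k : ℝ}

lemma cls_step (hg : IsClassicalSolution B gp gm) (hB : GoodB B' DB b) (hBB : ∀ t, 0 ≤ t → B' t = B t) {n : ℕ} {M s0 t : ℝ}
    (hM : ∀ t ∈ Icc 0 T, ∀ s, ∀ z : Z, ‖z‖ ≤ n → GB gp gm s (t, z) ≤ M) (hs0 : s0 ∈ Icc 0 T) (ht : t ∈ Icc 0 T)
    (hn : ∀ s, ∀ z : Z, n < ‖z‖ → GB gp gm s (s0, z) = 0)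
    (hk : ∀ τ ∈ uIcc s0 t, ∀ s, ∀ z : Z, k < ‖z‖ → GB gp gm s (τ, z) = 0) (s : Bool) (z : Z)
    (hz : RR n |AP n |M| T| T < ‖z‖) : GB gp gm s (t, z) = 0 := by
  obtain ⟨η, hη, hts⟩ : ∃ η : ℝ, (η = 1 ∨ η = -1) ∧ t = s0 + η * |t - s0| := by
    rcases le_total s0 t with h | h
    · exact ⟨1, Or.inl rfl, by rw [abs_of_nonneg (by linarith)]; ring⟩
    · exact ⟨-1, Or.inr rfl, by rw [abs_of_nonpos (by linarith)]; ring⟩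
  have hη1 : |η| = 1 := by rcases hη with h | h <;> simp [h]
  have hη2 : η * η = 1 := by rcases hη with h | h <;> simp [h]
  set T' := |t - s0| with hT'
  have hT'T : T' ≤ T := by rw [hT', abs_le]; constructor <;> linarith [hs0.1, hs0.2, ht.1, ht.2]
  have hwin : ∀ τ ∈ Icc 0 T', s0 + η * τ ∈ uIcc s0 t := by
    intro τ hτ
    rcases hη with h | h <;> rw [h] at hts ⊢
    · rw [uIcc_of_le (by linarith [abs_nonneg (t - s0)])]; constructor <;> linarith [hτ.1, hτ.2]
    · rw [uIcc_of_ge (by linarith [abs_nonneg (t - s0)])]; constructor <;> linarith [hτ.1, hτ.2]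
  have hpos : ∀ τ ∈ Icc 0 T', 0 ≤ s0 + η * τ := fun τ hτ => (ordConnected_Icc.uIcc_subset hs0 ht (hwin τ hτ)).1
  obtain ⟨Dg, hS⟩ := toSol (B' := fun τ x => η • B' (s0 + η * τ) x) hg hη hpos (fun τ hτ => hk _ (hwin τ hτ))
    (fun τ hτ x => by rw [hBB _ (hpos τ hτ)])
  obtain ⟨ℓ, hD⟩ : ∃ ℓ, Data (fun s z => GB gp gm s (s0 + η * 0, z.1, η • z.2)) n |M| ℓ := by
    refine Data.mk' (fun s => ?_) (fun s z => ?_) (fun s z => ?_) (fun s z hz => ?_) (Nat.cast_nonneg n)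
    · have h1 : ContDiff ℝ 1 fun z : Z => ((s0 + η * 0, z.1, η • z.2) : ℝ × E2 × E3) := by fun_prop
      exact contDiffOn_univ.1 ((cls_C1 hg s).comp h1.contDiffOn fun z _ => by
        show 0 ≤ s0 + η * 0
        simpa using hs0.1)
    · exact cls_nn hg s _ (by show 0 ≤ s0 + η * 0; simpa using hs0.1)
    · simp only [mul_zero, add_zero]
      by_cases hz : ‖z‖ ≤ n
      · exact (hM s0 hs0 s (z.1, η • z.2) (by rwa [nrm_refl hη1])).trans (le_abs_self _)
      · have := hn s (z.1, η • z.2) (by rw [nrm_refl hη1]; exact not_le.1 hz)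
        rw [this]; exact abs_nonneg _
    · simp only [mul_zero, add_zero]
      exact hn s (z.1, η • z.2) (by rwa [nrm_refl hη1])
  have := hS.apriori (abs_nonneg _) hT'T (hB.win hη1 s0) hD ⟨abs_nonneg _, le_rfl⟩ s (z.1, η • z.2) (by rwa [nrm_refl hη1])
  simp only [smul_smul, hη2, one_smul, ← hT', ← hts] at this
  exact this

lemma cls_unif (hg : IsClassicalSolution B gp gm) (hB : GoodB B' DB b) (hBB : ∀ t, 0 ≤ t → B' t = B t) (hT : 0 ≤ T) :
    ∃ k : ℝ, ∀ t ∈ Icc 0 T, ∀ s, ∀ z : Z, k < ‖z‖ → GB gp gm s (t, z) = 0 := by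
  set F : ℕ → Set ℝ := fun n => {t | ∀ s, ∀ z : Z, n < ‖z‖ → GB gp gm s (max t 0, z) = 0} with hF
  have hmem : ∀ n t, 0 ≤ t → (t ∈ F n ↔ ∀ s, ∀ z : Z, n < ‖z‖ → GB gp gm s (t, z) = 0) := fun n t ht => by
    simp only [hF, mem_setOf_eq, max_eq_left ht]
  obtain ⟨k, hk⟩ := baire (F := F) hT (fun n => by
      simp only [hF, setOf_forall]
      refine isClosed_iInter fun s => isClosed_iInter fun z => isClosed_iInter fun _ => isClosed_eq ?_ continuous_const
      exact (cls_cont hg s).comp_continuous (f := fun t : ℝ => ((max t 0, z) : ℝ × E2 × E3)) (by fun_prop) fun t => (show (0:ℝ) ≤ max t 0 from le_max_right _ _))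
    (fun n m hnm t ht s z hz => ht s z (lt_of_le_of_lt (by exact_mod_cast hnm) hz))
    (fun t ht => by
      obtain ⟨R, hR⟩ := (hg.support_bounded t ht.1).subset_closedBall 0
      refine mem_iUnion.2 ⟨⌈R⌉₊, (hmem _ _ ht.1).2 fun s z hz => ?_⟩
      by_contra hne
      have : z ∈ Metric.closedBall (0:Z) R := hR (by
        cases s
        · exact Or.inr hne
        · exact Or.inl hne)
      rw [mem_closedBall_zero_iff] at this
      exact absurd hz (not_lt.2 (this.trans (Nat.le_ceil R))))
    (fun n => by
      obtain ⟨M, hM⟩ := cls_bd hg T n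
      refine ⟨⌈RR n |AP n |M| T| T⌉₊, ?_⟩
      rintro s0 hs0 t ht hn ⟨k, hk⟩
      refine (hmem _ _ ht.1).2 fun s z hz => ?_
      refine cls_step hg hB hBB hM hs0 ht ((hmem _ _ hs0.1).1 hn) (k := k) (fun τ hτ => ?_) s z ((Nat.le_ceil _).trans_lt hz)
      exact (hmem _ _ (ordConnected_Icc.uIcc_subset hs0 ht hτ).1).1 (hk hτ))
  exact ⟨k, fun t ht => (hmem k t ht.1).1 (hk ht)⟩

lemma cls_sol (hg : IsClassicalSolution B gp gm) (hB : GoodB B' DB b) (hBB : ∀ t, 0 ≤ t → B' t = B t) (hT : 0 ≤ T) :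
    ∃ k Dg, Sol B' T k (fun τ s z => GB gp gm s (τ, z)) Dg := by
  obtain ⟨k, hk⟩ := cls_unif hg hB hBB hT
  obtain ⟨Dg, h⟩ := toSol (B' := B') (η := 1) (a := 0) (k := k) (T := T) hg (Or.inl rfl) (fun τ hτ => by simpa using hτ.1)
    (fun τ hτ => by simpa using hk τ hτ) (fun τ hτ x => by simp [hBB τ hτ.1])
  refine ⟨k, Dg, ?_⟩
  simpa using h

lemma Sol.restrict {g Dg} {T' : ℝ} (h : Sol B T k g Dg) (hT : T' ≤ T) : Sol B T' k g Dg := by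
  have hs : Icc (0:ℝ) T' ⊆ Icc 0 T := Icc_subset_Icc_right hT
  exact ⟨fun s t ht z => (h.hd s t (hs ht) z).mono (prod_mono hs subset_rfl), fun s => (h.hdc s).mono (prod_mono hs subset_rfl),
    fun t ht => h.nn t (hs ht), fun t ht => h.sup t (hs ht), fun t ht => h.pde t (hs ht)⟩

lemma initData {fp0 fm0 : Z → ℝ} (h0p : IsInitialData fp0) (h0m : IsInitialData fm0) :
    ∃ n M ℓ, Data (fun s => cond s fp0 fm0) n M ℓ := by
  have h1 : ∀ s, IsInitialData (cond s fp0 fm0) := fun s => by cases s <;> assumption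
  have h2 : ∀ s, ∃ R, ∀ z, R < ‖z‖ → cond s fp0 fm0 z = 0 := fun s => by
    obtain ⟨R, hR⟩ := (h1 s).2.1.isCompact.isBounded.subset_closedBall 0
    refine ⟨R, fun z hz => ?_⟩
    by_contra hne
    have := hR (subset_tsupport _ hne)
    rw [mem_closedBall_zero_iff] at this
    exact absurd hz (not_lt.2 this)
  have h3 : ∀ s, ∃ C, ∀ z, ‖cond s fp0 fm0 z‖ ≤ C := fun s => (h1 s).1.continuous.bounded_above_of_compact_support (h1 s).2.1
  choose R hR using h2
  choose C hC using h3
  refine ⟨max (max (R true) (R false)) 0, max (C true) (C false), ?_⟩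
  refine Data.mk' (fun s => (h1 s).1) (fun s => (h1 s).2.2) (fun s z => ?_) (fun s z hz => hR s z (lt_of_le_of_lt ?_ hz)) (le_max_right _ _)
  · refine (le_abs_self _).trans ((hC s z).trans ?_)
    cases s
    · exact le_max_right _ _
    · exact le_max_left _ _
  · refine le_trans ?_ (le_max_left _ _)
    cases s
    · exact le_max_right _ _
    · exact le_max_left _ _

/-- Global existence. -/
lemma glob {f0 : Bool → Z → ℝ} {n M ℓ : ℝ} (hD : Data f0 n M ℓ) (hB : GoodB B' DB b) (hBB : ∀ t, 0 ≤ t → B' t = B t) :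
    ∃ fp fm, IsClassicalSolution B fp fm ∧ ∀ s z, GB fp fm s (0, z) = f0 s z := by
  have hex := fun j : ℕ => existSol (T := (j : ℝ) + 1) hD hB (by positivity)
  choose g kk hS h0 hC1 hnn using hex
  have hag : ∀ i j : ℕ, ∀ t : ℝ, 0 ≤ t → t ≤ i + 1 → t ≤ j + 1 → g i t = g j t := by
    intro i j t ht hi hj
    exact ((hS i).restrict hi).unique ((hS j).restrict hj) ht hB (by rw [h0]; exact hD) (by rw [h0, h0]) ⟨ht, le_rfl⟩
  set f : Bool → ℝ × E2 × E3 → ℝ := fun s q => g ⌊q.1⌋₊ q.1 s q.2 with hf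
  have hfj : ∀ (j : ℕ) (t : ℝ), 0 ≤ t → t ≤ j + 1 → ∀ s z, f s (t, z) = g j t s z := by
    intro j t ht hj s z
    simp only [hf]
    rw [hag _ j t ht (Nat.lt_floor_add_one t).le hj]
  have hev : ∀ s, ∀ q ∈ S, f s =ᶠ[𝓝[S] q] fun w : ℝ × Z => g ⌊q.1⌋₊ w.1 s w.2 := by
    intro s q hq
    have h1 : {w : ℝ × E2 × E3 | w.1 < ⌊q.1⌋₊ + 1} ∈ 𝓝 q := (isOpen_lt continuous_fst continuous_const).mem_nhds (Nat.lt_floor_add_one q.1)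
    filter_upwards [self_mem_nhdsWithin, mem_nhdsWithin_of_mem_nhds h1] with w hw hw1
    exact hfj _ w.1 hw (le_of_lt hw1) s w.2
  have hGB : ∀ s, GB (f true) (f false) s = f s := fun s => by cases s <;> rfl
  have hsm : ∀ s, ContDiffOn ℝ 1 (f s) S := fun s q hq =>
    ((hC1 ⌊q.1⌋₊ s).contDiffAt.contDiffWithinAt).congr_of_eventuallyEq (hev s q hq) ((hev s q hq).self_of_nhdsWithin hq)
  have hmem : ∀ t : ℝ, 0 ≤ t → t ∈ Icc (0:ℝ) (⌊t⌋₊ + 1) := fun t ht => ⟨ht, (Nat.lt_floor_add_one t).le⟩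
  have hpde : ∀ s t, 0 ≤ t → ∀ x p, fderivWithin ℝ (f s) S (t, x, p) (1, e2 (p 0) (p 1), force (f true) (f false) B (sg s) t x p) = 0 := by
    intro s t ht x p
    set j := ⌊t⌋₊ with hj
    have e1 : ∀ s z, f s (t, z) = g j t s z := hfj j t ht (hmem t ht).2
    obtain ⟨m, hm0, hm1, -⟩ := (hS j).bdd (by positivity)
    have hcl := cl_eq (hmem t ht)
    have hgc : ∀ s, Continuous (g j t s) := fun s => (hC1 j s).continuous.comp (f := fun z : Z => (t, z)) (by fun_prop)
    have hgs := (hS j).sup t (hmem t ht)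
    have hF := force_eq (fp := f true) (fm := f false) (t := t) (r := rho (g j t)) (m := 2 * m * v3 (kk j)) (R := kk j)
      (fun y => by simp only [chargeDensity, e1]; rfl)
      (by
        have := rho_cont (X := Unit) (f := fun _ => g j t) (fun s => (hgc s).comp continuous_snd) (fun _ => hgs)
        exact this.comp (f := fun y : E2 => ((), y)) (by fun_prop))
      (fun y => by
        have := rho_sub (f := g j t) (g := fun _ _ => 0) (R := kk j) (δ := m) (x := y) (y := y) hgc
          (fun s => continuous_const) hgs (fun _ _ _ => rfl) (fun s p => by
            rw [sub_zero]; have := hm1 t s (y, p); rwa [hcl] at this)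
        simpa [rho] using this)
      (fun y => rho_supp hgs y) B (sg s) x p
    rw [hF, (hev s (t, x, p) ht).fderivWithin_eq ((hev s (t, x, p) ht).self_of_nhdsWithin ht),
      fderivWithin_eq_fderiv (S_ud _ ht) ((hC1 _ s).differentiable one_ne_zero _)]
    have := (hS j).pde t (hmem t ht) s (x, p)
    rw [hBB t ht] at this
    exact this
  refine ⟨f true, f false, ⟨hsm _, hsm _, fun z _ => hnn _ _ _ _, fun z _ => hnn _ _ _ _, fun t ht => ?_, hpde true, hpde false⟩, fun s z => ?_⟩
  · refine (Metric.isBounded_closedBall (x := (0:Z)) (r := kk ⌊t⌋₊)).subset fun z hz => ?_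
    rw [mem_closedBall_zero_iff]
    by_contra hc
    have := fun s => (hS ⌊t⌋₊).sup t (hmem t ht) s z (not_le.1 hc)
    rcases hz with hz | hz
    · exact hz (this true)
    · exact hz (this false)
  · rw [hGB, hfj 0 0 le_rfl (by norm_num), h0]

lemma main {fp0 fm0 : Z → ℝ} (h0p : IsInitialData fp0) (h0m : IsInitialData fm0) {A : ℝ → E2 → E3} (hA : IsAdmissiblePotential A) :
    ∃ fp fm : ℝ × E2 × E3 → ℝ,
      (IsClassicalSolution (fun t => curl2 (A t)) fp fm ∧
        (∀ x p, fp (0, x, p) = fp0 (x, p)) ∧ (∀ x p, fm (0, x, p) = fm0 (x, p))) ∧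
      ∀ gp gm : ℝ × E2 × E3 → ℝ,
        IsClassicalSolution (fun t => curl2 (A t)) gp gm →
        (∀ x p, gp (0, x, p) = fp0 (x, p)) → (∀ x p, gm (0, x, p) = fm0 (x, p)) →
        ∀ t : ℝ, 0 ≤ t → ∀ x p, gp (t, x, p) = fp (t, x, p) ∧ gm (t, x, p) = fm (t, x, p) := by
  obtain ⟨DB, b, hB⟩ := goodB hA
  obtain ⟨n, M, ℓ, hD⟩ := initData h0p h0m
  have hBB : ∀ t : ℝ, 0 ≤ t → (fun t => curl2 (A (max t 0))) t = (fun t => curl2 (A t)) t := fun t ht => by simp only [max_eq_left ht]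
  obtain ⟨fp, fm, hf, hf0⟩ := glob hD hB hBB
  refine ⟨fp, fm, ⟨hf, fun x p => hf0 true (x, p), fun x p => hf0 false (x, p)⟩, fun gp gm hg hp hm t ht x p => ?_⟩
  obtain ⟨k, Dg, h1⟩ := cls_sol hg hB hBB ht
  obtain ⟨k', Dg', h2⟩ := cls_sol hf hB hBB ht
  have e1 : (fun s (z : Z) => GB fp fm s (0, z)) = fun s => cond s fp0 fm0 := by ext1 s; ext1 z; exact hf0 s z
  have e2 : (fun s (z : Z) => GB gp gm s (0, z)) = fun s => cond s fp0 fm0 := by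
    ext1 s; ext1 z
    cases s
    · exact hm z.1 z.2
    · exact hp z.1 z.2
  have := h1.unique h2 ht hB (n := n) (M := M) (ℓ := ℓ) (by rw [e2]; exact hD) (by rw [e1, e2]) ⟨ht, le_rfl⟩
  exact ⟨congrFun (congrFun this true) (x, p), congrFun (congrFun this false) (x, p)⟩
end
end VP
end

/-- Global well-posedness of the two-and-one-half dimensional Vlasov–Poisson system with an
external magnetic field `B = curl A`: for any initial data `(f̊⁺, f̊⁻) ∈ C¹_c(ℝ⁵;[0,∞))²`
there exists a classical solution on `[0,∞)` attaining the initial data, and it is unique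
on `[0,∞)`. -/
theorem stmt8 (fp0 fm0 : E2 × E3 → ℝ) (h0p : IsInitialData fp0) (h0m : IsInitialData fm0)
    (A : ℝ → E2 → E3) (hA : IsAdmissiblePotential A) :
    ∃ fp fm : ℝ × E2 × E3 → ℝ,
      (IsClassicalSolution (fun t => curl2 (A t)) fp fm ∧
        (∀ x p, fp (0, x, p) = fp0 (x, p)) ∧ (∀ x p, fm (0, x, p) = fm0 (x, p))) ∧
      ∀ gp gm : ℝ × E2 × E3 → ℝ,
        IsClassicalSolution (fun t => curl2 (A t)) gp gm →
        (∀ x p, gp (0, x, p) = fp0 (x, p)) → (∀ x p, gm (0, x, p) = fm0 (x, p)) →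
        ∀ t : ℝ, 0 ≤ t → ∀ x p, gp (t, x, p) = fp (t, x, p) ∧ gm (t, x, p) = fm (t, x, p) := by
  exact VP.main h0p h0m hA
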